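/- Define X̄_{β,s}:=ħ·X_{β,s} and let Ẏ_ħ^>(g) be the ℚ[ħ]-subalgebra of Y_ħ^>(g) generated by {X̄_{β,s} : β∈Δ⁺, s∈ℕ}. Then: (a) Ẏ_ħ^>(g) does not depend on the choices of decompositions used in defining the root vectors X_{β,s}; and (b) for any fixed such choices, the ordered monomials X̄_h (the products of the X̄_{β,s}^{h(β,s)} taken from left to right in increasing order of (β,s)), for h∈𝓗, form a basis of Ẏ_ħ^>(g) as a ℚ[ħ]-module. -/

import Mathlib

set_option synthInstance.maxHeartbeats 1000000
set_option maxHeartbeats 1600000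

noncomputable section
open scoped BigOperators DirectSum

/-! ### Base field ℚ(v) and quantum numbers -/

/-- the base field `ℚ(v)`. -/
abbrev KK : Type := RatFunc ℚ
/-- the variable `v ∈ ℚ(v)`. -/
def vv : KK := RatFunc.X
/-- integer powers of `v`. -/
def vpow (m : ℤ) : KK := vv ^ m
/-- the quantum integer `[m]_u = (uᵐ - u⁻ᵐ)/(u - u⁻¹)`. -/
def qInt (u : KK) (m : ℕ) : KK := (u ^ (m : ℤ) - u ^ (-(m : ℤ))) / (u - u⁻¹)
/-- the quantum factorial `[m]_u!`. -/
def qFact (u : KK) (m : ℕ) : KK := ∏ k ∈ Finset.range m, qInt u (k + 1)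
/-- the quantum binomial coefficient. -/
def qBinom (u : KK) (m k : ℕ) : KK := qFact u m / (qFact u k * qFact u (m - k))
/-- `⟨m⟩_v = vᵐ - v⁻ᵐ`. -/
def qBrack (m : ℕ) : KK := vpow (m : ℤ) - vpow (-(m : ℤ))
/-- the sign `ε ∈ {+,-}` as `±1`. -/
def sgn (ε : Bool) : ℤ := if ε then 1 else -1
/-- `l` is an integer power of `v`. -/
def IsVpow (l : KK) : Prop := ∃ m : ℤ, l = vpow m

/-! ### Cartan data of types `C_n` and `D_n` (1-based indices) -/

/-- the Cartan matrix of type `C_n` (1-based indices). -/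
def aC (n i j : ℕ) : ℤ :=
  if i = j then 2 else if i + 1 = n ∧ j = n then -2
  else if i + 1 = j ∨ j + 1 = i then -1 else 0
/-- the symmetrizing integers `d_i` of type `C_n`. -/
def dC (n i : ℕ) : ℕ := if i = n then 2 else 1
/-- the Cartan matrix of type `D_n` (1-based indices). -/
def aD (n i j : ℕ) : ℤ :=
  if i = j then 2
  else if (i + 1 = j ∧ j + 1 ≤ n) ∨ (j + 1 = i ∧ i + 1 ≤ n) then -1
  else if (i + 2 = n ∧ j = n) ∨ (j + 2 = n ∧ i = n) then -1 else 0
/-- the symmetrizing integers `d_i` of type `D_n` (all equal to `1`). -/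
def dD (n i : ℕ) : ℕ := 1

/-! ### The positive subalgebra of the quantum loop algebra, for Cartan data `(A, Dd)` -/

section Ualg
variable (n : ℕ) (A : ℕ → ℕ → ℤ) (Dd : ℕ → ℕ)

/-- the free `ℚ(v)`-algebra on generators `e_{i,r}`, `i ∈ I`, `r ∈ ℤ`. -/
abbrev FA := FreeAlgebra KK (Fin n × ℤ)
/-- the free generator `e_{i,r}`. -/
def fg (i : Fin n) (r : ℤ) : FA n := FreeAlgebra.ι KK (i, r)

/-- the `z^{-r₁}⋯z^{-r_m}w^{-t}`-coefficient of the Serre relation between colors `i ≠ j`. -/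
def serreElt (i j : Fin n) (m : ℕ) (r : Fin m → ℤ) (t : ℤ) : FA n :=
  ∑ σ : Equiv.Perm (Fin m), ∑ k ∈ Finset.range (m + 1),
    ((-1 : KK) ^ k * qBinom (vpow (Dd (i.1 + 1))) m k) •
      (((List.ofFn fun l => fg n i (r (σ l))).take k
        ++ fg n j t :: (List.ofFn fun l => fg n i (r (σ l))).drop k).prod)

/-- the defining relations of `U_v^>(Lg)` in the new Drinfeld realization: the coefficients of
`(z - v_i^{a_ij} w) e_i(z) e_j(w) = (v_i^{a_ij} z - w) e_j(w) e_i(z)` and of the Serre relations. -/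
inductive URel : FA n → FA n → Prop
  | loop (i j : Fin n) (r s : ℤ) :
      URel (fg n i (r + 1) * fg n j s
             - vpow ((Dd (i.1 + 1) : ℤ) * A (i.1 + 1) (j.1 + 1)) • (fg n i r * fg n j (s + 1)))
           (vpow ((Dd (i.1 + 1) : ℤ) * A (i.1 + 1) (j.1 + 1)) • (fg n j s * fg n i (r + 1))
             - fg n j (s + 1) * fg n i r)
  | serre (i j : Fin n) (hij : i ≠ j) (r : Fin (1 - A (i.1 + 1) (j.1 + 1)).toNat → ℤ) (t : ℤ) :
      URel (serreElt n Dd i j _ r t) 0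

/-- the positive subalgebra `U_v^>(Lg)` of the quantum loop algebra. -/
abbrev UA := RingQuot (URel n A Dd)
/-- the generator `e_{i,r}` of `U_v^>(Lg)`. -/
def ug (i : Fin n) (r : ℤ) : UA n A Dd := RingQuot.mkAlgHom KK (URel n A Dd) (fg n i r)
/-- the generator `e_{i,r}` with a 1-based index `1 ≤ i ≤ n` (and junk value `0` otherwise). -/
def g1 (i : ℕ) (r : ℤ) : UA n A Dd := if h : 1 ≤ i ∧ i ≤ n then ug n A Dd ⟨i - 1, by omega⟩ r else 0

end Ualg

/-! ### `q`-brackets, ordered monomials, and ℤ[v,v⁻¹]-forms -/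

section Aux
variable {B : Type} [Ring B] [Module KK B]

/-- the `u`-commutator `[x,y]_u = xy - u · yx`. -/
def qcm (u : KK) (x y : B) : B := x * y - u • (y * x)

/-- the iterated `q`-bracket `[⋯[[g i₁ s₁, g i₂ s₂]_{λ₁}, g i₃ s₃]_{λ₂}, ⋯]_{λ_{ℓ-1}}`. -/
def chainE (g : ℕ → ℤ → B) (w : List ℕ) (ss : List ℤ) (ls : List KK) : B :=
  match w, ss with
  | i :: w', s :: ss' =>
      ((w'.zip ss').zip ls).foldl
        (fun acc p => acc * g p.1.1 p.1.2 - p.2 • (g p.1.1 p.1.2 * acc)) (g i s)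
  | _, _ => 0
end Aux

section Mon
variable {B : Type} [Ring B] {ι : Type} [LinearOrder ι]
/-- the ordered monomial `∏→ (E p)^(h p)`, the product taken in increasing order of `p`. -/
def ordMon (E : ι → B) (h : ι →₀ ℕ) : B := ((h.support.sort (· ≤ ·)).map (fun p => E p ^ h p)).prod
end Mon

/-- the subring `ℤ[v,v⁻¹] ⊆ ℚ(v)`. -/
def Rint : Subring KK := Subring.closure {vv, vv⁻¹}

section Forms
variable {B : Type} [Ring B] [Algebra KK B]
/-- the `ℤ[v,v⁻¹]`-subalgebra of a `ℚ(v)`-algebra generated by a set `X`, realized as the subring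
generated by `X` together with the central scalars `v^{±1}`. -/
def zvForm (X : Set B) : Subring B :=
  Subring.closure ({algebraMap KK B vv, algebraMap KK B vv⁻¹} ∪ X)
end Forms

/-! ### Positive roots of type `C_n` with the fixed convex (lexicographic) order -/

section RootsC
variable (n : ℕ)

/-- Positive roots of type `C_n`, encoded as lexicographically ordered pairs `(i,t)`:
`[i,i+t]` for `i+t<n` or `i=n`; `[i,n,i]` for `i+t=n`, `i<n`; `[i,n]` for `i+t=n+1`;
`[i,n,j]` with `j = 2n+1-i-t` for `i+t ≥ n+2`.  The induced linear order is exactly the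
convex order coming from standard Lyndon words. -/
def IsPosRootC (p : Fin (n + 1) ×ₗ Fin (2 * n + 1)) : Prop :=
  1 ≤ ((ofLex p).1 : ℕ) ∧ (((ofLex p).1 : ℕ) = n → ((ofLex p).2 : ℕ) = 0) ∧
    ((ofLex p).2 : ℕ) + 2 * ((ofLex p).1 : ℕ) ≤ 2 * n

instance : DecidablePred (IsPosRootC n) := fun p => by unfold IsPosRootC; infer_instance

/-- the set `Δ⁺` of positive roots of type `C_n`, with its convex linear order. -/
abbrev PosRootC := {p : Fin (n + 1) ×ₗ Fin (2 * n + 1) // IsPosRootC n p}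

variable {n}
/-- the first index `i` of a positive root. -/
def ri (β : PosRootC n) : ℕ := ((ofLex β.1).1 : ℕ)
/-- the offset `t` of a positive root within its block. -/
def rt (β : PosRootC n) : ℕ := ((ofLex β.1).2 : ℕ)

/-- multiplicity of `α_c` (1-based color `c`) in the positive root `β` (type `C_n`). -/
def nuC (β : PosRootC n) (c : ℕ) : ℕ :=
  let i := ri β; let t := rt β
  if i + t < n ∨ i = n then (if i ≤ c ∧ c ≤ i + t then 1 else 0)
  else if i + t = n then (if i ≤ c ∧ c ≤ n - 1 then 2 else if c = n then 1 else 0)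
  else if i + t = n + 1 then (if i ≤ c ∧ c ≤ n then 1 else 0)
  else (if i ≤ c ∧ c < 2 * n + 1 - i - t then 1
        else if 2 * n + 1 - i - t ≤ c ∧ c ≤ n - 1 then 2
        else if c = n then 1 else 0)

/-- standard Lyndon word (list of 1-based simple-root indices) of `β` (type `C_n`). -/
def wordC (β : PosRootC n) : List ℕ :=
  let i := ri β; let t := rt β
  if i + t < n ∨ i = n then List.range' i (t + 1)
  else if i + t = n then List.range' i (n - i) ++ List.range' i (n - i) ++ [n]
  else if i + t = n + 1 then List.range' i (n - i + 1)
  else List.range' i (n - i + 1) ++ (List.range' (2 * n + 1 - i - t) (n - (2 * n + 1 - i - t))).reverse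

/-- the height `|β|` of a positive root (type `C_n`). -/
def heightC (β : PosRootC n) : ℕ := (wordC β).length

/-- `β` is a root of the form `[i,n,i]`. -/
def isINI (β : PosRootC n) : Prop := ri β + rt β = n ∧ ri β < n
instance (β : PosRootC n) : Decidable (isINI β) := by unfold isINI; infer_instance
end RootsC

/-! ### Positive roots of type `D_n` with the fixed convex (lexicographic) order -/

section RootsD
variable (n : ℕ)

/-- Positive roots of type `D_n`, encoded as lexicographically ordered pairs `(i,t)`:
`[i,i+t]` for `i+t<n` or `i=n`; `[i,n]` for `i+t=n`; `[i,n,n-1]` for `i+t=n+1`;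
`[i,n,j]` with `j = 2n-i-t` for `i+t ≥ n+2`.  The induced linear order is exactly the
convex order coming from standard Lyndon words. -/
def IsPosRootD (p : Fin (n + 1) ×ₗ Fin (2 * n + 1)) : Prop :=
  1 ≤ ((ofLex p).1 : ℕ) ∧ (n - 1 ≤ ((ofLex p).1 : ℕ) → ((ofLex p).2 : ℕ) = 0) ∧
    (((ofLex p).2 : ℕ) = 0 ∨ ((ofLex p).2 : ℕ) + 2 * ((ofLex p).1 : ℕ) + 1 ≤ 2 * n)

instance : DecidablePred (IsPosRootD n) := fun p => by unfold IsPosRootD; infer_instance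

/-- the set `Δ⁺` of positive roots of type `D_n`, with its convex linear order. -/
abbrev PosRootD := {p : Fin (n + 1) ×ₗ Fin (2 * n + 1) // IsPosRootD n p}

variable {n}
/-- the first index `i` of a positive root. -/
def riD (β : PosRootD n) : ℕ := ((ofLex β.1).1 : ℕ)
/-- the offset `t` of a positive root within its block. -/
def rtD (β : PosRootD n) : ℕ := ((ofLex β.1).2 : ℕ)

/-- multiplicity of `α_c` (1-based color `c`) in the positive root `β` (type `D_n`). -/
def nuD (β : PosRootD n) (c : ℕ) : ℕ :=
  let i := riD β; let t := rtD β
  if i + t < n ∨ i = n then (if i ≤ c ∧ c ≤ i + t then 1 else 0)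
  else if i + t = n then (if (i ≤ c ∧ c ≤ n - 2) ∨ c = n then 1 else 0)
  else if i + t = n + 1 then (if i ≤ c ∧ c ≤ n then 1 else 0)
  else (if i ≤ c ∧ c < 2 * n - i - t then 1
        else if 2 * n - i - t ≤ c ∧ c ≤ n - 2 then 2
        else if c = n - 1 ∨ c = n then 1 else 0)

/-- standard Lyndon word (list of 1-based simple-root indices) of `β` (type `D_n`). -/
def wordD (β : PosRootD n) : List ℕ :=
  let i := riD β; let t := rtD β
  if i + t < n ∨ i = n then List.range' i (t + 1)
  else if i + t = n then List.range' i (n - 1 - i) ++ [n]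
  else if i + t = n + 1 then List.range' i (n - 1 - i) ++ [n, n - 1]
  else List.range' i (n - 1 - i) ++ [n] ++ (List.range' (2 * n - i - t) (n - (2 * n - i - t))).reverse

/-- the height `|β|` of a positive root (type `D_n`). -/
def heightD (β : PosRootD n) : ℕ := (wordD β).length

/-- `β` is a root of the form `[i,n,j]` with `i < j ≤ n-2`. -/
def isSpecD (β : PosRootD n) : Prop := n + 2 ≤ riD β + rtD β
instance (β : PosRootD n) : Decidable (isSpecD β) := by unfold isSpecD; infer_instance
end RootsD

/-! ### The positive subalgebra of the Yangian, for Cartan data `(A, Dd)` -/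

/-- the base ring `ℚ[ħ]`. -/
abbrev RH : Type := Polynomial ℚ
/-- the formal parameter `ħ`. -/
def hbar : RH := Polynomial.X

section Yang
variable (n : ℕ) (A : ℕ → ℕ → ℤ) (Dd : ℕ → ℕ)

/-- the free `ℚ[ħ]`-algebra on generators `x_{i,r}`, `i ∈ I`, `r ∈ ℕ`. -/
abbrev FAY := FreeAlgebra RH (Fin n × ℕ)
/-- the free generator `x_{i,r}`. -/
def fy (i : Fin n) (r : ℕ) : FAY n := FreeAlgebra.ι RH (i, r)

/-- the defining relations of the positive subalgebra `Y_ħ^>(g)` of the Yangian. -/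
inductive YRel : FAY n → FAY n → Prop
  | loop (i j : Fin n) (r s : ℕ) :
      YRel ((fy n i (r + 1) * fy n j s - fy n j s * fy n i (r + 1))
              - (fy n i r * fy n j (s + 1) - fy n j (s + 1) * fy n i r))
           ((Polynomial.C (((Dd (i.1 + 1) : ℚ) * (A (i.1 + 1) (j.1 + 1) : ℚ)) / 2) * hbar) •
              (fy n i r * fy n j s + fy n j s * fy n i r))
  | serre (i j : Fin n) (hij : i ≠ j)
      (ss : Fin (1 - A (i.1 + 1) (j.1 + 1)).toNat → ℕ) (r : ℕ) :
      YRel (∑ σ : Equiv.Perm (Fin (1 - A (i.1 + 1) (j.1 + 1)).toNat),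
              (List.ofFn fun l => fy n i (ss (σ l))).foldr (fun a b => a * b - b * a) (fy n j r)) 0

/-- the positive subalgebra `Y_ħ^>(g)` of the Yangian. -/
abbrev YA := RingQuot (YRel n A Dd)
/-- the generator `x_{i,r}` of `Y_ħ^>(g)`. -/
def yg (i : Fin n) (r : ℕ) : YA n A Dd := RingQuot.mkAlgHom RH (YRel n A Dd) (fy n i r)
/-- the generator `x_{i,r}` with a 1-based index `1 ≤ i ≤ n` (and junk value `0` otherwise). -/
def gy1 (i : ℕ) (r : ℕ) : YA n A Dd :=
  if h : 1 ≤ i ∧ i ≤ n then yg n A Dd ⟨i - 1, by omega⟩ r else 0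
end Yang

/-- the iterated commutator `[⋯[[g i₁ s₁, g i₂ s₂], g i₃ s₃], ⋯, g i_ℓ s_ℓ]`. -/
def chainY {B : Type} [Ring B] (g : ℕ → ℕ → B) (w : List ℕ) (ss : List ℕ) : B :=
  match w, ss with
  | i :: w', s :: ss' =>
      (w'.zip ss').foldl (fun acc p => acc * g p.1 p.2 - g p.1 p.2 * acc) (g i s)
  | _, _ => 0

section YangC
variable (n : ℕ)
/-- the positive subalgebra of the Yangian of type `C_n`. -/
abbrev YC := YA n (aC n) (dC n)
/-- generators with 1-based indices (type `C_n`). -/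
def genYC : ℕ → ℕ → YC n := gy1 n (aC n) (dC n)

variable {n}
/-- the specific root vector `X̃_{β,s}` of type `C_n`. -/
def xTildeC (β : PosRootC n) (s : ℕ) : YC n :=
  if isINI β then
    (let Ach := chainY (genYC (n := n)) (List.range' (ri β) (n - ri β))
        (List.replicate (n - ri β) 0)
     let Bch := Ach * genYC (n := n) n s - genYC (n := n) n s * Ach
     Ach * Bch - Bch * Ach)
  else chainY (genYC (n := n)) (wordC β) (s :: List.replicate ((wordC β).length - 1) 0)

/-- `E` is a Yangian root vector `X_{β,s}` for a root of "chain" type, for some decomposition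
`s = s₁ + ⋯ + s_ℓ` with `s_k ∈ ℕ`. -/
def IsRVYCchain (β : PosRootC n) (s : ℕ) (E : YC n) : Prop :=
  ∃ ss : List ℕ, ss.length = (wordC β).length ∧ ss.sum = s ∧
    E = chainY (genYC (n := n)) (wordC β) ss

/-- `E` is a Yangian root vector `X_{β,s}` of type `C_n` for some choice of decompositions. -/
def IsRVYC (β : PosRootC n) (s : ℕ) (E : YC n) : Prop :=
  if isINI β then
    ∃ (β₁ β₂ : PosRootC n) (s₁ s₂ : ℕ) (E₁ E₂ : YC n),
      (ri β₁ = ri β ∧ ri β₁ + rt β₁ + 1 = n) ∧ (ri β₂ = ri β ∧ ri β₂ + rt β₂ = n + 1) ∧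
      IsRVYCchain β₁ s₁ E₁ ∧ IsRVYCchain β₂ s₂ E₂ ∧
      s = s₁ + s₂ ∧ E = E₁ * E₂ - E₂ * E₁
  else IsRVYCchain β s E
end YangC

section YangD
variable (n : ℕ)
/-- the positive subalgebra of the Yangian of type `D_n`. -/
abbrev YD := YA n (aD n) (dD n)
/-- generators with 1-based indices (type `D_n`). -/
def genYD : ℕ → ℕ → YD n := gy1 n (aD n) (dD n)

variable {n}
/-- the specific root vector `X̃_{β,s}` of type `D_n`. -/
def xTildeD (β : PosRootD n) (s : ℕ) : YD n :=
  chainY (genYD (n := n)) (wordD β) (s :: List.replicate ((wordD β).length - 1) 0)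

/-- `E` is a Yangian root vector `X_{β,s}` of type `D_n` for some choice of decompositions. -/
def IsRVYD (β : PosRootD n) (s : ℕ) (E : YD n) : Prop :=
  ∃ ss : List ℕ, ss.length = (wordD β).length ∧ ss.sum = s ∧
    E = chainY (genYD (n := n)) (wordD β) ss
end YangD


/-- the positive subalgebra `Ẏ_ħ^>(g)` of the Drinfeld–Gavarini dual attached to a choice `X`
of root vectors: the `ℚ[ħ]`-subalgebra generated by the elements `X̄_{β,s} = ħ·X_{β,s}`
(type `C_n`). -/
def dgFormC {n : ℕ} (X : PosRootC n × ℕ → YC n) : Subalgebra RH (YC n) :=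
  Algebra.adjoin RH (Set.range fun p => hbar • X p)

/-- the positive subalgebra `Ẏ_ħ^>(g)` of the Drinfeld–Gavarini dual (type `D_n`). -/
def dgFormD {n : ℕ} (X : PosRootD n × ℕ → YD n) : Subalgebra RH (YD n) :=
  Algebra.adjoin RH (Set.range fun p => hbar • X p)

/-! ### Loop-type relations in a Lie ring -/

section LieRel
variable {L : Type*} [LieRing L]

/-- The relations satisfied by the generators of the positive half of a current algebra, with
Cartan matrix `a`. -/
structure CurrentRel (a : ℕ → ℕ → ℤ) (x : ℕ → ℕ → L) : Prop where
  loop : ∀ i j r s, ⁅x i (r + 1), x j s⁆ = ⁅x i r, x j (s + 1)⁆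
  diag : ∀ i r s, ⁅x i r, x i s⁆ = 0
  comm : ∀ i j r s, i ≠ j → a i j = 0 → ⁅x i r, x j s⁆ = 0
  serre₁ : ∀ i j r s t, a i j = -1 → ⁅⁅x j t, x i r⁆, x i s⁆ = 0
  serre₂ : ∀ i j r s u t, a i j = -2 → ⁅⁅⁅x j t, x i r⁆, x i s⁆, x i u⁆ = 0

lemma lie_lie_right (u v w : L) : ⁅u, ⁅v, w⁆⁆ = ⁅⁅u, v⁆, w⁆ - ⁅⁅u, w⁆, v⁆ := by
  rw [leibniz_lie u v w, sub_eq_add_neg, lie_skew, ← lie_skew v ⁅u, w⁆]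

/-- all members of the family `v` commute with all generators of color `c`. -/
def Kills (x : ℕ → ℕ → L) (v : ℕ → L) (c : ℕ) : Prop := ∀ s r, ⁅v s, x c r⁆ = 0

/-- bracketing the family `v` with the generators of color `c` yields the family `w`. -/
def Step (x : ℕ → ℕ → L) (v : ℕ → L) (c : ℕ) (w : ℕ → L) : Prop := ∀ s r, ⁅v s, x c r⁆ = w (s + r)

variable {a : ℕ → ℕ → ℤ} {x : ℕ → ℕ → L} {u v w v' v'' v''' : ℕ → L} {c d : ℕ}

lemma CurrentRel.shift (h : CurrentRel a x) (i j r s t : ℕ) :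
    ⁅x i r, x j (s + t)⁆ = ⁅x i (r + t), x j s⁆ := by
  induction t generalizing s with
  | zero => rfl
  | succ t ih =>
    rw [show s + (t + 1) = (s + 1) + t by omega, ih, show r + (t + 1) = (r + t) + 1 by omega,
      h.loop]

lemma CurrentRel.step_base (h : CurrentRel a x) (i c : ℕ) :
    Step x (x i) c (fun s => ⁅x i s, x c 0⁆) := fun s r => by
  simpa using h.shift i c s 0 r

lemma Kills.of_step_comm (hcd : ∀ r s, ⁅x d r, x c s⁆ = 0) (hs : Step x v d w)
    (hz : Kills x v c) : Kills x w c := fun s r => by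
  have h1 := lie_lie_right (v s) (x d 0) (x c r)
  rw [hcd, hs, hz s r] at h1
  simpa using h1.symm

lemma CurrentRel.step_next (h : CurrentRel a x) (hs : Step x u d v) (hz : Kills x u c) :
    Step x v c (fun s => ⁅v s, x c 0⁆) := fun s r => by
  have key : ∀ s r, ⁅v s, x c r⁆ = ⁅u 0, ⁅x d s, x c r⁆⁆ := fun s r => by
    rw [lie_lie_right, hz, hs]; simp
  have := h.shift d c s 0 r
  rw [zero_add] at this
  simp only [key, this]

lemma CurrentRel.kills_repeat (h : CurrentRel a x) (ha : a c d = -1) (hz : Kills x v c)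
    (h1 : Step x v d v') (h2 : Step x v' c v'') : Kills x v'' c := fun s r => by
  have h0 := congrArg (fun y => ⁅v s, y⁆) (h.serre₁ c d 0 r 0 ha)
  simp only [lie_lie_right, hz s _, h1 s _, h2 _ _] at h0
  simpa using h0

variable [IsAddTorsionFree L]

lemma eq_zero_of_eq_neg_self {y : L} (h : y = -y) : y = 0 := by
  have : 2 • y = 0 := by rw [two_nsmul]; nth_rewrite 1 [h]; simp
  simpa using this

lemma CurrentRel.kills_back (h : CurrentRel a x) (ha : a c d = -1) (hz : Kills x v d)
    (h1 : Step x v c v') (hz' : Kills x v' c) (h2 : Step x v' d v'') : Kills x v'' c := by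
  have key : ∀ s r t, ⁅v'' (s + r), x c t⁆ = -⁅v'' (s + t), x c r⁆ := fun s r t => by
    have h0 := congrArg (fun y => ⁅v s, y⁆) (h.serre₁ c d r t 0 ha)
    simp only [lie_lie_right, hz s _, h1 s _, h2 _ _, hz' _ _] at h0
    have h3 : -⁅v'' (s + r), x c t⁆ - ⁅v'' (s + t), x c r⁆ = 0 := by simpa using h0
    rw [sub_eq_zero] at h3
    rw [← h3, neg_neg]
  have hd : ∀ s r, ⁅v'' (s + r), x c r⁆ = 0 := fun s r => eq_zero_of_eq_neg_self (key s r r)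
  intro s r
  rcases le_total r s with hrs | hrs
  · have := hd (s - r) r
    rwa [Nat.sub_add_cancel hrs] at this
  · have h4 := key 0 s r
    have h5 := hd (r - s) s
    rw [Nat.sub_add_cancel hrs] at h5
    simpa [h5] using h4

lemma CurrentRel.kills_double (h : CurrentRel a x) (ha : a c d = -2) (hz : Kills x v d)
    (h1 : Step x v c v') (hz' : Kills x v' c) (h2 : Step x v' d v'') (h3 : Step x v'' c v''') :
    Kills x v''' c := by
  have key : ∀ s r, ⁅v''' s, x c r⁆ = ⁅v''' (s + r), x c 0⁆ := fun s r => by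
    have h0 := lie_lie_right (v'' s) (x c 0) (x c r)
    rw [h.diag, lie_zero, h3, h3, eq_comm, sub_eq_zero] at h0
    simpa using h0
  intro s r
  have h0 := congrArg (fun y => ⁅v 0, y⁆) (h.serre₂ c d r s 0 0 ha)
  simp only [lie_lie_right, hz _ _, h1 _ _, h2 _ _, hz' _ _, h3 _ _] at h0
  simp only [key, h3 _ _, Nat.zero_add, Nat.add_zero, zero_lie, zero_sub, sub_zero, lie_zero,
    sub_lie, neg_lie] at h0
  rw [key]
  have h5 : 3 • ⁅v''' (s + r), x c 0⁆ = 0 := by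
    rw [add_comm r s] at h0
    have : -(3 • ⁅v''' (s + r), x c 0⁆) = 0 := by rw [← h0]; abel
    simpa using this
  simpa using h5

end LieRel

section TypeC
variable {L : Type*} [LieRing L]

/-- the families of iterated brackets along the sequence of colors `w`. -/
def pathFam (x : ℕ → ℕ → L) (w : ℕ → ℕ) : ℕ → ℕ → L
  | 0, s => x (w 0) s
  | p + 1, s => ⁅pathFam x w p s, x (w (p + 1)) 0⁆

/-- the colors `i, …, n-1, n, n-1, …, i`. -/
def colC (n i p : ℕ) : ℕ := if i + p ≤ n then i + p else 2 * n - i - p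

lemma aC_cases (n i j : ℕ) : (i = j ∧ aC n i j = 2) ∨ (i + 1 = n ∧ j = n ∧ aC n i j = -2) ∨
    ((i + 1 = j ∧ j ≠ n ∨ j + 1 = i) ∧ aC n i j = -1) ∨
    (i ≠ j ∧ i + 1 ≠ j ∧ j + 1 ≠ i ∧ aC n i j = 0) := by
  unfold aC
  split_ifs <;> omega

lemma aC_eq_neg_one {n i j : ℕ} (h : i + 1 = j ∧ j ≠ n ∨ j + 1 = i) : aC n i j = -1 := by
  have := aC_cases n i j
  omega

lemma aC_eq_neg_two {n i j : ℕ} (h : i + 1 = n ∧ j = n) : aC n i j = -2 := by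
  have := aC_cases n i j
  omega

lemma colC_cases (n i p : ℕ) : (i + p ≤ n ∧ colC n i p = i + p) ∨
    (n < i + p ∧ i + p ≤ 2 * n ∧ colC n i p + i + p = 2 * n) ∨
    (2 * n < i + p ∧ colC n i p = 0) := by
  unfold colC
  split_ifs <;> omega

variable {n : ℕ} {x : ℕ → ℕ → L}

lemma CurrentRel.commC (h : CurrentRel (aC n) x) {c d : ℕ} (h1 : c ≠ d) (h2 : c + 1 ≠ d)
    (h3 : d + 1 ≠ c) (r s : ℕ) : ⁅x c r, x d s⁆ = 0 := by
  apply h.comm _ _ _ _ h1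
  have := aC_cases n c d
  omega

variable [IsAddTorsionFree L]

lemma CurrentRel.pathC (h : CurrentRel (aC n) x) {i : ℕ} (hi1 : 1 ≤ i) (hi : i < n) (p : ℕ)
    (hp : p + 1 ≤ 2 * (n - i)) :
    (∀ c, i < c → c ≤ n → c ≠ colC n i (p + 1) → Kills x (pathFam x (colC n i) p) c) ∧
    (p + 2 ≤ 2 * (n - i) →
      Step x (pathFam x (colC n i) p) (colC n i (p + 1)) (pathFam x (colC n i) (p + 1))) := by
  induction p using Nat.strong_induction_on with
  | _ p ih =>
  rcases p with _ | p
  · have e0 := colC_cases n i 0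
    have e1 := colC_cases n i (0 + 1)
    refine ⟨fun c hc hcn hc' s r => h.commC (by omega) (by omega) (by omega) s r, fun _ => ?_⟩
    exact h.step_base _ _
  have hS := (ih p (by omega) (by omega)).2 (by omega)
  have hK := (ih p (by omega) (by omega)).1
  have e0 := colC_cases n i p
  have e1 := colC_cases n i (p + 1)
  have e2 := colC_cases n i (p + 1 + 1)
  refine ⟨fun c hc hcn hc' => ?_, fun hp2 => h.step_next hS (hK _ (by omega) (by omega) (by omega))⟩
  by_cases hcd : c = colC n i (p + 1)
  · subst hcd
    rcases p with _ | p
    · intro s r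
      have z := colC_cases n i 0
      have q : aC n (colC n i (0 + 1)) (colC n i 0) = -1 := aC_eq_neg_one (by omega)
      exact h.serre₁ _ _ 0 r s q
    have f0 := colC_cases n i p
    obtain ⟨hK', hS'⟩ := ih p (by omega) (by omega)
    by_cases hd : colC n i (p + 1) = n
    swap
    · exact h.kills_repeat (aC_eq_neg_one (by omega)) (hK' _ (by omega) (by omega) (by omega))
        (hS' (by omega)) hS
    · rcases p with _ | p
      · omega
      have g0 := colC_cases n i p
      obtain ⟨hK'', hS''⟩ := ih p (by omega) (by omega)
      have hc1 : colC n i (p + 1 + 1 + 1) = colC n i (p + 1) := by omega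
      have q1 := hS'' (by omega)
      rw [hc1] at hS ⊢
      exact h.kills_double (aC_eq_neg_two (by omega)) (hK'' _ (by omega) (by omega) (by omega)) q1
        (hK' _ (by omega) (by omega) (by omega))
        (hS' (by omega)) hS
  by_cases hadj : c + 1 = colC n i (p + 1) ∨ colC n i (p + 1) + 1 = c
  · rcases p with _ | p
    · omega
    have f0 := colC_cases n i p
    obtain ⟨hK', hS'⟩ := ih p (by omega) (by omega)
    have hce : c = colC n i (p + 1) := by omega
    subst hce
    exact h.kills_back (aC_eq_neg_one (by omega)) (hK' _ (by omega) (by omega) (by omega))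
      (hS' (by omega))
      (hK _ (by omega) (by omega) (by omega)) hS
  · exact Kills.of_step_comm (fun r s => h.commC (by omega) (by omega) (by omega) r s) hS
      (hK c hc hcn hcd)

end TypeC

section TypeC
variable {L : Type*} [LieRing L] {n : ℕ} {x : ℕ → ℕ → L} [IsAddTorsionFree L]

lemma colC_zero {n i : ℕ} (hi : i ≤ n) : colC n i 0 = i := by
  have e0 := colC_cases n i 0
  omega

lemma colC_symm {n i p q : ℕ} (hi : i ≤ n) (h : p + q = 2 * (n - i)) :
    colC n i p = colC n i q := by
  have e0 := colC_cases n i p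
  have e1 := colC_cases n i q
  omega

lemma CurrentRel.pathC_kills_start (h : CurrentRel (aC n) x) {i : ℕ} (hi1 : 1 ≤ i) (hi : i < n)
    (p : ℕ) (hp : p + 2 ≤ 2 * (n - i)) : Kills x (pathFam x (colC n i) p) i := by
  have e1 := colC_cases n i 1
  induction p with
  | zero =>
    intro s r
    simp only [pathFam, colC_zero hi.le, h.diag]
  | succ p ih =>
    rcases p with _ | p
    · intro s r
      have q : aC n i (colC n i 1) = -1 := by
        have := aC_cases n i (colC n i 1)
        omega
      have h0 := h.serre₁ _ _ s r 0 q
      simp only [pathFam, colC_zero hi.le, zero_add]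
      rw [← lie_skew (x i s), neg_lie, h0, neg_zero]
    · have e2 := colC_cases n i (p + 1 + 1)
      refine Kills.of_step_comm (fun r s => h.commC ?_ ?_ ?_ r s)
        ((h.pathC hi1 hi (p + 1) (by omega)).2 (by omega)) (ih (by omega)) <;> omega

omit [IsAddTorsionFree L] in
lemma pathFam_succ_eq {w : ℕ → ℕ} {p : ℕ}
    (hS : Step x (pathFam x w p) (w (p + 1)) (pathFam x w (p + 1))) (s r : ℕ) :
    pathFam x w (p + 1) (s + r) = ⁅pathFam x w p s, x (w (p + 1)) r⁆ := (hS s r).symm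

lemma CurrentRel.pathC_comm (h : CurrentRel (aC n) x) {i : ℕ} (hi1 : 1 ≤ i) (hi : i < n)
    (q : ℕ) : ∀ p s r, p + q + 2 ≤ 2 * (n - i) →
      ⁅pathFam x (colC n i) p s, pathFam x (colC n i) q r⁆ = 0 := by
  induction q with
  | zero =>
    intro p s r hp
    simpa only [pathFam, colC_zero hi.le] using h.pathC_kills_start hi1 hi p (by omega) s r
  | succ q ih =>
    intro p s r hp
    have e := colC_cases n i (q + 1)
    rw [← Nat.add_zero r, pathFam_succ_eq ((h.pathC hi1 hi q (by omega)).2 (by omega)),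
      lie_lie_right, ih p s r (by omega), zero_lie, zero_sub, neg_eq_zero]
    by_cases hc : colC n i (q + 1) = colC n i (p + 1)
    · rw [hc, (h.pathC hi1 hi p (by omega)).2 (by omega), ih (p + 1) _ r (by omega)]
    · rw [(h.pathC hi1 hi p (by omega)).1 _ (by omega) (by omega) hc, zero_lie]

/-- the family of root vectors for the root `[i,n,i]`, up to sign. -/
def longFam (x : ℕ → ℕ → L) (n i s : ℕ) : L :=
  ⁅pathFam x (colC n i) (2 * (n - i) - 1) s, x i 0⁆

lemma CurrentRel.pathC_pair (h : CurrentRel (aC n) x) {i : ℕ} (hi1 : 1 ≤ i) (hi : i < n)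
    (q : ℕ) : ∀ p s r, p + q + 1 = 2 * (n - i) →
      ⁅pathFam x (colC n i) p s, pathFam x (colC n i) q r⁆ = (-1) ^ q • longFam x n i (s + r) := by
  have step : ∀ p q s r r', p + (q + 1) + 1 = 2 * (n - i) →
      ⁅pathFam x (colC n i) p s, pathFam x (colC n i) (q + 1) (r + r')⁆ =
        -⁅pathFam x (colC n i) (p + 1) (s + r'), pathFam x (colC n i) q r⁆ := by
    intro p q s r r' hp
    rw [pathFam_succ_eq ((h.pathC hi1 hi q (by omega)).2 (by omega)),
      lie_lie_right, h.pathC_comm hi1 hi q p s r (by omega), zero_lie, zero_sub,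
      colC_symm hi.le (show q + 1 + (p + 1) = 2 * (n - i) by omega),
      (h.pathC hi1 hi p (by omega)).2 (by omega)]
  induction q with
  | zero =>
    intro p s r hp
    obtain ⟨p, rfl⟩ : ∃ p', p = p' + 1 := ⟨p - 1, by omega⟩
    have h1 := step p 0 s 0 r (by omega)
    have h2 := step p 0 s r 0 (by omega)
    simp only [Nat.zero_add, Nat.add_zero] at h1 h2
    rw [h1, neg_inj] at h2
    have hp : 2 * (n - i) - 1 = p + 1 := by omega
    rw [← h2]
    simp only [longFam, pow_zero, one_smul, hp]
    simp only [pathFam, colC_zero hi.le]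
  | succ q ih =>
    intro p s r hp
    have := step p q s r 0 hp
    simp only [Nat.add_zero] at this
    rw [this, ih _ _ _ (by omega), pow_succ]
    simp

lemma CurrentRel.longFam_kills (h : CurrentRel (aC n) x) {i : ℕ} (hi1 : 1 ≤ i) (hi : i < n)
    (c : ℕ) (hc : i ≤ c) (hcn : c ≤ n) : Kills x (longFam x n i) c := by
  have pair := h.pathC_pair hi1 hi
  obtain rfl | hic := hc.eq_or_lt
  · obtain hn | hn := (show i + 1 = n ∨ i + 2 ≤ n by omega)
    · intro s r
      have h2 : aC n i n = -2 := aC_eq_neg_two ⟨hn, rfl⟩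
      have h3 := h.serre₂ i n 0 0 r s h2
      have e1 := colC_cases n i 1
      have hN : 2 * (n - i) - 1 = 0 + 1 := by omega
      have hc1 : colC n i (0 + 1) = n := by rw [Nat.zero_add]; omega
      have h4 : ⁅x i s, x n 0⁆ = -⁅x n s, x i 0⁆ := by
        rw [← lie_skew]
        have := h.shift n i 0 0 s
        simp only [Nat.zero_add] at this
        rw [this]
      simp only [longFam, hN, pathFam, hc1, colC_zero hi.le, h4, neg_lie, h3, neg_zero]
    · intro s r
      have h1 := pair 1 (2 * (n - i) - 2) 0 s (by omega)
      have h2 := lie_lie_right (pathFam x (colC n i) (2 * (n - i) - 2) 0)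
        (pathFam x (colC n i) 1 s) (x i r)
      rw [h.pathC_kills_start hi1 hi _ (by omega), h.pathC_kills_start hi1 hi _ (by omega),
        h1] at h2
      have h3 : ⁅x i r, longFam x n i s⁆ = 0 := by simpa using h2.symm
      rw [← lie_skew, h3, neg_zero]
  · obtain ⟨q, hq, hq'⟩ : ∃ q, c = colC n i (q + 1) ∧ q + 2 ≤ 2 * (n - i) := by
      refine ⟨c - i - 1, ?_, by omega⟩
      have := colC_cases n i (c - i - 1 + 1)
      omega
    have hne : c ≠ colC n i q := by
      have := colC_cases n i (q + 1)
      have := colC_cases n i q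
      omega
    have key : ∀ q, c = colC n i (q + 1) → c ≠ colC n i q → q + 2 ≤ 2 * (n - i) → ∀ p s r r',
        p + q + 1 = 2 * (n - i) →
        ⁅pathFam x (colC n i) p s, pathFam x (colC n i) (q + 1) (r + r')⁆ =
          (-1) ^ q • ⁅longFam x n i (s + r), x c r'⁆ := by
      intro q hq hne hq' p s r r' hp
      rw [pathFam_succ_eq ((h.pathC hi1 hi q (by omega)).2 (by omega)), ← hq,
        lie_lie_right, pair _ _ _ _ hp, (h.pathC hi1 hi p (by omega)).1 c hic hcn (by
          rwa [colC_symm hi.le (show p + 1 + q = 2 * (n - i) by omega)]), zero_lie, sub_zero]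
      rcases neg_one_pow_eq_or ℤ q with h1 | h1 <;> simp [h1]
    have main : ∀ s r r', ⁅longFam x n i (s + r), x c r'⁆ =
        -⁅longFam x n i (s + r + r'), x c 0⁆ := by
      intro s r r'
      obtain ⟨q', hqq⟩ : ∃ q', q + q' + 2 = 2 * (n - i) := ⟨2 * (n - i) - 2 - q, by omega⟩
      have hne' : c ≠ colC n i q' := by
        have := colC_cases n i (q + 1)
        have := colC_cases n i q'
        omega
      have k1 := key q hq hne (by omega) (q' + 1) s r r' (by omega)
      have k2 := key q' (hq.trans (colC_symm hi.le (by omega)))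
        hne' (by omega) (q + 1) (r + r') s 0 (by omega)
      have hp : (-1 : ℤ) ^ q' = (-1) ^ q := by
        rcases Nat.even_or_odd q with hh | hh
        · rw [hh.neg_one_pow, Even.neg_one_pow (by rw [Nat.even_iff] at hh ⊢; omega)]
        · rw [hh.neg_one_pow, Odd.neg_one_pow (by rw [Nat.odd_iff] at hh ⊢; omega)]
      simp only [Nat.add_zero] at k2
      rw [← lie_skew, k1, hp, show r + r' + s = s + r + r' by omega] at k2
      rcases neg_one_pow_eq_or ℤ q with h1 | h1
      · rw [h1, one_smul, one_smul] at k2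
        rw [← k2, neg_neg]
      · rw [h1, neg_smul, neg_smul, one_smul, one_smul, neg_neg] at k2
        exact k2
    have z : ∀ s, ⁅longFam x n i s, x c 0⁆ = 0 := fun s => eq_zero_of_eq_neg_self (main s 0 0)
    intro s r
    have := main s 0 r
    simpa only [Nat.add_zero, z, neg_zero] using this

end TypeC

section Closure
variable {R L : Type*} [CommRing R] [LieRing L] [LieAlgebra R L]

/-- the elements normalizing a submodule of a Lie algebra. -/
def bracketNormalizer (B : Submodule R L) : LieSubalgebra R L where
  carrier := {y | ∀ m ∈ B, ⁅m, y⁆ ∈ B}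
  add_mem' ha hb m hm := by rw [lie_add]; exact B.add_mem (ha m hm) (hb m hm)
  zero_mem' m hm := by rw [lie_zero]; exact B.zero_mem
  smul_mem' c y hy m hm := by rw [lie_smul]; exact B.smul_mem c (hy m hm)
  lie_mem' {a b} ha hb m hm := by
    rw [lie_lie_right]; exact B.sub_mem (hb _ (ha m hm)) (ha _ (hb m hm))

lemma lieSpan_le_of_lie_mem (S : Submodule R L) (X : Set L) (hX : X ⊆ S)
    (hcl : ∀ z ∈ X, ∀ y ∈ S, ⁅y, z⁆ ∈ S) :
    (LieSubalgebra.lieSpan R L X).toSubmodule ≤ S := by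
  let K : LieSubalgebra R L :=
    { S ⊓ (bracketNormalizer S).toSubmodule with
      lie_mem' := fun {a b} ha hb => ⟨hb.2 _ ha.1, (bracketNormalizer S).lie_mem ha.2 hb.2⟩ }
  have : LieSubalgebra.lieSpan R L X ≤ K :=
    LieSubalgebra.lieSpan_le.2 fun z hz => ⟨hX hz, hcl z hz⟩
  exact fun z hz => (this hz).1

lemma lieSpan_le_iSup {x : ℕ → ℕ → L} {n : ℕ} (B : ℕ → Submodule R L)
    (h0 : ∀ c r, (c = 0 ∨ n < c) → x c r = 0)
    (hx : ∀ c r, 1 ≤ c → c ≤ n → x c r ∈ B c)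
    (hcl : ∀ c d r, 1 ≤ c → c ≤ d → d ≤ n → ∀ y ∈ B c, ⁅y, x d r⁆ ∈ B c)
    (hgen : ∀ c, 1 ≤ c → c ≤ n → ∀ y ∈ B c,
      y ∈ LieSubalgebra.lieSpan R L {z | ∃ d r, c ≤ d ∧ d ≤ n ∧ z = x d r}) :
    (LieSubalgebra.lieSpan R L {z | ∃ c r, z = x c r}).toSubmodule ≤
      ⨆ c ∈ Set.Icc 1 n, B c := by
  have hle : ∀ c, 1 ≤ c → c ≤ n → B c ≤ ⨆ c ∈ Set.Icc 1 n, B c := fun c h1 h2 =>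
    le_iSup₂_of_le c ⟨h1, h2⟩ le_rfl
  have hout : ∀ c, ¬ (1 ≤ c ∧ c ≤ n) → ∀ r, x c r = 0 := fun c hc r => h0 c r (by omega)
  refine lieSpan_le_of_lie_mem _ _ ?_ ?_
  · rintro _ ⟨c, r, rfl⟩
    by_cases hc : 1 ≤ c ∧ c ≤ n
    · exact hle c hc.1 hc.2 (hx c r hc.1 hc.2)
    · rw [hout c hc r]; exact zero_mem _
  · rintro _ ⟨c, r, rfl⟩ y hy
    by_cases hc : 1 ≤ c ∧ c ≤ n
    swap
    · rw [hout c hc r, lie_zero]; exact zero_mem _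
    have hsub : (⨆ c ∈ Set.Icc 1 n, B c) ≤
        (⨆ c ∈ Set.Icc 1 n, B c).comap (LieModule.toEnd R L L (x c r)) := by
      refine iSup₂_le fun i hi y hy => ?_
      rw [Submodule.mem_comap, LieModule.toEnd_apply_apply]
      rcases le_or_gt i c with hic | hic
      · rw [← lie_skew]
        exact neg_mem (hle i hi.1 hi.2 (hcl i c r hi.1 hic hc.2 y hy))
      · have hN : LieSubalgebra.lieSpan R L {z | ∃ d r, i ≤ d ∧ d ≤ n ∧ z = x d r} ≤
            bracketNormalizer (B c) := by
          rw [LieSubalgebra.lieSpan_le]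
          rintro _ ⟨d, s, hd, hdn, rfl⟩ m hm
          exact hcl c d s hc.1 (by omega) hdn m hm
        exact hle c hc.1 hc.2 (hN (hgen i hi.1 hi.2 y hy) _ (hx c r hc.1 hc.2))
    rw [← lie_skew]
    exact neg_mem (hsub hy)

end Closure

section Chain
variable {L : Type*} [LieRing L]

/-- the left-normed bracket `[⋯[[g i₁ s₁, g i₂ s₂], g i₃ s₃], ⋯, g i_ℓ s_ℓ]` in a Lie ring. -/
def chainLie (g : ℕ → ℕ → L) (w : List ℕ) (ss : List ℕ) : L :=
  match w, ss with
  | i :: w', s :: ss' => (w'.zip ss').foldl (fun acc p => ⁅acc, g p.1 p.2⁆) (g i s)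
  | _, _ => 0

lemma foldl_lie_pathFam {x : ℕ → ℕ → L} {w : ℕ → ℕ} (k : ℕ) : ∀ (p t : ℕ) (ss : List ℕ),
    ss.length = k →
    (∀ q, q < k → Step x (pathFam x w (p + q)) (w (p + q + 1)) (pathFam x w (p + q + 1))) →
    (((List.range k).map fun j => w (p + 1 + j)).zip ss).foldl (fun acc p => ⁅acc, x p.1 p.2⁆)
      (pathFam x w p t) = pathFam x w (p + k) (t + ss.sum) := by
  induction k with
  | zero =>
    intro p t ss hss _
    obtain rfl := List.length_eq_zero_iff.1 hss
    simp
  | succ k ih =>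
    intro p t ss hss hS
    obtain ⟨s, ss, rfl⟩ := List.exists_of_length_succ ss hss
    have h0 := hS 0 (by omega) t s
    simp only [Nat.add_zero] at h0
    have h1 := ih (p + 1) (t + s) ss (by simpa using hss) (fun q hq => by
      have := hS (q + 1) (by omega)
      rwa [show p + (q + 1) = p + 1 + q by omega] at this)
    rw [List.range_succ_eq_map]
    simp only [List.map_cons, List.map_map, List.zip_cons_cons, List.foldl_cons, Nat.add_zero,
      h0, List.sum_cons]
    rw [show p + (k + 1) = p + 1 + k by omega, ← add_assoc, ← h1]
    congr 3
    funext j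
    simp only [Function.comp]
    congr 1
    omega

lemma chainLie_eq_pathFam {x : ℕ → ℕ → L} {w : ℕ → ℕ} (k : ℕ) (ss : List ℕ)
    (hss : ss.length = k + 1)
    (hS : ∀ q, q < k → Step x (pathFam x w q) (w (q + 1)) (pathFam x w (q + 1))) :
    chainLie x ((List.range (k + 1)).map w) ss = pathFam x w k ss.sum := by
  obtain ⟨s, ss, rfl⟩ := List.exists_of_length_succ ss hss
  have h1 := foldl_lie_pathFam k 0 s ss (by simpa using hss) (fun q hq => by
    simpa only [Nat.zero_add] using hS q hq)
  rw [List.range_succ_eq_map]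
  simp only [List.map_cons, List.map_map, chainLie, List.sum_cons]
  simp only [Nat.zero_add] at h1
  rw [← h1]
  simp only [pathFam]
  congr 3
  funext j
  simp only [Function.comp]
  congr 1
  omega

end Chain

section TypeD
variable {L : Type*} [LieRing L]

/-- the colors `i, …, n-2, n, n-1, n-2, …, i`. -/
def colD (n i p : ℕ) : ℕ :=
  if i + p + 2 ≤ n then i + p else if i + p + 1 = n then n else 2 * n - 1 - i - p

lemma aD_cases {n : ℕ} (i j : ℕ) : (i = j ∧ aD n i j = 2) ∨
    ((i + 1 = j ∧ j + 1 ≤ n ∨ j + 1 = i ∧ i + 1 ≤ n ∨ i + 2 = n ∧ j = n ∨ j + 2 = n ∧ i = n) ∧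
      aD n i j = -1) ∨
    (i ≠ j ∧ ¬(i + 1 = j ∧ j + 1 ≤ n) ∧ ¬(j + 1 = i ∧ i + 1 ≤ n) ∧ ¬(i + 2 = n ∧ j = n) ∧
      ¬(j + 2 = n ∧ i = n) ∧ aD n i j = 0) := by
  unfold aD
  split_ifs <;> omega

lemma colD_cases (n i p : ℕ) : (i + p + 2 ≤ n ∧ colD n i p = i + p) ∨
    (i + p + 1 = n ∧ colD n i p = n) ∨
    (n ≤ i + p ∧ i + p < 2 * n ∧ colD n i p + i + p + 1 = 2 * n) ∨
    (2 * n ≤ i + p ∧ colD n i p = 0) := by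
  unfold colD
  split_ifs <;> omega

lemma aD_eq_neg_one {n i j : ℕ}
    (h : i + 1 = j ∧ j < n ∨ j + 1 = i ∧ i < n ∨ i + 2 = n ∧ j = n ∨ j + 2 = n ∧ i = n) :
    aD n i j = -1 := by
  unfold aD
  split_ifs <;> omega

/-- the vertices `c` and `d` are not joined by an edge. -/
def NonadjD (n c d : ℕ) : Prop :=
  ¬(c + 1 = d ∧ d < n) ∧ ¬(d + 1 = c ∧ c < n) ∧ ¬(c + 2 = n ∧ d = n) ∧ ¬(d + 2 = n ∧ c = n)

lemma colD_adj {n i p c : ℕ} (hi : i + 2 ≤ n) (hp : p + 1 ≤ 2 * (n - i) - 2) (hic : i < c)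
    (h : ¬ NonadjD n c (colD n i (p + 1))) (h1 : c ≠ colD n i (p + 1 + 1))
    (h2 : ¬ (i + (p + 1) + 2 = n ∧ c + 1 = n)) :
    (1 ≤ p ∧ i + p + 1 ≠ n ∧ c = colD n i p) ∨ (i + p = n ∧ c = n) := by
  have e0 := colD_cases n i p
  have e1 := colD_cases n i (p + 1)
  have e2 := colD_cases n i (p + 1 + 1)
  simp only [NonadjD, not_and_or] at h
  rcases h with h | h | h | h <;> omega

lemma colD_succ_adj {n i p : ℕ} (hi : i + 2 ≤ n) (hp : p + 1 ≤ 2 * (n - i) - 2)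
    (h : i + p + 1 ≠ n) :
    aD n (colD n i p) (colD n i (p + 1)) = -1 ∧ aD n (colD n i (p + 1)) (colD n i p) = -1 := by
  have e0 := colD_cases n i p
  have e1 := colD_cases n i (p + 1)
  constructor <;> apply aD_eq_neg_one <;> rcases e0 with e0 | e0 | e0 | e0 <;> omega

lemma colD_bounds {n i p : ℕ} (hi : i + 2 ≤ n) (hp1 : 1 ≤ p) (hp : p ≤ 2 * (n - i) - 2) :
    i < colD n i p ∧ colD n i p ≤ n := by
  have e0 := colD_cases n i p
  omega

lemma colD_ne_succ {n i p : ℕ} (hi : i + 2 ≤ n) (hp : p + 1 ≤ 2 * (n - i) - 2) :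
    colD n i p ≠ colD n i (p + 1) := by
  have e0 := colD_cases n i p
  have e1 := colD_cases n i (p + 1)
  omega

lemma colD_ne_sub_one {n i p : ℕ} (hi : i + 2 ≤ n) (h : i + p ≠ n) : colD n i p + 1 ≠ n := by
  have e0 := colD_cases n i p
  omega

variable {n : ℕ} {x : ℕ → ℕ → L}

/-- the family `[U, x_{n-1}]`, where `U` is the family of root vectors for `[i,n-2]`. -/
def sideFam (x : ℕ → ℕ → L) (n i s : ℕ) : L :=
  ⁅pathFam x (colD n i) (n - i - 2) s, x (n - 1) 0⁆

lemma CurrentRel.commD (h : CurrentRel (aD n) x) {c d : ℕ} (h1 : c ≠ d)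
    (h2 : ¬(c + 1 = d ∧ d + 1 ≤ n)) (h3 : ¬(d + 1 = c ∧ c + 1 ≤ n)) (h4 : ¬(c + 2 = n ∧ d = n))
    (h5 : ¬(d + 2 = n ∧ c = n)) (r s : ℕ) : ⁅x c r, x d s⁆ = 0 := by
  apply h.comm _ _ _ _ h1
  have := aD_cases (n := n) c d
  omega

lemma lie_lie_comm_of_comm {u v w : L} (h : ⁅v, w⁆ = 0) : ⁅⁅u, v⁆, w⁆ = ⁅⁅u, w⁆, v⁆ := by
  have := lie_lie_right u v w
  rw [h, lie_zero] at this
  exact (sub_eq_zero.1 this.symm)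

variable [IsAddTorsionFree L]

lemma CurrentRel.pathD (h : CurrentRel (aD n) x) {i : ℕ} (hi1 : 1 ≤ i) (hi : i + 2 ≤ n) (p : ℕ)
    (hp : p ≤ 2 * (n - i) - 2) :
    (∀ c, i < c → c ≤ n → c ≠ colD n i (p + 1) → ¬ (i + p + 2 = n ∧ c + 1 = n) →
      Kills x (pathFam x (colD n i) p) c) ∧
    (p + 1 ≤ 2 * (n - i) - 2 →
      Step x (pathFam x (colD n i) p) (colD n i (p + 1)) (pathFam x (colD n i) (p + 1))) ∧
    (i + p + 2 = n → Step x (pathFam x (colD n i) p) (n - 1) (sideFam x n i) ∧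
      ∀ c, i < c → c < n → Kills x (sideFam x n i) c) ∧
    (i + p + 1 = n → Step x (sideFam x n i) n (pathFam x (colD n i) (p + 1))) := by
  induction p using Nat.strong_induction_on with
  | _ p ih =>
  rcases p with _ | p
  · have e0 := colD_cases n i 0
    have e1 := colD_cases n i (0 + 1)
    refine ⟨fun c hc hcn hc' hc'' s r => h.commD (by omega) (by omega) (by omega) (by omega)
      (by omega) s r, fun _ => h.step_base _ _, fun h2 => ⟨?_, ?_⟩, fun _ => by omega⟩
    · have h3 : sideFam x n i = fun s => ⁅x (colD n i 0) s, x (n - 1) 0⁆ := by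
        funext s
        rw [sideFam, show n - i - 2 = 0 by omega, pathFam]
      rw [h3]
      exact h.step_base _ _
    · intro c hc hcn s r
      rw [sideFam, show n - i - 2 = 0 by omega, pathFam]
      obtain rfl : c = n - 1 := by omega
      exact h.serre₁ _ _ _ _ _ (aD_eq_neg_one (by omega))
  obtain ⟨hK, hS, hU, hV⟩ := ih p (by omega) (by omega)
  replace hS := hS (by omega)
  have e0 := colD_cases n i p
  have e1 := colD_cases n i (p + 1)
  have e2 := colD_cases n i (p + 1 + 1)
  have hSnext : p + 1 + 1 ≤ 2 * (n - i) - 2 →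
      Step x (pathFam x (colD n i) (p + 1)) (colD n i (p + 1 + 1))
        (pathFam x (colD n i) (p + 1 + 1)) := by
    intro hp2
    by_cases hpm : i + p + 2 = n
    · obtain ⟨hU1, hU2⟩ := hU hpm
      have c1 : colD n i (p + 1) = n := by omega
      have c2 : colD n i (p + 1 + 1) = n - 1 := by omega
      have hcomm : ∀ r s, ⁅x n r, x (n - 1) s⁆ = 0 :=
        h.commD (by omega) (by omega) (by omega) (by omega) (by omega)
      intro s r
      simp only [pathFam, c1, c2]
      rw [lie_lie_comm_of_comm (hcomm _ _), hU1, lie_lie_comm_of_comm (hcomm _ _), hU1,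
        Nat.add_zero]
    · exact h.step_next hS (hK _ (by omega) (by omega) (by omega) (by omega))
  have hmain : ∀ c, i < c → c ≤ n → c ≠ colD n i (p + 1 + 1) →
      ¬ (i + (p + 1) + 2 = n ∧ c + 1 = n) → Kills x (pathFam x (colD n i) (p + 1)) c := by
    intro c hc hcn hc' hc''
    by_cases hcd : c = colD n i (p + 1)
    · subst hcd
      rcases p with _ | p
      · intro s r
        exact h.serre₁ _ _ 0 r s (colD_succ_adj hi hp (by omega)).2
      obtain ⟨hK', hS', hU', -⟩ := ih p (by omega) (by omega)
      by_cases hpm : i + p + 2 = n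
      · have c1 : colD n i (p + 1 + 1) = n - 1 := by omega
        rw [c1]
        exact Kills.of_step_comm (h.commD (by omega) (by omega) (by omega) (by omega) (by omega))
          (hV (by omega)) ((hU' hpm).2 _ (by omega) (by omega))
      · exact h.kills_repeat (colD_succ_adj hi hp (by omega)).2
          (hK' _ hc hcn (colD_ne_succ hi hp).symm fun hh => hpm hh.1)
          (hS' (by omega)) hS
    by_cases hadj : NonadjD n c (colD n i (p + 1))
    · exact Kills.of_step_comm (h.commD (Ne.symm hcd) hadj.2.1 hadj.1 hadj.2.2.2 hadj.2.2.1) hS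
        (hK c hc hcn hcd (by omega))
    · obtain ⟨hp1, hp2, hce⟩ | ⟨hpm, hcn⟩ := colD_adj hi hp hc hadj hc' hc''
      · obtain ⟨p, rfl⟩ : ∃ q, p = q + 1 := ⟨p - 1, by omega⟩
        obtain ⟨hK', hS', -, -⟩ := ih p (by omega) (by omega)
        have hb := colD_bounds (p := p + 1 + 1) hi (by omega) hp
        have hne := colD_ne_succ (p := p + 1) hi hp
        subst hce
        exact h.kills_back (colD_succ_adj hi hp hp2).1
          (hK' _ hb.1 hb.2 hne.symm fun hh => colD_ne_sub_one hi (by omega) hh.2)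
          (hS' (by omega)) (hK _ hc hcn hne fun hh => colD_ne_sub_one hi (by omega) hh.2) hS
      · obtain ⟨q, rfl⟩ : ∃ q, p = q + 1 + 1 := ⟨p - 2, by omega⟩
        obtain ⟨-, -, -, hV'⟩ := ih (q + 1) (by omega) (by omega)
        obtain ⟨-, -, hU'', -⟩ := ih q (by omega) (by omega)
        clear ih hadj hSnext hU hV
        subst hcn
        exact h.kills_back (aD_eq_neg_one (by omega)) ((hU'' (by omega)).2 _ (by omega) (by omega))
          (hV' (by omega)) (hK _ (by omega) (by omega) (by omega) (by omega)) hS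
  refine ⟨hmain, hSnext, fun hpm => ?_, fun hpm => ?_⟩
  · have hq : n - i - 2 = p + 1 := by omega
    have hst : Step x (pathFam x (colD n i) (p + 1)) (n - 1) (sideFam x n i) := by
      have : sideFam x n i = fun s => ⁅pathFam x (colD n i) (p + 1) s, x (n - 1) 0⁆ := by
        funext s
        rw [sideFam, hq]
      rw [this]
      exact h.step_next hS (hK _ (by omega) (by omega) (by omega) (by omega))
    refine ⟨hst, fun c hc hcn => ?_⟩
    by_cases hc1 : c = n - 1
    · subst hc1
      exact h.kills_repeat (aD_eq_neg_one (by omega))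
        (hK _ (by omega) (by omega) (by omega) (by omega)) hS hst
    by_cases hc2 : c = n - 2
    · have hc3 : c = colD n i (p + 1) := by omega
      subst hc3
      exact h.kills_back (aD_eq_neg_one (by omega))
        (hK _ (by omega) (by omega) (by omega) (by omega)) hS
        (hmain _ (by omega) (by omega) (by omega) (by omega)) hst
    · exact Kills.of_step_comm (h.commD (by omega) (by omega) (by omega) (by omega) (by omega)) hst
        (hmain _ (by omega) (by omega) (by omega) (by omega))
  · obtain ⟨hU1, -⟩ := (hU (by omega))
    have c1 : colD n i (p + 1) = n := by omega
    have c2 : colD n i (p + 1 + 1) = n - 1 := by omega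
    have hcomm : ∀ r s, ⁅x n r, x (n - 1) s⁆ = 0 :=
      h.commD (by omega) (by omega) (by omega) (by omega) (by omega)
    intro s r
    rw [c1] at hS
    rw [sideFam, show n - i - 2 = p by omega,
      lie_lie_comm_of_comm (by rw [← lie_skew, hcomm, neg_zero]), hS, ← c2]
    rfl

end TypeD

section TypeD
variable {L : Type*} [LieRing L] {n : ℕ} {x : ℕ → ℕ → L}

lemma colD_of_le {n i p : ℕ} (h : i + p + 2 ≤ n) : colD n i p = i + p := by
  have e0 := colD_cases n i p
  omega

lemma CurrentRel.serre_start (h : CurrentRel (aD n) x) {i d : ℕ} (hd : aD n i d = -1) (s r : ℕ) :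
    ⁅⁅x i s, x d 0⁆, x i r⁆ = 0 := by
  rw [← lie_skew (x i s), neg_lie, h.serre₁ _ _ s r 0 hd, neg_zero]

variable [IsAddTorsionFree L]

lemma CurrentRel.pathD_kills_start_of_lt (h : CurrentRel (aD n) x) {i : ℕ} (hi1 : 1 ≤ i)
    (hi : i + 2 ≤ n) (p : ℕ) (hp : p + 1 ≤ 2 * (n - i) - 2) :
    Kills x (pathFam x (colD n i) p) i := by
  induction p with
  | zero =>
    intro s r
    simp only [pathFam, colD_of_le (p := 0) hi, Nat.add_zero, h.diag]
  | succ p ih =>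
    rcases p with _ | p
    · intro s r
      have q := (colD_succ_adj (p := 0) hi (by omega) (by omega)).1
      simp only [pathFam, colD_of_le (p := 0) hi, Nat.add_zero] at q ⊢
      exact h.serre_start q s r
    · have e2 := colD_cases n i (p + 1 + 1)
      refine Kills.of_step_comm (fun r s => h.commD ?_ ?_ ?_ ?_ ?_ r s)
        ((h.pathD hi1 hi (p + 1) (by omega)).2.1 (by omega)) (ih (by omega)) <;> omega

lemma CurrentRel.sideD_step (h : CurrentRel (aD n) x) {i : ℕ} (hi1 : 1 ≤ i) (hi : i + 2 ≤ n) :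
    Step x (pathFam x (colD n i) (n - i - 2)) (n - 1) (sideFam x n i) :=
  ((h.pathD hi1 hi (n - i - 2) (by omega)).2.2.1 (by omega)).1

lemma CurrentRel.sideD_kills (h : CurrentRel (aD n) x) {i : ℕ} (hi1 : 1 ≤ i) (hi : i + 2 ≤ n)
    {c : ℕ} (hc : i ≤ c) (hcn : c < n) : Kills x (sideFam x n i) c := by
  obtain rfl | hic := hc.eq_or_lt
  · by_cases h2 : i + 2 = n
    · intro s r
      have q : aD n i (n - 1) = -1 := aD_eq_neg_one (by omega)
      rw [sideFam, show n - i - 2 = 0 by omega, pathFam, colD_of_le (p := 0) hi]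
      exact h.serre_start q s r
    · exact Kills.of_step_comm (h.commD (by omega) (by omega) (by omega) (by omega) (by omega))
        (h.sideD_step hi1 hi) (h.pathD_kills_start_of_lt hi1 hi _ (by omega))
  · exact ((h.pathD hi1 hi (n - i - 2) (by omega)).2.2.1 (by omega)).2 c hic hcn

lemma CurrentRel.pathD_step (h : CurrentRel (aD n) x) {i : ℕ} (hi1 : 1 ≤ i) (hi : i + 2 ≤ n)
    {p : ℕ} (hp : p + 1 ≤ 2 * (n - i) - 2) :
    Step x (pathFam x (colD n i) p) (colD n i (p + 1)) (pathFam x (colD n i) (p + 1)) :=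
  (h.pathD hi1 hi p (by omega)).2.1 hp

lemma CurrentRel.pathD_comm (h : CurrentRel (aD n) x) {i : ℕ} (hi1 : 1 ≤ i) (hi : i + 2 ≤ n)
    (q : ℕ) : ∀ p s r, p + q + 1 ≤ 2 * (n - i) - 2 → i + q + 2 ≤ n →
      ⁅pathFam x (colD n i) p s, pathFam x (colD n i) q r⁆ = 0 := by
  induction q with
  | zero =>
    intro p s r hp _
    have := h.pathD_kills_start_of_lt hi1 hi p (by omega) s r
    simpa only [pathFam, colD_of_le (p := 0) hi, Nat.add_zero] using this
  | succ q ih =>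
    intro p s r hp hq
    rw [← Nat.add_zero r, pathFam_succ_eq (h.pathD_step hi1 hi (by omega)),
      lie_lie_right, ih p s r (by omega) (by omega), zero_lie, zero_sub, neg_eq_zero,
      colD_of_le hq]
    by_cases hc : i + (q + 1) = colD n i (p + 1)
    · rw [hc, h.pathD_step hi1 hi (by omega), ih (p + 1) _ r (by omega) (by omega)]
    · rw [(h.pathD hi1 hi p (by omega)).1 _ (by omega) (by omega) hc (by omega), zero_lie]

lemma CurrentRel.sideD_comm (h : CurrentRel (aD n) x) {i : ℕ} (hi1 : 1 ≤ i) (hi : i + 2 ≤ n)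
    (q : ℕ) (s r : ℕ) (hq : i + q + 2 ≤ n) :
    ⁅sideFam x n i s, pathFam x (colD n i) q r⁆ = 0 := by
  induction q generalizing r with
  | zero =>
    have := h.sideD_kills hi1 hi le_rfl (by omega) s r
    simpa only [pathFam, colD_of_le (p := 0) hi, Nat.add_zero] using this
  | succ q ih =>
    rw [← Nat.add_zero r, pathFam_succ_eq (h.pathD_step hi1 hi (by omega)),
      lie_lie_right, ih r (by omega), zero_lie, zero_sub, neg_eq_zero,
      colD_of_le hq, h.sideD_kills hi1 hi (by omega) (by omega), zero_lie]

lemma CurrentRel.pathD_comm_middle (h : CurrentRel (aD n) x) {i : ℕ} (hi1 : 1 ≤ i)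
    (hi : i + 2 ≤ n) {q : ℕ} (hq : i + q + 2 = n) (s r : ℕ) :
    ⁅pathFam x (colD n i) (q + 2) s, pathFam x (colD n i) q r⁆ = 0 := by
  have c1 : colD n i (q + 1) = n := by
    have := colD_cases n i (q + 1)
    omega
  have c2 : colD n i (q + 1 + 1) = n - 1 := by
    have := colD_cases n i (q + 1 + 1)
    omega
  have hside : Step x (sideFam x n i) n (pathFam x (colD n i) (q + 1 + 1)) :=
    (h.pathD hi1 hi (q + 1) (by omega)).2.2.2 (by omega)
  have hq' : n - i - 2 = q := by omega
  have hst := h.sideD_step hi1 hi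
  rw [hq'] at hst
  have e1 : ∀ s a b, ⁅sideFam x n i s, pathFam x (colD n i) (q + 1) (a + b)⁆ =
      -⁅pathFam x (colD n i) (q + 1 + 1) (s + b), pathFam x (colD n i) q a⁆ := by
    intro s a b
    rw [pathFam_succ_eq (h.pathD_step hi1 hi (by omega)), lie_lie_right,
      h.sideD_comm hi1 hi q s a (by omega), zero_lie, zero_sub, c1, hside]
  have e2 : ∀ s t R, ⁅sideFam x n i (s + t), pathFam x (colD n i) (q + 1) R⁆ =
      ⁅pathFam x (colD n i) (q + 1 + 1) (R + t), pathFam x (colD n i) q s⁆ := by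
    intro s t R
    have h1 := h.pathD_step hi1 hi (p := q + 1) (by omega)
    rw [c2] at h1
    rw [← hst s t, ← lie_skew, lie_lie_right, h.pathD_comm hi1 hi q (q + 1) R s (by omega)
      (by omega), zero_lie, zero_sub, h1, neg_neg]
  have key : ∀ N, ⁅pathFam x (colD n i) (q + 1 + 1) 0, pathFam x (colD n i) q N⁆ = 0 := by
    intro N
    apply eq_zero_of_eq_neg_self
    have h1 := e1 N 0 0
    have h2 := e2 N 0 0
    have h3 := e1 0 0 N
    have h4 := e1 0 N 0
    simp only [Nat.add_zero, Nat.zero_add] at h1 h2 h3 h4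
    exact (h2.symm.trans h1).trans (h3.symm.trans h4)
  have h3 := e1 0 r s
  have h4 := e1 0 (r + s) 0
  simp only [Nat.add_zero, Nat.zero_add] at h3 h4
  rw [h4, neg_inj] at h3
  change ⁅pathFam x (colD n i) (q + 1 + 1) s, pathFam x (colD n i) q r⁆ = 0
  rw [← h3, key]

lemma CurrentRel.pathD_comm_antidiag (h : CurrentRel (aD n) x) {i : ℕ} (hi1 : 1 ≤ i)
    (hi : i + 2 ≤ n) (k : ℕ) : ∀ p q s r, p + q = 2 * (n - i) - 2 → i + q + 2 + k = n →
      ⁅pathFam x (colD n i) p s, pathFam x (colD n i) q r⁆ = 0 := by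
  induction k with
  | zero =>
    intro p q s r hp hq
    obtain rfl : p = q + 2 := by omega
    exact h.pathD_comm_middle hi1 hi hq s r
  | succ k ih =>
    intro p q s r hp hq
    obtain ⟨p, rfl⟩ : ∃ p', p = p' + 1 := ⟨p - 1, by omega⟩
    have h1 := ih p (q + 1) s r (by omega) (by omega)
    have hc : colD n i (q + 1) = colD n i (p + 1) := by
      have := colD_cases n i (q + 1)
      have := colD_cases n i (p + 1)
      omega
    rw [← Nat.add_zero r, pathFam_succ_eq (h.pathD_step hi1 hi (by omega)),
      lie_lie_right, h.pathD_comm hi1 hi q p s r (by omega) (by omega), zero_lie, zero_sub,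
      neg_eq_zero, hc, h.pathD_step hi1 hi (by omega), Nat.add_zero] at h1
    exact h1

lemma CurrentRel.pathD_kills_start (h : CurrentRel (aD n) x) {i : ℕ} (hi1 : 1 ≤ i)
    (hi : i + 2 ≤ n) (p : ℕ) (hp : p ≤ 2 * (n - i) - 2) :
    Kills x (pathFam x (colD n i) p) i := by
  obtain h1 | rfl := Nat.lt_or_eq_of_le hp
  · exact h.pathD_kills_start_of_lt hi1 hi p h1
  · intro s r
    have := h.pathD_comm_antidiag hi1 hi (n - i - 2) (2 * (n - i) - 2) 0 s r (by omega) (by omega)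
    simpa only [pathFam, colD_of_le (p := 0) hi, Nat.add_zero] using this

end TypeD

/-- bracketings of the symbols `x_{c,r}`. -/
inductive BTree : Type
  | leaf (c r : ℕ) : BTree
  | br (a b : BTree) : BTree

namespace BTree
variable {L L' : Type*} [LieRing L] [LieRing L']

/-- the value of a bracketing in a Lie ring. -/
def eval (x : ℕ → ℕ → L) : BTree → L
  | leaf c r => x c r
  | br a b => ⁅eval x a, eval x b⁆

lemma map_eval (f : L → L') (hf : ∀ a b, f ⁅a, b⁆ = ⁅f a, f b⁆) (x : ℕ → ℕ → L) (T : BTree) :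
    f (T.eval x) = T.eval fun c r => f (x c r) := by
  induction T with
  | leaf c r => rfl
  | br a b iha ihb => rw [eval, eval, hf, iha, ihb]

/-- the left-normed bracketing of the word `w` with second indices `ss`. -/
def chain (w ss : List ℕ) : BTree :=
  match w, ss with
  | i :: w', s :: ss' => (w'.zip ss').foldl (fun acc p => br acc (leaf p.1 p.2)) (leaf i s)
  | _, _ => leaf 0 0

lemma eval_chain (x : ℕ → ℕ → L) (h0 : x 0 0 = 0) (w ss : List ℕ) :
    (chain w ss).eval x = chainLie x w ss := by
  rcases w with _ | ⟨i, w'⟩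
  · exact h0
  · rcases ss with _ | ⟨s, ss'⟩
    · exact h0
    have : ∀ (l : List (ℕ × ℕ)) (T : BTree),
        (l.foldl (fun acc p => br acc (leaf p.1 p.2)) T).eval x =
          l.foldl (fun acc p => ⁅acc, x p.1 p.2⁆) (T.eval x) := by
      intro l
      induction l with
      | nil => intro T; rfl
      | cons p l ih => intro T; simp only [List.foldl_cons, ih, eval]
    exact this _ _

/-- `T` is a left-normed bracketing of `w` with second indices summing to `s`. -/
def IsChain (w : List ℕ) (s : ℕ) (T : BTree) : Prop :=
  ∃ ss : List ℕ, ss.length = w.length ∧ ss.sum = s ∧ T = chain w ss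

end BTree

/-- `T` is a bracketing defining a root vector `X_{β,s}` of type `C_n`. -/
def IsRootTreeC {n : ℕ} (β : PosRootC n) (s : ℕ) (T : BTree) : Prop :=
  if isINI β then
    ∃ (β₁ β₂ : PosRootC n) (s₁ s₂ : ℕ) (T₁ T₂ : BTree),
      (ri β₁ = ri β ∧ ri β₁ + rt β₁ + 1 = n) ∧ (ri β₂ = ri β ∧ ri β₂ + rt β₂ = n + 1) ∧
      T₁.IsChain (wordC β₁) s₁ ∧ T₂.IsChain (wordC β₂) s₂ ∧
      s = s₁ + s₂ ∧ T = BTree.br T₁ T₂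
  else T.IsChain (wordC β) s

/-- `T` is a bracketing defining a root vector `X_{β,s}` of type `D_n`. -/
def IsRootTreeD {n : ℕ} (β : PosRootD n) (s : ℕ) (T : BTree) : Prop := T.IsChain (wordD β) s

section Words

lemma wordC_eq_map {n i p : ℕ} (hi : i < n) (hp : p + 1 ≤ 2 * (n - i)) (β : PosRootC n)
    (hβ : ri β = i) (ht : i + p < n ∧ rt β = p ∨ n ≤ i + p ∧ rt β = p + 1) :
    wordC β = (List.range (p + 1)).map (colC n i) := by
  unfold wordC
  simp only [hβ]
  rcases ht with ⟨h1, h2⟩ | ⟨h1, h2⟩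
  · rw [if_pos (by omega), h2]
    apply List.ext_getElem
    · simp
    · intro k hk1 hk2
      simp only [List.getElem_range', List.getElem_map, List.getElem_range]
      simp at hk1
      have := colC_cases n i k
      omega
  · rw [if_neg (by omega), if_neg (by omega)]
    split_ifs with h3
    · apply List.ext_getElem
      · simp; omega
      · intro k hk1 hk2
        simp only [List.getElem_range', List.getElem_map, List.getElem_range]
        simp at hk1
        have := colC_cases n i k
        omega
    · apply List.ext_getElem
      · simp; omega
      · intro k hk1 hk2
        simp only [List.getElem_range', List.getElem_map, List.getElem_range, List.getElem_append,
          List.getElem_reverse, List.length_range']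
        simp at hk1
        have := colC_cases n i k
        split_ifs <;> omega

lemma wordC_last {n : ℕ} (β : PosRootC n) (h : ri β = n) : wordC β = [n] := by
  have := β.2.2.1 h
  unfold wordC
  rw [if_pos (Or.inr h), h, show rt β = 0 from this]
  rfl

end Words

section Span
variable {R L : Type*} [CommRing R] [LieRing L] [LieAlgebra R L]

lemma lie_mem_span_of_forall {S : Set L} {z : L}
    (hS : ∀ y ∈ S, ⁅y, z⁆ ∈ Submodule.span R S) :
    ∀ y ∈ Submodule.span R S, ⁅y, z⁆ ∈ Submodule.span R S := by
  intro y hy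
  induction hy using Submodule.span_induction with
  | mem y hy => exact hS y hy
  | zero => rw [zero_lie]; exact zero_mem _
  | add a b _ _ ha hb => rw [add_lie]; exact add_mem ha hb
  | smul c a _ ha => rw [smul_lie]; exact Submodule.smul_mem _ _ ha

lemma pathFam_mem_lieSpan {x : ℕ → ℕ → L} {w : ℕ → ℕ} {c n : ℕ} (p : ℕ)
    (h : ∀ q, q ≤ p → c ≤ w q ∧ w q ≤ n) (s : ℕ) :
    pathFam x w p s ∈ LieSubalgebra.lieSpan R L {z | ∃ d r, c ≤ d ∧ d ≤ n ∧ z = x d r} := by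
  induction p with
  | zero => exact LieSubalgebra.subset_lieSpan ⟨_, _, (h 0 le_rfl).1, (h 0 le_rfl).2, rfl⟩
  | succ p ih =>
    exact LieSubalgebra.lie_mem _ (ih fun q hq => h q (by omega))
      (LieSubalgebra.subset_lieSpan ⟨_, _, (h (p + 1) le_rfl).1, (h (p + 1) le_rfl).2, rfl⟩)

variable [IsAddTorsionFree L] {n : ℕ} {x : ℕ → ℕ → L}

/-- the root vectors of type `C_n` in the block of roots starting with `i`. -/
def blockC (x : ℕ → ℕ → L) (n i : ℕ) : Set L :=
  {z | (i = n ∧ ∃ s, z = x n s) ∨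
    (i < n ∧ ∃ s, z = longFam x n i s ∨ ∃ p, p + 1 ≤ 2 * (n - i) ∧ z = pathFam x (colC n i) p s)}

theorem CurrentRel.lieSpan_le_spanC (h : CurrentRel (aC n) x)
    (h0 : ∀ c r, (c = 0 ∨ n < c) → x c r = 0) (T : PosRootC n × ℕ → BTree)
    (hT : ∀ p, IsRootTreeC p.1 p.2 (T p)) :
    (LieSubalgebra.lieSpan R L {z | ∃ c r, z = x c r}).toSubmodule ≤
      Submodule.span R (Set.range fun p => (T p).eval x) := by
  refine (lieSpan_le_iSup (fun i => Submodule.span R (blockC x n i)) h0 ?_ ?_ ?_).trans ?_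
  · intro c r h1 hc
    apply Submodule.subset_span
    obtain hc | rfl := Nat.lt_or_eq_of_le hc
    · exact Or.inr ⟨hc, r, Or.inr ⟨0, by omega, by rw [pathFam, colC_zero hc.le]⟩⟩
    · exact Or.inl ⟨rfl, r, rfl⟩
  · intro c d r h1 hcd hdn
    apply lie_mem_span_of_forall
    rintro y (⟨rfl, s, rfl⟩ | ⟨hc, s, rfl | ⟨p, hp, rfl⟩⟩)
    · obtain rfl : c = d := by omega
      rw [h.diag]
      exact zero_mem _
    · rw [h.longFam_kills h1 hc d hcd hdn]
      exact zero_mem _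
    · by_cases hd : d = colC n c (p + 1)
      · obtain hp2 | hp2 := (show p + 2 ≤ 2 * (n - c) ∨ p + 1 = 2 * (n - c) by omega)
        · rw [hd, (h.pathC h1 hc p hp).2 hp2]
          exact Submodule.subset_span (Or.inr ⟨hc, _, Or.inr ⟨p + 1, by omega, rfl⟩⟩)
        · have hdc : d = c := by
            have := colC_cases n c (p + 1)
            omega
          have := h.pathC_pair h1 hc 0 p s r (by omega)
          simp only [pathFam, colC_zero hc.le, pow_zero, one_smul] at this
          rw [hdc, this]
          exact Submodule.subset_span (Or.inr ⟨hc, _, Or.inl rfl⟩)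
      · obtain rfl | hcd := hcd.eq_or_lt
        · obtain hp2 | hp2 := (show p + 2 ≤ 2 * (n - c) ∨ p + 1 = 2 * (n - c) by omega)
          · rw [h.pathC_kills_start h1 hc p hp2]
            exact zero_mem _
          · have := colC_cases n c (p + 1)
            omega
        · rw [(h.pathC h1 hc p hp).1 d hcd hdn hd]
          exact zero_mem _
  · intro c h1 hcn
    suffices Submodule.span R (blockC x n c) ≤
        (LieSubalgebra.lieSpan R L {z | ∃ d r, c ≤ d ∧ d ≤ n ∧ z = x d r}).toSubmodule from
      fun y hy => this hy
    rw [Submodule.span_le]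
    have hcol : ∀ p, p + 1 ≤ 2 * (n - c) → c ≤ colC n c p ∧ colC n c p ≤ n := fun p hp => by
      have := colC_cases n c p
      omega
    rintro y (⟨rfl, s, rfl⟩ | ⟨hc, s, rfl | ⟨p, hp, rfl⟩⟩)
    · exact LieSubalgebra.subset_lieSpan ⟨_, _, le_rfl, le_rfl, rfl⟩
    · exact LieSubalgebra.lie_mem _ (pathFam_mem_lieSpan _ (fun q hq => hcol q (by omega)) s)
        (LieSubalgebra.subset_lieSpan ⟨_, _, le_rfl, hcn, rfl⟩)
    · exact pathFam_mem_lieSpan _ (fun q hq => hcol q (by omega)) s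
  · refine iSup₂_le fun i hi => Submodule.span_le.2 ?_
    have h00 := h0 0 0 (Or.inl rfl)
    have hchain : ∀ (β : PosRootC n) (p s : ℕ) (T : BTree), i < n → p + 1 ≤ 2 * (n - i) →
        ri β = i → (i + p < n ∧ rt β = p ∨ n ≤ i + p ∧ rt β = p + 1) → T.IsChain (wordC β) s →
        T.eval x = pathFam x (colC n i) p s := by
      rintro β p s T hin hp hβ ht ⟨ss, hss, rfl, rfl⟩
      rw [wordC_eq_map hin hp β hβ ht] at hss ⊢
      rw [BTree.eval_chain x h00, chainLie_eq_pathFam p ss (by simpa using hss)]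
      exact fun q hq => (h.pathC hi.1 hin q (by omega)).2 (by omega)
    have hmk : ∀ t, (i = n → t = 0) → t + 2 * i ≤ 2 * n → ∃ β : PosRootC n, ri β = i ∧ rt β = t :=
      fun t h1 h2 => ⟨⟨toLex (⟨i, by have := hi.2; omega⟩, ⟨t, by omega⟩), hi.1, h1, h2⟩, rfl, rfl⟩
    rintro y (⟨hin, s, rfl⟩ | ⟨hin, s, rfl | ⟨p, hp, rfl⟩⟩)
    · obtain ⟨β, h1, h2⟩ := hmk 0 (fun _ => rfl) (by omega)
      apply Submodule.subset_span
      refine ⟨(β, s), ?_⟩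
      have h3 := hT (β, s)
      rw [IsRootTreeC, if_neg (by unfold isINI; dsimp only; omega)] at h3
      obtain ⟨ss, hss, hs, hE⟩ := h3
      dsimp only at hs hss hE
      rw [wordC_last β (h1.trans hin)] at hss hE
      obtain ⟨a, rfl⟩ := List.length_eq_one_iff.1 hss
      simp only [List.sum_cons, List.sum_nil, Nat.add_zero] at hs
      dsimp only
      rw [hE, hs]
      rfl
    · obtain ⟨β, h1, h2⟩ := hmk (n - i) (by omega) (by omega)
      have h3 := hT (β, s)
      rw [IsRootTreeC, if_pos (by unfold isINI; dsimp only; omega)] at h3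
      obtain ⟨β₁, β₂, s₁, s₂, T₁, T₂, ⟨h4, h5⟩, ⟨h6, h7⟩, h8, h9, h10, h11⟩ := h3
      dsimp only at h4 h6 h10
      have hE : (T (β, s)).eval x = (-1) ^ (n - i) • longFam x n i s := by
        rw [h11, BTree.eval, hchain β₁ (n - i - 1) s₁ T₁ hin (by omega) (by omega) (by omega) h8,
          hchain β₂ (n - i) s₂ T₂ hin (by omega) (by omega) (by omega) h9,
          h.pathC_pair hi.1 hin _ _ _ _ (by omega), h10]
      have hE' : longFam x n i s = (-1 : R) ^ (n - i) • (T (β, s)).eval x := by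
        rw [hE]
        rcases Nat.even_or_odd (n - i) with he | he <;> simp [he.neg_one_pow]
      rw [hE']
      exact Submodule.smul_mem _ _ (Submodule.subset_span ⟨(β, s), rfl⟩)
    · obtain ⟨β, h1, h2⟩ : ∃ β : PosRootC n, ri β = i ∧
          (i + p < n ∧ rt β = p ∨ n ≤ i + p ∧ rt β = p + 1) := by
        rcases Nat.lt_or_ge (i + p) n with h1 | h1
        · obtain ⟨β, h2, h3⟩ := hmk p (by omega) (by omega)
          exact ⟨β, h2, Or.inl ⟨h1, h3⟩⟩
        · obtain ⟨β, h2, h3⟩ := hmk (p + 1) (by omega) (by omega)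
          exact ⟨β, h2, Or.inr ⟨h1, h3⟩⟩
      apply Submodule.subset_span
      refine ⟨(β, s), ?_⟩
      have h3 := hT (β, s)
      rw [IsRootTreeC, if_neg (by unfold isINI; dsimp only; omega)] at h3
      exact hchain β p s _ hin hp h1 h2 h3

end Span

section Words

lemma wordD_eq_map {n i p : ℕ} (hi : i + 2 ≤ n) (hp : p ≤ 2 * (n - i) - 2) (β : PosRootD n)
    (hβ : riD β = i) (ht : i + p + 2 ≤ n ∧ rtD β = p ∨ n ≤ i + p + 1 ∧ rtD β = p + 1) :
    wordD β = (List.range (p + 1)).map (colD n i) := by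
  unfold wordD
  simp only [hβ]
  rcases ht with ⟨h1, h2⟩ | ⟨h1, h2⟩
  · rw [if_pos (by omega), h2]
    apply List.ext_getElem
    · simp
    · intro k hk1 hk2
      simp only [List.getElem_range', List.getElem_map, List.getElem_range]
      simp at hk1
      have := colD_cases n i k
      omega
  · rw [if_neg (by omega)]
    split_ifs with h3 h4
    · apply List.ext_getElem
      · simp; omega
      · intro k hk1 hk2
        simp only [List.getElem_range', List.getElem_map, List.getElem_range, List.getElem_append,
          List.length_range', List.getElem_singleton]
        simp at hk1
        have := colD_cases n i k
        split_ifs <;> omega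
    · apply List.ext_getElem
      · simp; omega
      · intro k hk1 hk2
        simp only [List.getElem_range', List.getElem_map, List.getElem_range, List.getElem_append,
          List.length_range', List.getElem_cons]
        simp at hk1
        have := colD_cases n i k
        split_ifs <;> omega
    · apply List.ext_getElem
      · simp; omega
      · intro k hk1 hk2
        simp only [List.getElem_range', List.getElem_map, List.getElem_range, List.getElem_append,
          List.getElem_reverse, List.length_range', List.getElem_singleton, List.length_append,
          List.length_singleton]
        simp at hk1
        have := colD_cases n i k
        split_ifs <;> omega

lemma wordD_side {n i : ℕ} (β : PosRootD n) (hβ : riD β = i) (ht : i + rtD β + 1 = n) :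
    wordD β = (List.range (rtD β + 1)).map (fun p => i + p) := by
  unfold wordD
  simp only [hβ]
  rw [if_pos (by omega)]
  apply List.ext_getElem <;> simp

lemma wordD_last {n i : ℕ} (β : PosRootD n) (hi : n ≤ i + 1) (h : riD β = i) : wordD β = [i] := by
  have h1 : rtD β = 0 := β.2.2.1 (by change n - 1 ≤ riD β; omega)
  have h2 : riD β < n + 1 := (ofLex β.1).1.2
  unfold wordD
  rw [if_pos (by omega), h, h1]
  rfl

end Words

lemma pathFam_congr {L : Type*} [LieRing L] {x : ℕ → ℕ → L} {w w' : ℕ → ℕ} (p : ℕ)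
    (h : ∀ q, q ≤ p → w q = w' q) : pathFam x w p = pathFam x w' p := by
  induction p with
  | zero => funext s; rw [pathFam, pathFam, h 0 le_rfl]
  | succ p ih => funext s; rw [pathFam, pathFam, h (p + 1) le_rfl, ih fun q hq => h q (by omega)]

section Span
variable {R L : Type*} [CommRing R] [LieRing L] [LieAlgebra R L]
variable [IsAddTorsionFree L] {n : ℕ} {x : ℕ → ℕ → L}

/-- the root vectors of type `D_n` in the block of roots starting with `i`. -/
def blockD (x : ℕ → ℕ → L) (n i : ℕ) : Set L :=
  {z | (n ≤ i + 1 ∧ ∃ s, z = x i s) ∨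
    (i + 2 ≤ n ∧ ∃ s, z = sideFam x n i s ∨
      ∃ p, p ≤ 2 * (n - i) - 2 ∧ z = pathFam x (colD n i) p s)}

lemma sideFam_eq_pathFam {L : Type*} [LieRing L] (x : ℕ → ℕ → L) {n i p : ℕ} (h : i + p + 2 = n) :
    sideFam x n i = pathFam x (fun p => i + p) (p + 1) := by
  funext s
  rw [sideFam, pathFam, show n - i - 2 = p by omega, show i + (p + 1) = n - 1 by omega,
    pathFam_congr p fun q hq => colD_of_le (by omega)]

lemma CurrentRel.chainLie_side (h : CurrentRel (aD n) x) {i p : ℕ} (hi1 : 1 ≤ i)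
    (hi : i + p + 2 = n) (ss : List ℕ) (hss : ss.length = p + 1 + 1) :
    chainLie x ((List.range (p + 1 + 1)).map fun p => i + p) ss = sideFam x n i ss.sum := by
  rw [chainLie_eq_pathFam (p + 1) ss hss, sideFam_eq_pathFam x hi]
  intro q hq
  obtain h1 | rfl := (show q + 1 ≤ p ∨ q = p by omega)
  · have h2 := h.pathD_step hi1 (by omega) (p := q) (by omega)
    rwa [pathFam_congr q fun k hk => colD_of_le (by omega),
      pathFam_congr (q + 1) fun k hk => colD_of_le (by omega), colD_of_le (by omega)] at h2
  · have h2 := h.sideD_step hi1 (by omega)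
    rwa [show n - i - 2 = q by omega, pathFam_congr q fun k hk => colD_of_le (by omega),
      sideFam_eq_pathFam x hi, show n - 1 = i + (q + 1) by omega] at h2

theorem CurrentRel.lieSpan_le_spanD (hn : 2 ≤ n) (h : CurrentRel (aD n) x)
    (h0 : ∀ c r, (c = 0 ∨ n < c) → x c r = 0) (T : PosRootD n × ℕ → BTree)
    (hT : ∀ p, IsRootTreeD p.1 p.2 (T p)) :
    (LieSubalgebra.lieSpan R L {z | ∃ c r, z = x c r}).toSubmodule ≤
      Submodule.span R (Set.range fun p => (T p).eval x) := by
  refine (lieSpan_le_iSup (fun i => Submodule.span R (blockD x n i)) h0 ?_ ?_ ?_).trans ?_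
  · intro c r h1 hc
    apply Submodule.subset_span
    obtain hc | hc := (show c + 2 ≤ n ∨ n ≤ c + 1 by omega)
    · exact Or.inr ⟨hc, r, Or.inr ⟨0, by omega, by rw [pathFam, colD_of_le hc]; rfl⟩⟩
    · exact Or.inl ⟨hc, r, rfl⟩
  · intro c d r h1 hcd hdn
    apply lie_mem_span_of_forall
    rintro y (⟨hc, s, rfl⟩ | ⟨hc, s, rfl | ⟨p, hp, rfl⟩⟩)
    · obtain rfl | hne := hcd.eq_or_lt
      · rw [h.diag]
        exact zero_mem _
      · rw [h.commD (by omega) (by omega) (by omega) (by omega) (by omega)]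
        exact zero_mem _
    · obtain hd | rfl := Nat.lt_or_eq_of_le hdn
      · rw [h.sideD_kills h1 hc hcd hd]
        exact zero_mem _
      · have h2 := (h.pathD h1 hc (d - c - 2 + 1) (by omega)).2.2.2 (by omega)
        rw [h2]
        exact Submodule.subset_span (Or.inr ⟨hc, _, Or.inr ⟨_, by omega, rfl⟩⟩)
    · obtain rfl | hcd := hcd.eq_or_lt
      · rw [h.pathD_kills_start h1 hc p hp]
        exact zero_mem _
      by_cases hd : d = colD n c (p + 1)
      · have hp2 : p + 1 ≤ 2 * (n - c) - 2 := by
          have := colD_cases n c (p + 1)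
          omega
        rw [hd, h.pathD_step h1 hc hp2]
        exact Submodule.subset_span (Or.inr ⟨hc, _, Or.inr ⟨p + 1, hp2, rfl⟩⟩)
      · by_cases hd' : c + p + 2 = n ∧ d + 1 = n
        · have h2 := h.sideD_step h1 hc
          rw [show n - c - 2 = p by omega, show n - 1 = d by omega] at h2
          rw [h2]
          exact Submodule.subset_span (Or.inr ⟨hc, _, Or.inl rfl⟩)
        · rw [(h.pathD h1 hc p hp).1 d hcd hdn hd hd']
          exact zero_mem _
  · intro c h1 hcn
    suffices Submodule.span R (blockD x n c) ≤
        (LieSubalgebra.lieSpan R L {z | ∃ d r, c ≤ d ∧ d ≤ n ∧ z = x d r}).toSubmodule from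
      fun y hy => this hy
    rw [Submodule.span_le]
    have hcol : c + 2 ≤ n → ∀ p, p ≤ 2 * (n - c) - 2 → c ≤ colD n c p ∧ colD n c p ≤ n :=
      fun hc p hp => by
        have := colD_cases n c p
        omega
    rintro y (⟨hc, s, rfl⟩ | ⟨hc, s, rfl | ⟨p, hp, rfl⟩⟩)
    · exact LieSubalgebra.subset_lieSpan ⟨_, _, le_rfl, hcn, rfl⟩
    · exact LieSubalgebra.lie_mem _
        (pathFam_mem_lieSpan _ (fun q hq => hcol hc q (by omega)) s)
        (LieSubalgebra.subset_lieSpan ⟨n - 1, _, by omega, by omega, rfl⟩)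
    · exact pathFam_mem_lieSpan _ (fun q hq => hcol hc q (by omega)) s
  · refine iSup₂_le fun i hi => Submodule.span_le.2 ?_
    have h00 := h0 0 0 (Or.inl rfl)
    have hmk : ∀ t, (n ≤ i + 1 → t = 0) → (t = 0 ∨ t + 2 * i + 1 ≤ 2 * n) →
        ∃ β : PosRootD n, riD β = i ∧ rtD β = t :=
      fun t h1 h2 => ⟨⟨toLex (⟨i, by have := hi.2; omega⟩, ⟨t, by have := hi.1; omega⟩),
        hi.1, fun h3 => h1 (by change n - 1 ≤ i at h3; omega), h2⟩, rfl, rfl⟩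
    rintro y (⟨hin, s, rfl⟩ | ⟨hin, s, rfl | ⟨p, hp, rfl⟩⟩)
    · obtain ⟨β, h1, h2⟩ := hmk 0 (fun _ => rfl) (Or.inl rfl)
      apply Submodule.subset_span
      refine ⟨(β, s), ?_⟩
      obtain ⟨ss, hss, hs, hE⟩ := hT (β, s)
      dsimp only at hs hss hE
      rw [wordD_last β hin h1] at hss hE
      obtain ⟨a, rfl⟩ := List.length_eq_one_iff.1 hss
      simp only [List.sum_cons, List.sum_nil, Nat.add_zero] at hs
      dsimp only
      rw [hE, hs]
      rfl
    · obtain ⟨β, h1, h2⟩ := hmk (n - 1 - i) (by omega) (by omega)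
      apply Submodule.subset_span
      refine ⟨(β, s), ?_⟩
      obtain ⟨ss, hss, hs, hE⟩ := hT (β, s)
      dsimp only at hs hss hE
      rw [wordD_side β h1 (by omega), show rtD β = n - i - 2 + 1 by omega] at hss hE
      dsimp only
      rw [hE, BTree.eval_chain x h00, h.chainLie_side hi.1 (by omega) ss (by simpa using hss), hs]
    · obtain ⟨β, h1, h2⟩ : ∃ β : PosRootD n, riD β = i ∧
          (i + p + 2 ≤ n ∧ rtD β = p ∨ n ≤ i + p + 1 ∧ rtD β = p + 1) := by
        rcases Nat.lt_or_ge (i + p + 1) n with h1 | h1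
        · obtain ⟨β, h2, h3⟩ := hmk p (by omega) (by omega)
          exact ⟨β, h2, Or.inl ⟨h1, h3⟩⟩
        · obtain ⟨β, h2, h3⟩ := hmk (p + 1) (by omega) (by omega)
          exact ⟨β, h2, Or.inr ⟨h1, h3⟩⟩
      apply Submodule.subset_span
      refine ⟨(β, s), ?_⟩
      obtain ⟨ss, hss, hs, hE⟩ := hT (β, s)
      dsimp only at hs hss hE
      rw [wordD_eq_map hin hp β h1 h2] at hss hE
      dsimp only
      rw [hE, BTree.eval_chain x h00, chainLie_eq_pathFam p ss (by simpa using hss), hs]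
      exact fun q hq => h.pathD_step hi.1 hin (by omega)

end Span

section Symmetrized
variable {L : Type*} [LieRing L] [IsAddTorsionFree L]

/-- Current relations follow from the loop relation and the symmetrized Serre relations. -/
lemma CurrentRel.of_symmetrized {a : ℕ → ℕ → ℤ} {x : ℕ → ℕ → L}
    (loop : ∀ i j r s, ⁅x i (r + 1), x j s⁆ = ⁅x i r, x j (s + 1)⁆)
    (comm : ∀ i j r s, i ≠ j → a i j = 0 → ⁅x i r, x j s⁆ = 0)
    (serre₁ : ∀ i j r s t, a i j = -1 →
      ⁅x i r, ⁅x i s, x j t⁆⁆ + ⁅x i s, ⁅x i r, x j t⁆⁆ = 0)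
    (serre₂ : ∀ i j r s u t, a i j = -2 →
      ⁅x i r, ⁅x i s, ⁅x i u, x j t⁆⁆⁆ + ⁅x i r, ⁅x i u, ⁅x i s, x j t⁆⁆⁆ +
      ⁅x i s, ⁅x i r, ⁅x i u, x j t⁆⁆⁆ + ⁅x i s, ⁅x i u, ⁅x i r, x j t⁆⁆⁆ +
      ⁅x i u, ⁅x i r, ⁅x i s, x j t⁆⁆⁆ + ⁅x i u, ⁅x i s, ⁅x i r, x j t⁆⁆⁆ = 0) :
    CurrentRel a x := by
  have shift : ∀ i r s, ⁅x i r, x i s⁆ = ⁅x i 0, x i (r + s)⁆ := by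
    intro i r
    induction r with
    | zero => intro s; rw [Nat.zero_add]
    | succ r ih => intro s; rw [loop, ih]; congr 2; omega
  have diag : ∀ i r s, ⁅x i r, x i s⁆ = 0 := by
    intro i r s
    apply eq_zero_of_eq_neg_self
    rw [lie_skew, shift i r s, shift i s r, Nat.add_comm]
  have swap : ∀ i r s (z : L), ⁅x i r, ⁅x i s, z⁆⁆ = ⁅x i s, ⁅x i r, z⁆⁆ := by
    intro i r s z
    rw [leibniz_lie, diag, zero_lie, zero_add]
  refine ⟨loop, diag, comm, ?_, ?_⟩
  · intro i j r s t h
    have := serre₁ i j s r t h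
    rw [swap i r s, ← two_nsmul] at this
    have key : ⁅⁅x j t, x i r⁆, x i s⁆ = ⁅x i s, ⁅x i r, x j t⁆⁆ := by
      rw [← lie_skew, ← lie_skew (x i r), lie_neg]
    rw [key]
    simpa using this
  · intro i j r s u t h
    have := serre₂ i j u s r t h
    have key : ⁅⁅⁅x j t, x i r⁆, x i s⁆, x i u⁆ = -⁅x i u, ⁅x i s, ⁅x i r, x j t⁆⁆⁆ := by
      have hk : ⁅⁅x j t, x i r⁆, x i s⁆ = ⁅x i s, ⁅x i r, x j t⁆⁆ := by
        rw [← lie_skew, ← lie_skew (x i r), lie_neg]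
      rw [hk, ← lie_skew]
    have e1 : ⁅x i u, ⁅x i r, ⁅x i s, x j t⁆⁆⁆ = ⁅x i u, ⁅x i s, ⁅x i r, x j t⁆⁆⁆ := by
      rw [swap i r s]
    have e2 : ⁅x i s, ⁅x i u, ⁅x i r, x j t⁆⁆⁆ = ⁅x i u, ⁅x i s, ⁅x i r, x j t⁆⁆⁆ := swap ..
    have e3 : ⁅x i s, ⁅x i r, ⁅x i u, x j t⁆⁆⁆ = ⁅x i u, ⁅x i s, ⁅x i r, x j t⁆⁆⁆ := by
      rw [swap i r u, e2]
    have e4 : ⁅x i r, ⁅x i u, ⁅x i s, x j t⁆⁆⁆ = ⁅x i u, ⁅x i s, ⁅x i r, x j t⁆⁆⁆ := by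
      rw [swap i r u, e1]
    have e5 : ⁅x i r, ⁅x i s, ⁅x i u, x j t⁆⁆⁆ = ⁅x i u, ⁅x i s, ⁅x i r, x j t⁆⁆⁆ := by
      rw [swap i r s, e3]
    rw [e1, e2, e3, e4, e5] at this
    have h6 : 6 • ⁅x i u, ⁅x i s, ⁅x i r, x j t⁆⁆⁆ = 0 := by
      rw [← this]; abel
    rw [key, neg_eq_zero]
    exact (nsmul_eq_zero_iff_right (by norm_num)).1 h6

end Symmetrized

/-- the defining relations of the positive subalgebra of the Yangian, for a family of elements of a
`ℚ[ħ]`-algebra indexed by all pairs of natural numbers. -/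
structure YangRel (A : ℕ → ℕ → ℤ) (Dd : ℕ → ℕ) {B : Type*} [Ring B] [Algebra RH B]
    (g : ℕ → ℕ → B) : Prop where
  loop : ∀ i j r s, ⁅g i (r + 1), g j s⁆ - ⁅g i r, g j (s + 1)⁆ =
    (Polynomial.C (((Dd i : ℚ) * (A i j : ℚ)) / 2) * hbar) • (g i r * g j s + g j s * g i r)
  comm : ∀ i j r s, i ≠ j → A i j = 0 → ⁅g i r, g j s⁆ = 0
  serre₁ : ∀ i j r s t, i ≠ j → A i j = -1 →
    ⁅g i r, ⁅g i s, g j t⁆⁆ + ⁅g i s, ⁅g i r, g j t⁆⁆ = 0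
  serre₂ : ∀ i j r s u t, i ≠ j → A i j = -2 →
    ⁅g i r, ⁅g i s, ⁅g i u, g j t⁆⁆⁆ + ⁅g i r, ⁅g i u, ⁅g i s, g j t⁆⁆⁆ +
    ⁅g i s, ⁅g i r, ⁅g i u, g j t⁆⁆⁆ + ⁅g i s, ⁅g i u, ⁅g i r, g j t⁆⁆⁆ +
    ⁅g i u, ⁅g i r, ⁅g i s, g j t⁆⁆⁆ + ⁅g i u, ⁅g i s, ⁅g i r, g j t⁆⁆⁆ = 0

section Presentation
variable (n : ℕ) (A : ℕ → ℕ → ℤ) (Dd : ℕ → ℕ)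

lemma map_serre {B B' : Type*} [Ring B] [Ring B'] (f : B → B')
    (hf : ∀ a b, f (a * b - b * a) = ⁅f a, f b⁆) (l : List B) (z : B) :
    f (l.foldr (fun a b => a * b - b * a) z) = (l.map f).foldr (fun a b => ⁅a, b⁆) (f z) := by
  induction l with
  | nil => rfl
  | cons a l ih => simp [ih, hf]

/-- the sum over permutations of iterated brackets. -/
def serreSum {B : Type*} [Ring B] (m : ℕ) (u : Fin m → B) (z : B) : B :=
  ∑ σ : Equiv.Perm (Fin m), (List.ofFn fun l => u (σ l)).foldr (fun a b => ⁅a, b⁆) z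

lemma serreSum_one {B : Type*} [Ring B] (u : Fin 1 → B) (z : B) :
    serreSum 1 u z = ⁅u 0, z⁆ := by
  simp [serreSum]

lemma serreSum_two {B : Type*} [Ring B] (u : Fin 2 → B) (z : B) :
    serreSum 2 u z = ⁅u 0, ⁅u 1, z⁆⁆ + ⁅u 1, ⁅u 0, z⁆⁆ := by
  have : (Finset.univ : Finset (Equiv.Perm (Fin 2))) = {1, Equiv.swap 0 1} := by decide
  rw [serreSum, this, Finset.sum_pair (by decide)]
  simp

lemma serreSum_three {B : Type*} [Ring B] (u : Fin 3 → B) (z : B) :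
    serreSum 3 u z =
      ⁅u 0, ⁅u 1, ⁅u 2, z⁆⁆⁆ + ⁅u 0, ⁅u 2, ⁅u 1, z⁆⁆⁆ + ⁅u 1, ⁅u 0, ⁅u 2, z⁆⁆⁆ +
      ⁅u 1, ⁅u 2, ⁅u 0, z⁆⁆⁆ + ⁅u 2, ⁅u 0, ⁅u 1, z⁆⁆⁆ + ⁅u 2, ⁅u 1, ⁅u 0, z⁆⁆⁆ := by
  have h : (Finset.univ : Finset (Equiv.Perm (Fin 3))) =
      {1, Equiv.swap 1 2, Equiv.swap 0 1, Equiv.swap 0 1 * Equiv.swap 1 2,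
        Equiv.swap 1 2 * Equiv.swap 0 1, Equiv.swap 0 2} := by decide
  rw [serreSum, h, Finset.sum_insert (by decide), Finset.sum_insert (by decide),
    Finset.sum_insert (by decide), Finset.sum_insert (by decide), Finset.sum_insert (by decide),
    Finset.sum_singleton]
  have e1 : (Equiv.swap 1 2 : Equiv.Perm (Fin 3)) 0 = 0 := by decide
  have e2 : (Equiv.swap 0 1 : Equiv.Perm (Fin 3)) 2 = 2 := by decide
  have e3 : (Equiv.swap 0 2 : Equiv.Perm (Fin 3)) 1 = 1 := by decide
  simp [List.ofFn_succ, e1, e2, e3, add_assoc]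

variable {n A Dd}

lemma yg_relation {u v : FAY n} (h : YRel n A Dd u v) :
    RingQuot.mkAlgHom RH (YRel n A Dd) u = RingQuot.mkAlgHom RH (YRel n A Dd) v :=
  RingQuot.mkAlgHom_rel RH h

lemma gy1_succ (i : Fin n) (r : ℕ) : gy1 n A Dd (i.1 + 1) r = yg n A Dd i r := by
  rw [gy1, dif_pos ⟨by omega, by omega⟩]
  congr

lemma gy1_eq_zero {i : ℕ} (h : i = 0 ∨ n < i) (r : ℕ) : gy1 n A Dd i r = 0 := by
  rw [gy1, dif_neg (by omega)]

lemma gy1_serre {i j : ℕ} (hij : i ≠ j) {m : ℕ} (hm : (1 - A i j).toNat = m) (hm0 : m ≠ 0)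
    (ss : Fin m → ℕ) (r : ℕ) :
    serreSum m (fun l => gy1 n A Dd i (ss l)) (gy1 n A Dd j r) = 0 := by
  by_cases hi : i = 0 ∨ n < i
  · obtain ⟨m, rfl⟩ := Nat.exists_eq_succ_of_ne_zero hm0
    simp [serreSum, gy1_eq_zero hi, List.ofFn_succ, Ring.lie_def]
  by_cases hj : j = 0 ∨ n < j
  · have : ∀ l : List (YA n A Dd), l.foldr (fun a b => ⁅a, b⁆) (0 : YA n A Dd) = 0 := by
      intro l; induction l with
      | nil => rfl
      | cons a l ih => rw [List.foldr_cons, ih]; simp [Ring.lie_def]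
    simp [serreSum, gy1_eq_zero hj, this]
  obtain ⟨i, rfl⟩ := Nat.exists_eq_succ_of_ne_zero (n := i) (by omega)
  obtain ⟨j, rfl⟩ := Nat.exists_eq_succ_of_ne_zero (n := j) (by omega)
  subst hm
  have h := yg_relation (YRel.serre (n := n) (A := A) (Dd := Dd) ⟨i, by omega⟩ ⟨j, by omega⟩
    (by simpa using hij) ss r)
  rw [map_zero, map_sum] at h
  rw [serreSum, ← h]
  refine Finset.sum_congr rfl fun σ _ => ?_
  have h2 := map_serre (RingQuot.mkAlgHom RH (YRel n A Dd))
    (fun a b => by simp [Ring.lie_def])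
    (List.ofFn fun l => fy n ⟨i, by omega⟩ (ss (σ l))) (fy n ⟨j, by omega⟩ r)
  refine Eq.trans ?_ h2.symm
  rw [List.map_ofFn]
  have e1 := fun r => gy1_succ (n := n) (A := A) (Dd := Dd) ⟨i, by omega⟩ r
  have e2 := fun r => gy1_succ (n := n) (A := A) (Dd := Dd) ⟨j, by omega⟩ r
  simp only [Nat.succ_eq_add_one]
  simp only [e1, e2]
  rfl

lemma yangRel_gy1 : YangRel A Dd (gy1 n A Dd) where
  loop i j r s := by
    by_cases hi : i = 0 ∨ n < i
    · simp [gy1_eq_zero hi, Ring.lie_def]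
    by_cases hj : j = 0 ∨ n < j
    · simp [gy1_eq_zero hj, Ring.lie_def]
    obtain ⟨i, rfl⟩ := Nat.exists_eq_succ_of_ne_zero (n := i) (by omega)
    obtain ⟨j, rfl⟩ := Nat.exists_eq_succ_of_ne_zero (n := j) (by omega)
    have h := yg_relation (YRel.loop (n := n) (A := A) (Dd := Dd) ⟨i, by omega⟩ ⟨j, by omega⟩ r s)
    have e1 := fun r => gy1_succ (n := n) (A := A) (Dd := Dd) ⟨i, by omega⟩ r
    have e2 := fun r => gy1_succ (n := n) (A := A) (Dd := Dd) ⟨j, by omega⟩ r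
    simp only [Nat.succ_eq_add_one]
    simp only [e1, e2, Ring.lie_def]
    simp only [map_sub, map_mul, map_smul, map_add] at h
    exact h
  comm i j r s hij h := by
    have := gy1_serre (n := n) (A := A) (Dd := Dd) (m := 1) hij (by rw [h]; rfl) one_ne_zero ![r] s
    rwa [serreSum_one] at this
  serre₁ i j r s t hij h := by
    have := gy1_serre (n := n) (A := A) (Dd := Dd) (m := 2) hij (by rw [h]; rfl) two_ne_zero
      ![r, s] t
    rwa [serreSum_two] at this
  serre₂ i j r s u t hij h := by
    have := gy1_serre (n := n) (A := A) (Dd := Dd) (m := 3) hij (by rw [h]; rfl) three_ne_zero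
      ![r, s, u] t
    rwa [serreSum_three] at this

/-- Universal property of the positive subalgebra of the Yangian. -/
lemma YangRel.exists_algHom {B : Type*} [Ring B] [Algebra RH B] {g : ℕ → ℕ → B}
    (hA : ∀ i j, i ≠ j → A i j = 0 ∨ A i j = -1 ∨ A i j = -2) (h : YangRel A Dd g)
    (h0 : ∀ c r, (c = 0 ∨ n < c) → g c r = 0) :
    ∃ f : YA n A Dd →ₐ[RH] B, ∀ c r, f (gy1 n A Dd c r) = g c r := by
  let F : FAY n →ₐ[RH] B := FreeAlgebra.lift RH fun p => g (p.1.1 + 1) p.2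
  have hF : ∀ i r, F (fy n i r) = g (i.1 + 1) r := fun i r => FreeAlgebra.lift_ι_apply _ _
  have hrel : ∀ ⦃u v⦄, YRel n A Dd u v → F u = F v := by
    intro u v huv
    induction huv with
    | loop i j r s =>
      have := h.loop (i.1 + 1) (j.1 + 1) r s
      simp only [Ring.lie_def] at this
      simpa only [map_sub, map_mul, map_smul, map_add, hF] using this
    | serre i j hij ss r =>
      rw [map_zero, map_sum]
      have e : ∀ σ : Equiv.Perm (Fin (1 - A (i.1 + 1) (j.1 + 1)).toNat),
          F ((List.ofFn fun l => fy n i (ss (σ l))).foldr (fun a b => a * b - b * a) (fy n j r)) =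
          (List.ofFn fun l => g (i.1 + 1) (ss (σ l))).foldr (fun a b => ⁅a, b⁆)
            (g (j.1 + 1) r) := by
        intro σ
        refine (map_serre F (fun a b => by simp [Ring.lie_def]) _ _).trans ?_
        rw [List.map_ofFn]
        simp only [Function.comp_def, hF]
      simp only [e]
      have hne : i.1 + 1 ≠ j.1 + 1 := fun h => hij (Fin.ext (by omega))
      change serreSum _ (fun l => g (i.1 + 1) (ss l)) _ = 0
      have key : ∀ m (_ : (1 - A (i.1 + 1) (j.1 + 1)).toNat = m) (ss : Fin m → ℕ),
          serreSum m (fun l => g (i.1 + 1) (ss l)) (g (j.1 + 1) r) = 0 := by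
        intro m hm ss
        rcases hA _ _ hne with h' | h' | h'
        · rw [h'] at hm
          obtain rfl : m = 1 := by rw [← hm]; rfl
          rw [serreSum_one, h.comm _ _ _ _ hne h']
        · rw [h'] at hm
          obtain rfl : m = 2 := by rw [← hm]; rfl
          rw [serreSum_two, h.serre₁ _ _ _ _ _ hne h']
        · rw [h'] at hm
          obtain rfl : m = 3 := by rw [← hm]; rfl
          rw [serreSum_three, h.serre₂ _ _ _ _ _ _ hne h']
      exact key _ rfl ss
  refine ⟨RingQuot.liftAlgHom RH ⟨F, hrel⟩, fun c r => ?_⟩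
  by_cases hc : c = 0 ∨ n < c
  · rw [gy1_eq_zero hc, map_zero, h0 c r hc]
  obtain ⟨c, rfl⟩ := Nat.exists_eq_succ_of_ne_zero (n := c) (by omega)
  refine (congrArg _ (gy1_succ (n := n) (A := A) (Dd := Dd) ⟨c, by omega⟩ r)).trans ?_
  rw [yg, RingQuot.liftAlgHom_mkAlgHom_apply]
  exact hF _ _

end Presentation

section Semiclassical
attribute [local instance] LieRing.ofAssociativeRing
variable {B : Type} [Ring B] [Algebra RH B]

lemma lie_smul_assoc (c : RH) (a b : B) : ⁅a, c • b⁆ = c • ⁅a, b⁆ := by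
  simp only [Ring.lie_def, mul_smul_comm, smul_mul_assoc, smul_sub]

/-- the Lie `ℚ[ħ]`-subalgebra generated by the elements `g c r`. -/
def genLie (g : ℕ → ℕ → B) : LieSubalgebra RH B :=
  LieSubalgebra.lieSpan RH B {z | ∃ c r, z = g c r}

/-- the rescaling `ħ • L` of a Lie subalgebra. -/
def hSub (L : LieSubalgebra RH B) : Submodule RH B :=
  L.toSubmodule.map (LinearMap.lsmul RH B hbar)

lemma mem_hSub {L : LieSubalgebra RH B} {v : B} : v ∈ hSub L ↔ ∃ a ∈ L, hbar • a = v := by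
  simp [hSub]

lemma smul_mem_hSub {L : LieSubalgebra RH B} {a : B} (ha : a ∈ L) : hbar • a ∈ hSub L :=
  mem_hSub.2 ⟨a, ha, rfl⟩

lemma lie_mem_hSub {L : LieSubalgebra RH B} {a v : B} (ha : a ∈ L) (hv : v ∈ hSub L) :
    ⁅a, v⁆ ∈ hSub L := by
  obtain ⟨b, hb, rfl⟩ := mem_hSub.1 hv
  rw [lie_smul_assoc]
  exact smul_mem_hSub (L.lie_mem ha hb)

lemma lie_mem_hSub_mul {L : LieSubalgebra RH B} {a v : B} (ha : a ∈ L)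
    (hv : v ∈ hSub L * hSub L) : ⁅a, v⁆ ∈ hSub L * hSub L := by
  induction hv using Submodule.mul_induction_on' with
  | mem_mul_mem u hu w hw =>
    have : ⁅a, u * w⁆ = ⁅a, u⁆ * w + u * ⁅a, w⁆ := by
      simp only [Ring.lie_def]; noncomm_ring
    rw [this]
    exact add_mem (Submodule.mul_mem_mul (lie_mem_hSub ha hu) hw)
      (Submodule.mul_mem_mul hu (lie_mem_hSub ha hw))
  | add u _ w _ h1 h2 => rw [lie_add]; exact add_mem h1 h2

/-- the elements of `L` which become decomposable after multiplication by `ħ`. -/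
def decompIdeal (L : LieSubalgebra RH B) : LieIdeal RH L where
  carrier := {a | hbar • (a : B) ∈ hSub L * hSub L}
  add_mem' {a b} ha hb := by
    simp only [Set.mem_ofPred_eq] at *
    push_cast
    rw [smul_add]
    exact add_mem ha hb
  zero_mem' := by simp
  smul_mem' c a ha := by
    simp only [Set.mem_ofPred_eq] at *
    push_cast
    rw [smul_comm]
    exact Submodule.smul_mem _ _ ha
  lie_mem {a b} hb := by
    change hbar • ((⁅a, b⁆ : L) : B) ∈ (hSub L * hSub L : Submodule RH B)
    have hb' : hbar • (b : B) ∈ hSub L * hSub L := hb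
    rw [LieSubalgebra.coe_bracket, ← lie_smul_assoc]
    exact lie_mem_hSub_mul a.2 hb'

lemma isAddTorsionFree_of_module (M : Type*) [AddCommGroup M] [Module RH M] :
    IsAddTorsionFree M where
  nsmul_right_injective k hk a b hab := by
    have h : ∀ c : M, Polynomial.C ((k : ℚ)⁻¹) • (k • c) = c := by
      intro c
      rw [← Nat.cast_smul_eq_nsmul RH, smul_smul, ← map_natCast Polynomial.C k, ← map_mul,
        inv_mul_cancel₀ (by exact_mod_cast hk), map_one, one_smul]
    have hab' : k • a = k • b := hab
    rw [← h a, hab', h b]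

variable {n : ℕ} {A : ℕ → ℕ → ℤ} {Dd : ℕ → ℕ} {ι : Type}

/-- spanning of the Lie algebra of a current presentation by the bracketings `T`. -/
def SpansCurrent (n : ℕ) (A : ℕ → ℕ → ℤ) (T : ι → BTree) : Prop :=
  ∀ (L : Type) [LieRing L] [LieAlgebra RH L] [IsAddTorsionFree L] (x : ℕ → ℕ → L),
    CurrentRel A x → (∀ c r, (c = 0 ∨ n < c) → x c r = 0) →
    (LieSubalgebra.lieSpan RH L {z | ∃ c r, z = x c r}).toSubmodule ≤
      Submodule.span RH (Set.range fun p => (T p).eval x)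

/-- the generator `g c r` as an element of the Lie algebra it generates. -/
def genIn (g : ℕ → ℕ → B) (c r : ℕ) : genLie g :=
  ⟨g c r, LieSubalgebra.subset_lieSpan ⟨c, r, rfl⟩⟩

lemma lieSpan_genIn (g : ℕ → ℕ → B) :
    LieSubalgebra.lieSpan RH (genLie g) {z | ∃ c r, z = genIn g c r} = ⊤ := by
  rw [eq_top_iff]
  rintro ⟨z, hz⟩ -
  have : genLie g ≤ (LieSubalgebra.lieSpan RH (genLie g) {z | ∃ c r, z = genIn g c r}).map
      (genLie g).incl := by
    refine LieSubalgebra.lieSpan_le.2 ?_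
    rintro _ ⟨c, r, rfl⟩
    exact ⟨genIn g c r, LieSubalgebra.subset_lieSpan ⟨c, r, rfl⟩, rfl⟩
  obtain ⟨w, hw, e⟩ := this hz
  have : w = ⟨z, hz⟩ := Subtype.ext e
  rwa [← this]

lemma YangRel.currentRel_quotient {g : ℕ → ℕ → B} (h : YangRel A Dd g) (hA : ∀ i, A i i = 2) :
    CurrentRel A fun c r => LieSubmodule.Quotient.mk' (decompIdeal (genLie g)) (genIn g c r) := by
  have tf : IsAddTorsionFree (genLie g ⧸ decompIdeal (genLie g)) :=
    isAddTorsionFree_of_module _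
  have hm : ∀ a b : genLie g, LieSubmodule.Quotient.mk' (decompIdeal (genLie g)) ⁅a, b⁆ =
      ⁅LieSubmodule.Quotient.mk' (decompIdeal (genLie g)) a,
        LieSubmodule.Quotient.mk' (decompIdeal (genLie g)) b⁆ := fun a b => rfl
  refine CurrentRel.of_symmetrized ?_ ?_ ?_ ?_
  · intro i j r s
    rw [← hm, ← hm, ← sub_eq_zero, ← map_sub, LieSubmodule.Quotient.mk_eq_zero]
    change hbar • (⁅g i (r + 1), g j s⁆ - ⁅g i r, g j (s + 1)⁆) ∈
      (hSub (genLie g) * hSub (genLie g) : Submodule RH B)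
    rw [h.loop, smul_smul, mul_comm, mul_assoc, ← smul_smul]
    refine Submodule.smul_mem _ _ ?_
    have hg : ∀ c r, hbar • g c r ∈ hSub (genLie g) := fun c r => smul_mem_hSub (genIn g c r).2
    have e : (hbar * hbar) • (g i r * g j s + g j s * g i r) =
        (hbar • g i r) * (hbar • g j s) + (hbar • g j s) * (hbar • g i r) := by
      rw [smul_add, smul_mul_smul_comm, smul_mul_smul_comm]
    rw [e]
    exact add_mem (Submodule.mul_mem_mul (hg _ _) (hg _ _))
      (Submodule.mul_mem_mul (hg _ _) (hg _ _))
  · intro i j r s hij ha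
    rw [← hm]
    have : ⁅genIn g i r, genIn g j s⁆ = 0 := Subtype.ext (h.comm i j r s hij ha)
    rw [this, map_zero]
  · intro i j r s t ha
    have hij : i ≠ j := by rintro rfl; rw [hA] at ha; omega
    simp only [← hm, ← map_add]
    rw [show ⁅genIn g i r, ⁅genIn g i s, genIn g j t⁆⁆ + ⁅genIn g i s, ⁅genIn g i r, genIn g j t⁆⁆
      = 0
      from Subtype.ext (h.serre₁ i j r s t hij ha), map_zero]
  · intro i j r s u t ha
    have hij : i ≠ j := by rintro rfl; rw [hA] at ha; omega
    simp only [← hm, ← map_add]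
    exact (congrArg _ (Subtype.ext (h.serre₂ i j r s u t hij ha))).trans (map_zero _)

lemma eval_genIn (g : ℕ → ℕ → B) (T : BTree) : ((T.eval (genIn g) : genLie g) : B) = T.eval g :=
  BTree.map_eval (fun a : genLie g => (a : B)) (fun _ _ => rfl) _ T

lemma eval_mem_genLie (g : ℕ → ℕ → B) (T : BTree) : T.eval g ∈ genLie g := by
  rw [← eval_genIn]; exact (T.eval (genIn g)).2

/-- Modulo decomposable elements, `ħ • L` is spanned by the rescaled bracketings. -/
theorem YangRel.hSub_le {g : ℕ → ℕ → B} (h : YangRel A Dd g) (hA : ∀ i, A i i = 2)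
    (h0 : ∀ c r, (c = 0 ∨ n < c) → g c r = 0) {T : ι → BTree} (hT : SpansCurrent n A T) :
    hSub (genLie g) ≤ Submodule.span RH (Set.range fun p => hbar • (T p).eval g) ⊔
      hSub (genLie g) * hSub (genLie g) := by
  have tf : IsAddTorsionFree (genLie g ⧸ decompIdeal (genLie g)) :=
    isAddTorsionFree_of_module _
  set π := LieSubmodule.Quotient.mk' (decompIdeal (genLie g)) with hπ
  have hm : ∀ a b : genLie g, π ⁅a, b⁆ = ⁅π a, π b⁆ := fun a b => rfl
  have hspan := hT (genLie g ⧸ decompIdeal (genLie g)) _ (h.currentRel_quotient hA) (by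
    intro c r hc
    rw [show genIn g c r = 0 from Subtype.ext (h0 c r hc), map_zero])
  intro v hv
  obtain ⟨a, ha, rfl⟩ := mem_hSub.1 hv
  have hall : ∀ b : genLie g, π b ∈ LieSubalgebra.lieSpan RH
      (genLie g ⧸ decompIdeal (genLie g)) {z | ∃ c r, z = π (genIn g c r)} := by
    intro b
    have hb : b ∈ LieSubalgebra.lieSpan RH (genLie g) {z | ∃ c r, z = genIn g c r} := by
      rw [lieSpan_genIn]; trivial
    induction hb using LieSubalgebra.lieSpan_induction with
    | mem x hx => obtain ⟨c, r, rfl⟩ := hx; exact LieSubalgebra.subset_lieSpan ⟨c, r, rfl⟩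
    | zero => rw [map_zero]; exact zero_mem _
    | add x y _ _ hx hy => rw [map_add]; exact add_mem hx hy
    | smul c x _ hx => rw [map_smul]; exact LieSubalgebra.smul_mem _ c hx
    | lie x y _ _ hx hy => rw [hm]; exact LieSubalgebra.lie_mem _ hx hy
  have h1 := hspan (hall ⟨a, ha⟩)
  have h2 : (Set.range fun p => (T p).eval fun c r => π (genIn g c r)) =
      (π : genLie g →ₗ[RH] _) '' Set.range fun p => (T p).eval (genIn g) := by
    rw [← Set.range_comp]
    congr 1
    funext p
    exact (BTree.map_eval π hm _ (T p)).symm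
  rw [h2, Submodule.span_image] at h1
  obtain ⟨w, hw, hwa⟩ := h1
  have h3 : π (⟨a, ha⟩ - w) = 0 := by
    rw [map_sub, sub_eq_zero]; exact hwa.symm
  rw [LieSubmodule.Quotient.mk_eq_zero] at h3
  have h4 : hbar • (a - (w : B)) ∈ hSub (genLie g) * hSub (genLie g) := h3
  have h5 : hbar • (w : B) ∈ Submodule.span RH (Set.range fun p => hbar • (T p).eval g) := by
    let f : genLie g →ₗ[RH] B := (LinearMap.lsmul RH B hbar).comp (genLie g).toSubmodule.subtype
    have : f w ∈ (Submodule.span RH (Set.range fun p => (T p).eval (genIn g))).map f :=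
      Submodule.mem_map_of_mem hw
    rw [Submodule.map_span, ← Set.range_comp] at this
    have e : f ∘ (fun p => (T p).eval (genIn g)) = fun p => hbar • (T p).eval g := by
      funext p
      exact congrArg (hbar • ·) (eval_genIn g (T p))
    rwa [e] at this
  have e : hbar • a = hbar • (w : B) + hbar • (a - (w : B)) := by
    rw [← smul_add]; congr 1; abel
  rw [e]
  exact Submodule.add_mem_sup h5 h4

end Semiclassical

lemma exists_list_ordMon {B κ : Type} [Ring B] [LinearOrder κ] (E : κ → B) (h : κ →₀ ℕ) :
    ∃ l : List κ, (∀ p, l.count p = h p) ∧ ordMon E h = (l.map E).prod := by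
  refine ⟨(h.support.sort (· ≤ ·)).flatMap fun p => List.replicate (h p) p, fun p => ?_, ?_⟩
  · rw [List.count_flatMap]
    have : ((h.support.sort (· ≤ ·)).map
        (List.count p ∘ fun p => List.replicate (h p) p)).sum =
        ∑ q ∈ h.support, List.count p (List.replicate (h q) q) := by
      rw [← List.sum_toFinset _ (Finset.sort_nodup _ _), Finset.sort_toFinset]
      rfl
    rw [this]
    simp only [List.count_replicate]
    by_cases hp : h p = 0
    · rw [hp]
      refine Finset.sum_eq_zero fun q hq => ?_
      rw [if_neg]
      simp only [beq_iff_eq]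
      rintro rfl
      exact (Finsupp.mem_support_iff.1 hq) hp
    · simp [hp]
  · rw [ordMon]
    generalize h.support.sort (· ≤ ·) = l
    induction l with
    | nil => simp
    | cons a l ih => simp [ih]

section Grading
attribute [local instance] LieRing.ofAssociativeRing
variable {B : Type} [Ring B] [Algebra RH B] {g : ℕ → ℕ → B}

/-- `δ` encodes a grading of `B` for which `g c r` has degree `r + 1` and `ħ` has degree `1`. -/
structure IsGrading (g : ℕ → ℕ → B) (δ : B →+* Polynomial B) : Prop where
  gen : ∀ c r, δ (g c r) = Polynomial.monomial (r + 1) (g c r)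
  rat : ∀ (q : ℚ) (b : B) (D : ℕ),
    (δ (Polynomial.C q • b)).coeff D = Polynomial.C q • (δ b).coeff D
  hbar_zero : ∀ b : B, (δ (hbar • b)).coeff 0 = 0
  hbar_succ : ∀ (b : B) (D : ℕ), (δ (hbar • b)).coeff (D + 1) = hbar • (δ b).coeff D
  eval_one : ∀ b : B, (δ b).eval 1 = b

namespace IsGrading
variable {δ : B →+* Polynomial B}

lemma smul_mem (h : IsGrading g δ) (S : Submodule RH B) (p : RH) : ∀ {b : B},
    (∀ D, (δ b).coeff D ∈ S) → ∀ D, (δ (p • b)).coeff D ∈ S := by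
  induction p using Polynomial.induction_on' with
  | add p q hp hq =>
    intro b hb D
    rw [add_smul, map_add, Polynomial.coeff_add]
    exact add_mem (hp hb D) (hq hb D)
  | monomial k a =>
    induction k with
    | zero =>
      intro b hb D
      rw [Polynomial.monomial_zero_left, h.rat]
      exact S.smul_mem _ (hb D)
    | succ k ih =>
      intro b hb D
      rw [← Polynomial.monomial_mul_X, mul_smul]
      refine ih (fun D => ?_) D
      rcases D with _ | D
      · exact (h.hbar_zero b).symm ▸ zero_mem _
      · exact (h.hbar_succ b D).symm ▸ S.smul_mem _ (hb D)

lemma mem_of_coeff (h : IsGrading g δ) (S : Submodule RH B) {b : B}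
    (hb : ∀ D, (δ b).coeff D ∈ S) : b ∈ S := by
  rw [← h.eval_one b, Polynomial.eval_eq_sum]
  exact Submodule.sum_mem _ fun D _ => by simpa using hb D

lemma coeff_mem_span (h : IsGrading g δ) {X : Set B}
    (hX : ∀ x ∈ X, ∃ d, δ x = Polynomial.monomial d x) {b : B} (hb : b ∈ Submodule.span RH X) :
    ∀ D, (δ b).coeff D ∈ Submodule.span RH X := by
  induction hb using Submodule.span_induction with
  | mem x hx =>
    intro D
    obtain ⟨d, hd⟩ := hX x hx
    rw [hd, Polynomial.coeff_monomial]
    split_ifs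
    · exact Submodule.subset_span hx
    · exact zero_mem _
  | zero => simp
  | add x y _ _ hx hy =>
    intro D
    rw [map_add, Polynomial.coeff_add]
    exact add_mem (hx D) (hy D)
  | smul p x _ hx => exact h.smul_mem _ p hx

lemma eval_tree (h : IsGrading g δ) (T : BTree) :
    ∃ d, δ (T.eval g) = Polynomial.monomial d (T.eval g) := by
  induction T with
  | leaf c r => exact ⟨_, h.gen c r⟩
  | br a b iha ihb =>
    obtain ⟨d, hd⟩ := iha
    obtain ⟨e, he⟩ := ihb
    refine ⟨d + e, ?_⟩
    simp only [BTree.eval]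
    rw [Ring.lie_def, map_sub, map_mul, map_mul, hd, he, Polynomial.monomial_mul_monomial,
      Polynomial.monomial_mul_monomial, add_comm e d, ← map_sub]

lemma hbar_smul (h : IsGrading g δ) {b : B} {d : ℕ} (hd : δ b = Polynomial.monomial d b) :
    δ (hbar • b) = Polynomial.monomial (d + 1) (hbar • b) := by
  ext D
  rcases D with _ | D
  · rw [h.hbar_zero, Polynomial.coeff_monomial, if_neg (by omega)]
  · rw [h.hbar_succ, hd, Polynomial.coeff_monomial, Polynomial.coeff_monomial]
    by_cases hD : d = D
    · simp [hD]
    · rw [if_neg hD, if_neg (by omega), smul_zero]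

lemma coeff_mem_genLie (h : IsGrading g δ) {a : B} (ha : a ∈ genLie g) :
    ∀ D, (δ a).coeff D ∈ genLie g := by
  induction ha using LieSubalgebra.lieSpan_induction with
  | mem x hx =>
    obtain ⟨c, r, rfl⟩ := hx
    intro D
    rw [h.gen, Polynomial.coeff_monomial]
    split_ifs
    · exact LieSubalgebra.subset_lieSpan ⟨c, r, rfl⟩
    · exact zero_mem _
  | zero => intro D; rw [map_zero]; exact zero_mem _
  | add x y _ _ hx hy =>
    intro D
    rw [map_add, Polynomial.coeff_add]
    exact add_mem (hx D) (hy D)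
  | smul p x _ hx => exact h.smul_mem (genLie g).toSubmodule p hx
  | lie x y _ _ hx hy =>
    intro D
    rw [Ring.lie_def, map_sub, map_mul, map_mul, Polynomial.coeff_sub, Polynomial.coeff_mul,
      Polynomial.coeff_mul, ← Finset.Nat.sum_antidiagonal_swap (n := D) (f := fun p =>
        (δ y).coeff p.1 * (δ x).coeff p.2), ← Finset.sum_sub_distrib]
    exact sum_mem fun p _ => (genLie g).lie_mem (hx p.1) (hy p.2)

lemma coeff_mem_hSub (h : IsGrading g δ) {v : B} (hv : v ∈ hSub (genLie g)) :
    (δ v).coeff 0 = 0 ∧ ∀ D, (δ v).coeff D ∈ hSub (genLie g) := by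
  obtain ⟨a, ha, rfl⟩ := mem_hSub.1 hv
  refine ⟨h.hbar_zero a, fun D => ?_⟩
  rcases D with _ | D
  · rw [h.hbar_zero]; exact zero_mem _
  · rw [h.hbar_succ]; exact smul_mem_hSub (h.coeff_mem_genLie ha D)

end IsGrading

variable {n : ℕ} {A : ℕ → ℕ → ℤ} {Dd : ℕ → ℕ} {ι : Type} {δ : B →+* Polynomial B}

/-- The rescaled root vectors generate the algebra generated by `ħ • L`. -/
theorem adjoin_eq_adjoin_hSub (h : YangRel A Dd g) (hA : ∀ i, A i i = 2)
    (h0 : ∀ c r, (c = 0 ∨ n < c) → g c r = 0) (hδ : IsGrading g δ)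
    {T : ι → BTree} (hT : SpansCurrent n A T) :
    Algebra.adjoin RH (Set.range fun p => hbar • (T p).eval g) =
      Algebra.adjoin RH (hSub (genLie g) : Set B) := by
  set X := Set.range fun p => hbar • (T p).eval g with hX
  refine le_antisymm (Algebra.adjoin_mono ?_) (Algebra.adjoin_le ?_)
  · rintro _ ⟨p, rfl⟩
    exact smul_mem_hSub (eval_mem_genLie g (T p))
  have hXh : ∀ x ∈ X, ∃ d, δ x = Polynomial.monomial d x := by
    rintro _ ⟨p, rfl⟩
    obtain ⟨d, hd⟩ := hδ.eval_tree (T p)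
    exact ⟨_, hδ.hbar_smul hd⟩
  have hle : Submodule.span RH X ≤ Subalgebra.toSubmodule (Algebra.adjoin RH X) :=
    Submodule.span_le.2 Algebra.subset_adjoin
  have key : ∀ D, ∀ v ∈ hSub (genLie g), (δ v).coeff D ∈ Algebra.adjoin RH X := by
    intro D
    induction D using Nat.strong_induction_on with
    | _ D ih =>
    intro v hv
    obtain ⟨s, hs, t, ht, rfl⟩ := Submodule.mem_sup.1 (h.hSub_le hA h0 hT hv)
    rw [map_add, Polynomial.coeff_add]
    refine add_mem (hle (hδ.coeff_mem_span hXh hs D)) ?_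
    clear hv
    induction ht using Submodule.mul_induction_on' with
    | mem_mul_mem u hu w hw =>
      rw [map_mul, Polynomial.coeff_mul]
      refine sum_mem fun p hp => ?_
      rw [Finset.HasAntidiagonal.mem_antidiagonal] at hp
      by_cases h1 : p.1 = 0
      · rw [h1, (hδ.coeff_mem_hSub hu).1, zero_mul]; exact zero_mem _
      by_cases h2 : p.2 = 0
      · rw [h2, (hδ.coeff_mem_hSub hw).1, mul_zero]; exact zero_mem _
      exact mul_mem (ih _ (by omega) u hu) (ih _ (by omega) w hw)
    | add u _ w _ h1 h2 => rw [map_add, Polynomial.coeff_add]; exact add_mem h1 h2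
  intro v hv
  exact hδ.mem_of_coeff (Subalgebra.toSubmodule (Algebra.adjoin RH X)) fun D => key D v hv

section OrderedMonomials
variable {κ : Type} [LinearOrder κ]

/-- Reordering a product of elements of `ħ • L` changes it by a multiple of `ħ`. -/
lemma prod_sub_prod_mem {L : LieSubalgebra RH B} (l l' : List B) (hp : l.Perm l')
    (hl : ∀ x ∈ l, x ∈ hSub L) :
    ∃ z ∈ Algebra.adjoin RH (hSub L : Set B), l.prod - l'.prod = hbar • z := by
  have hprod : ∀ l : List B, (∀ x ∈ l, x ∈ hSub L) →
      l.prod ∈ Algebra.adjoin RH (hSub L : Set B) := fun l hl =>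
    Subalgebra.list_prod_mem _ fun x hx => Algebra.subset_adjoin (hl x hx)
  induction hp with
  | nil => exact ⟨0, zero_mem _, by simp⟩
  | cons x hp ih =>
    obtain ⟨z, hz, e⟩ := ih fun y hy => hl y (List.mem_cons_of_mem _ hy)
    refine ⟨x * z, mul_mem (Algebra.subset_adjoin (hl x List.mem_cons_self)) hz, ?_⟩
    rw [List.prod_cons, List.prod_cons, ← mul_sub, e, mul_smul_comm]
  | swap x y l =>
    obtain ⟨a, ha, ea⟩ := mem_hSub.1 (hl x (by simp))
    have hy := hl y (by simp)
    refine ⟨⁅y, a⁆ * l.prod, mul_mem (Algebra.subset_adjoin ?_)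
      (hprod l fun z hz => hl z (by simp [hz])), ?_⟩
    · change ⁅y, a⁆ ∈ hSub L
      rw [← lie_skew]
      exact neg_mem (lie_mem_hSub ha hy)
    · rw [List.prod_cons, List.prod_cons, List.prod_cons, List.prod_cons, ← mul_assoc, ← mul_assoc,
        ← sub_mul, ← smul_mul_assoc, ← lie_smul_assoc, ea, Ring.lie_def]
  | trans h1 h2 ih1 ih2 =>
    obtain ⟨z, hz, e⟩ := ih1 hl
    obtain ⟨w, hw, e'⟩ := ih2 fun x hx => hl x (h1.mem_iff.2 hx)
    exact ⟨z + w, add_mem hz hw, by rw [smul_add, ← e, ← e']; abel⟩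

lemma ordMon_mem_adjoin (E : κ → B) (h : κ →₀ ℕ) :
    ordMon E h ∈ Algebra.adjoin RH (Set.range E) := by
  refine Subalgebra.list_prod_mem _ fun x hx => ?_
  obtain ⟨p, _, rfl⟩ := List.mem_map.1 hx
  exact pow_mem (Algebra.subset_adjoin (Set.mem_range_self p)) _

/-- The ordered monomials span the algebra generated by the rescaled root vectors. -/
theorem span_ordMon (h : YangRel A Dd g) (hA : ∀ i, A i i = 2)
    (h0 : ∀ c r, (c = 0 ∨ n < c) → g c r = 0) (hδ : IsGrading g δ)
    {T : κ → BTree} (hT : SpansCurrent n A T) :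
    Submodule.span RH (Set.range fun m : κ →₀ ℕ => ordMon (fun p => hbar • (T p).eval g) m) =
      Subalgebra.toSubmodule (Algebra.adjoin RH (Set.range fun p => hbar • (T p).eval g)) := by
  set E : κ → B := fun p => hbar • (T p).eval g with hE
  have hadj : Algebra.adjoin RH (Set.range E) = Algebra.adjoin RH (hSub (genLie g) : Set B) :=
    adjoin_eq_adjoin_hSub h hA h0 hδ hT
  have hEV : ∀ p, E p ∈ hSub (genLie g) := fun p => smul_mem_hSub (eval_mem_genLie g (T p))
  set P := Submodule.span RH (Set.range fun m : κ →₀ ℕ => ordMon E m) with hP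
  refine le_antisymm (Submodule.span_le.2 ?_) ?_
  · rintro _ ⟨m, rfl⟩
    exact ordMon_mem_adjoin E m
  have hhom : ∀ x ∈ Set.range (fun m : κ →₀ ℕ => ordMon E m),
      ∃ d, δ x = Polynomial.monomial d x := by
    rintro _ ⟨m, rfl⟩
    obtain ⟨l, hl, e⟩ := exists_list_ordMon E m
    simp only [e]
    clear e hl
    induction l with
    | nil => exact ⟨0, by simp⟩
    | cons a l ih =>
      obtain ⟨d, hd⟩ := hδ.eval_tree (T a)
      obtain ⟨e, he⟩ := ih
      refine ⟨d + 1 + e, ?_⟩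
      rw [List.map_cons, List.prod_cons, map_mul, he, hE]
      simp only
      rw [hδ.hbar_smul hd, Polynomial.monomial_mul_monomial]
  have hdec : ∀ z ∈ Algebra.adjoin RH (Set.range E), ∃ p ∈ P,
      ∃ w ∈ Algebra.adjoin RH (Set.range E), z = p + hbar • w := by
    intro z hz
    rw [← Subalgebra.mem_toSubmodule, Algebra.adjoin_eq_span] at hz
    induction hz using Submodule.span_induction with
    | mem x hx =>
      obtain ⟨l, hl, rfl⟩ := Submonoid.exists_list_of_mem_closure hx
      obtain ⟨k, rfl⟩ : ∃ k : List κ, l = k.map E := by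
        clear hx
        induction l with
        | nil => exact ⟨[], rfl⟩
        | cons a l ih =>
          obtain ⟨p, hp⟩ := hl a (by simp)
          obtain ⟨k, hk⟩ := ih fun y hy => hl y (by simp [hy])
          exact ⟨p :: k, by simp [hp, hk]⟩
      obtain ⟨k', hk', e⟩ := exists_list_ordMon E (Multiset.toFinsupp (k : Multiset κ))
      have hperm : k.Perm k' := List.perm_iff_count.2 fun a => by rw [hk']; simp
      obtain ⟨w, hw, e'⟩ := prod_sub_prod_mem (L := genLie g) _ _ (hperm.map E) (by
        intro x hx
        obtain ⟨p, _, rfl⟩ := List.mem_map.1 hx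
        exact hEV p)
      refine ⟨ordMon E (Multiset.toFinsupp (k : Multiset κ)), Submodule.subset_span ⟨_, rfl⟩, w,
        hadj ▸ hw, ?_⟩
      rw [e, ← e']; abel
    | zero => exact ⟨0, zero_mem _, 0, zero_mem _, by simp⟩
    | add x y _ _ hx hy =>
      obtain ⟨p, hp, w, hw, rfl⟩ := hx
      obtain ⟨q, hq, v, hv, rfl⟩ := hy
      exact ⟨p + q, add_mem hp hq, w + v, add_mem hw hv, by rw [smul_add]; abel⟩
    | smul c x _ hx =>
      obtain ⟨p, hp, w, hw, rfl⟩ := hx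
      exact ⟨c • p, P.smul_mem c hp, c • w, Subalgebra.smul_mem _ hw c, by
        rw [smul_add, smul_comm c hbar]⟩
  have key : ∀ D, ∀ z ∈ Algebra.adjoin RH (Set.range E), (δ z).coeff D ∈ P := by
    intro D
    induction D with
    | zero =>
      intro z hz
      obtain ⟨p, hp, w, hw, rfl⟩ := hdec z hz
      rw [map_add, Polynomial.coeff_add, hδ.hbar_zero, add_zero]
      exact hδ.coeff_mem_span hhom hp 0
    | succ D ih =>
      intro z hz
      obtain ⟨p, hp, w, hw, rfl⟩ := hdec z hz
      rw [map_add, Polynomial.coeff_add, hδ.hbar_succ]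
      exact add_mem (hδ.coeff_mem_span hhom hp _) (P.smul_mem _ (ih w hw))
  exact fun z hz => hδ.mem_of_coeff P fun D => key D z hz

end OrderedMonomials

end Grading

section Twist
attribute [local instance] LieRing.ofAssociativeRing
variable (B : Type) [Ring B] [Algebra RH B]

/-- polynomials over `B`, with the `ℚ[ħ]`-algebra structure in which `ħ` acts as `ħ T`. -/
def TwistedPoly : Type := Polynomial B

instance : Ring (TwistedPoly B) := inferInstanceAs (Ring (Polynomial B))

/-- the structure morphism of `TwistedPoly B`. -/
def twistHom : RH →+* Polynomial B :=
  (Polynomial.mapRingHom (algebraMap RH B)).comp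
    (Polynomial.eval₂RingHom ((Polynomial.C : RH →+* Polynomial RH).comp Polynomial.C)
      (Polynomial.C hbar * Polynomial.X))

lemma twistHom_commutes (p : RH) (f : Polynomial B) : twistHom B p * f = f * twistHom B p := by
  have : ∀ q : Polynomial RH, q.map (algebraMap RH B) * f = f * q.map (algebraMap RH B) := by
    intro q
    induction q using Polynomial.induction_on' with
    | add p q hp hq => rw [Polynomial.map_add, add_mul, mul_add, hp, hq]
    | monomial k a =>
      rw [Polynomial.map_monomial, ← Polynomial.C_mul_X_pow_eq_monomial, mul_assoc,
        Polynomial.X_pow_mul, ← mul_assoc, ← mul_assoc]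
      congr 1
      ext D
      rw [Polynomial.coeff_C_mul, Polynomial.coeff_mul_C, Algebra.commutes]
  exact this _

instance : Algebra RH (TwistedPoly B) := RingHom.toAlgebra' (twistHom B) (twistHom_commutes B)

variable {B}

/-- the monomial `b T^k`. -/
def twistMono (k : ℕ) : B →+ TwistedPoly B :=
  show B →+ Polynomial B from (Polynomial.monomial k : B →ₗ[B] Polynomial B).toAddMonoidHom

omit [Algebra RH B] in
lemma twistMono_mul (i j : ℕ) (a b : B) :
    twistMono i a * twistMono j b = twistMono (i + j) (a * b) :=
  Polynomial.monomial_mul_monomial i j a b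

omit [Algebra RH B] in
lemma twistMono_lie (i j : ℕ) (a b : B) :
    ⁅twistMono i a, twistMono j b⁆ = twistMono (i + j) ⁅a, b⁆ := by
  rw [Ring.lie_def, Ring.lie_def, twistMono_mul, twistMono_mul, add_comm j i, map_sub]

lemma twistHom_C (q : ℚ) :
    twistHom B (Polynomial.C q) = Polynomial.C (algebraMap RH B (Polynomial.C q)) := by
  simp [twistHom]

lemma twistHom_hbar : twistHom B hbar = Polynomial.C (algebraMap RH B hbar) * Polynomial.X := by
  conv_lhs => rw [hbar]
  simp [twistHom]

lemma coeff_C_smul (q : ℚ) (f : TwistedPoly B) (D : ℕ) :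
    Polynomial.coeff (Polynomial.C q • f : TwistedPoly B) D =
      Polynomial.C q • Polynomial.coeff f D := by
  change (twistHom B (Polynomial.C q) * (show Polynomial B from f)).coeff D = _
  rw [twistHom_C, Polynomial.coeff_C_mul, Algebra.smul_def]

lemma coeff_hbar_smul_succ (f : TwistedPoly B) (D : ℕ) :
    Polynomial.coeff (hbar • f : TwistedPoly B) (D + 1) = hbar • Polynomial.coeff f D := by
  change (twistHom B hbar * (show Polynomial B from f)).coeff (D + 1) = _
  rw [twistHom_hbar, mul_assoc, Polynomial.coeff_C_mul, Polynomial.coeff_X_mul, Algebra.smul_def]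

lemma coeff_hbar_smul_zero (f : TwistedPoly B) :
    Polynomial.coeff (hbar • f : TwistedPoly B) 0 = 0 := by
  change (twistHom B hbar * (show Polynomial B from f)).coeff 0 = _
  rw [twistHom_hbar, mul_assoc, Polynomial.coeff_C_mul, Polynomial.coeff_X_mul_zero, mul_zero]

lemma smul_twistMono (q : ℚ) (k : ℕ) (b : B) :
    (Polynomial.C q * hbar) • twistMono k b =
      twistMono (k + 1) ((Polynomial.C q * hbar : RH) • b) := by
  refine Polynomial.ext fun D => ?_
  rw [mul_smul, mul_smul, coeff_C_smul]
  rcases D with _ | D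
  · rw [coeff_hbar_smul_zero, smul_zero]
    change _ = (Polynomial.monomial (k + 1) _).coeff 0
    rw [Polynomial.coeff_monomial, if_neg (by omega)]
  · rw [coeff_hbar_smul_succ]
    change _ • hbar • (Polynomial.monomial k b).coeff D = (Polynomial.monomial (k + 1) _).coeff _
    rw [Polynomial.coeff_monomial, Polynomial.coeff_monomial]
    by_cases h : k = D
    · simp [h]
    · simp [h]

variable {n : ℕ} {A : ℕ → ℕ → ℤ} {Dd : ℕ → ℕ} {g : ℕ → ℕ → B}

lemma YangRel.twist (h : YangRel A Dd g) :
    YangRel A Dd fun c r => twistMono (r + 1) (g c r) := by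
  refine ⟨?_, ?_, ?_, ?_⟩
  · intro i j r s
    rw [twistMono_lie, twistMono_lie, twistMono_mul, twistMono_mul, add_comm (s + 1) (r + 1),
      ← map_add, smul_twistMono, ← h.loop, map_sub]
    congr 3
    omega
  · intro i j r s hij ha
    rw [twistMono_lie, h.comm i j r s hij ha, map_zero]
  · intro i j r s t hij ha
    simp only [twistMono_lie]
    rw [show s + 1 + (r + 1 + (t + 1)) = r + 1 + (s + 1 + (t + 1)) by omega, ← map_add,
      h.serre₁ i j r s t hij ha, map_zero]
  · intro i j r s u t hij ha
    simp only [twistMono_lie]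
    have := h.serre₂ i j r s u t hij ha
    rw [show r + 1 + (u + 1 + (s + 1 + (t + 1))) = r + 1 + (s + 1 + (u + 1 + (t + 1))) by omega,
      show s + 1 + (r + 1 + (u + 1 + (t + 1))) = r + 1 + (s + 1 + (u + 1 + (t + 1))) by omega,
      show s + 1 + (u + 1 + (r + 1 + (t + 1))) = r + 1 + (s + 1 + (u + 1 + (t + 1))) by omega,
      show u + 1 + (r + 1 + (s + 1 + (t + 1))) = r + 1 + (s + 1 + (u + 1 + (t + 1))) by omega,
      show u + 1 + (s + 1 + (r + 1 + (t + 1))) = r + 1 + (s + 1 + (u + 1 + (t + 1))) by omega]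
    simp only [← map_add]
    rw [this, map_zero]

end Twist

section YangianGrading
variable (n : ℕ) (A : ℕ → ℕ → ℤ) (Dd : ℕ → ℕ)

lemma adjoin_gy1 :
    Algebra.adjoin RH {z | ∃ c r, z = gy1 n A Dd c r} = (⊤ : Subalgebra RH (YA n A Dd)) := by
  rw [eq_top_iff]
  have h1 : (⊤ : Subalgebra RH (YA n A Dd)) =
      (⊤ : Subalgebra RH (FAY n)).map (RingQuot.mkAlgHom RH (YRel n A Dd)) := by
    rw [Algebra.map_top, (AlgHom.range_eq_top _).2 (RingQuot.mkAlgHom_surjective RH _)]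
  rw [h1, ← FreeAlgebra.adjoin_range_ι, AlgHom.map_adjoin]
  refine Algebra.adjoin_mono ?_
  rintro _ ⟨_, ⟨p, rfl⟩, rfl⟩
  exact ⟨p.1.1 + 1, p.2, (gy1_succ p.1 p.2).symm⟩

variable {n A Dd}

lemma exists_isGrading (hA : ∀ i j, i ≠ j → A i j = 0 ∨ A i j = -1 ∨ A i j = -2) :
    ∃ δ : YA n A Dd →+* Polynomial (YA n A Dd), IsGrading (gy1 n A Dd) δ := by
  obtain ⟨f, hf⟩ := (yangRel_gy1 (n := n) (A := A) (Dd := Dd)).twist.exists_algHom (n := n) hA (by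
    intro c r hc
    rw [gy1_eq_zero hc, map_zero])
  let δ : YA n A Dd →+* Polynomial (YA n A Dd) := (f : YA n A Dd →+* TwistedPoly (YA n A Dd))
  refine ⟨δ, ⟨fun c r => hf c r, ?_, ?_, ?_, ?_⟩⟩
  · intro q b D
    refine (congrArg (fun z : Polynomial _ => z.coeff D) (map_smul f (Polynomial.C q) b)).trans ?_
    exact coeff_C_smul q (f b) D
  · intro b
    refine (congrArg (fun z : Polynomial _ => z.coeff 0) (map_smul f hbar b)).trans ?_
    exact coeff_hbar_smul_zero (f b)
  · intro b D
    refine (congrArg (fun z : Polynomial _ => z.coeff (D + 1)) (map_smul f hbar b)).trans ?_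
    exact coeff_hbar_smul_succ (f b) D
  · intro b
    have hb : b ∈ Algebra.adjoin RH {z | ∃ c r, z = gy1 n A Dd c r} := by
      rw [adjoin_gy1]; trivial
    induction hb using Algebra.adjoin_induction with
    | mem z hz =>
      obtain ⟨c, r, rfl⟩ := hz
      rw [show δ (gy1 n A Dd c r) = Polynomial.monomial (r + 1) (gy1 n A Dd c r) from hf c r,
        Polynomial.eval_monomial, one_pow, mul_one]
    | algebraMap p =>
      have e1 : δ (algebraMap RH _ p) = twistHom (YA n A Dd) p := f.commutes p
      rw [e1]
      clear e1
      induction p using Polynomial.induction_on' with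
      | add p q hp hq => rw [map_add, Polynomial.eval_add, hp, hq, map_add]
      | monomial k a =>
        have e : Polynomial.monomial k a = (Polynomial.C a * hbar ^ k : RH) :=
          (Polynomial.C_mul_X_pow_eq_monomial).symm
        rw [e, map_mul, map_pow, twistHom_C, twistHom_hbar,
          (Polynomial.commute_X _).symm.mul_pow, ← Polynomial.C_pow, ← mul_assoc,
          ← Polynomial.C_mul, Polynomial.C_mul_X_pow_eq_monomial, Polynomial.eval_monomial,
          one_pow, mul_one, map_mul, map_pow]
    | add a b _ _ ha hb => rw [map_add, Polynomial.eval_add, ha, hb]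
    | mul a b _ _ ha hb =>
      rw [map_mul, Polynomial.eval, Polynomial.eval₂_mul_noncomm _ _ fun k => Commute.one_right _]
      exact congrArg₂ _ ha hb

end YangianGrading

lemma aC_offdiag (n i j : ℕ) (h : i ≠ j) : aC n i j = 0 ∨ aC n i j = -1 ∨ aC n i j = -2 := by
  unfold aC
  rw [if_neg h]
  split_ifs <;> simp

lemma aD_offdiag (n i j : ℕ) (h : i ≠ j) : aD n i j = 0 ∨ aD n i j = -1 ∨ aD n i j = -2 := by
  unfold aD
  rw [if_neg h]
  split_ifs <;> simp

section RootTrees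
attribute [local instance] LieRing.ofAssociativeRing
variable {n : ℕ}

lemma chainY_eq_eval {B : Type} [Ring B] (g : ℕ → ℕ → B) (h0 : g 0 0 = 0) (w ss : List ℕ) :
    chainY g w ss = (BTree.chain w ss).eval g := by
  rw [BTree.eval_chain g h0]
  unfold chainY chainLie
  rfl

lemma genYC_zero : genYC (n := n) 0 0 = 0 := gy1_eq_zero (Or.inl rfl) 0

lemma genYD_zero : genYD (n := n) 0 0 = 0 := gy1_eq_zero (Or.inl rfl) 0

lemma IsRVYCchain.exists_tree {β : PosRootC n} {s : ℕ} {E : YC n} (h : IsRVYCchain β s E) :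
    ∃ T : BTree, T.IsChain (wordC β) s ∧ E = T.eval (genYC n) := by
  obtain ⟨ss, h1, h2, h3⟩ := h
  exact ⟨_, ⟨ss, h1, h2, rfl⟩, h3.trans (chainY_eq_eval _ genYC_zero _ _)⟩

lemma IsRVYC.exists_tree {β : PosRootC n} {s : ℕ} {E : YC n} (h : IsRVYC β s E) :
    ∃ T : BTree, IsRootTreeC β s T ∧ E = T.eval (genYC n) := by
  unfold IsRVYC at h
  unfold IsRootTreeC
  split_ifs at h ⊢ with hβ
  · obtain ⟨β₁, β₂, s₁, s₂, E₁, E₂, h1, h2, h3, h4, h5, h6⟩ := h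
    obtain ⟨T₁, hT₁, rfl⟩ := h3.exists_tree
    obtain ⟨T₂, hT₂, rfl⟩ := h4.exists_tree
    exact ⟨BTree.br T₁ T₂, ⟨β₁, β₂, s₁, s₂, T₁, T₂, h1, h2, hT₁, hT₂, h5, rfl⟩, h6⟩
  · exact h.exists_tree

lemma IsRVYD.exists_tree {β : PosRootD n} {s : ℕ} {E : YD n} (h : IsRVYD β s E) :
    ∃ T : BTree, IsRootTreeD β s T ∧ E = T.eval (genYD n) := by
  obtain ⟨ss, h1, h2, h3⟩ := h
  exact ⟨_, ⟨ss, h1, h2, rfl⟩, h3.trans (chainY_eq_eval _ genYD_zero _ _)⟩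

lemma spansCurrentC {T : PosRootC n × ℕ → BTree} (hT : ∀ p, IsRootTreeC p.1 p.2 (T p)) :
    SpansCurrent n (aC n) T := fun _ _ _ _ _ hx h0 => hx.lieSpan_le_spanC h0 T hT

lemma spansCurrentD (hn : 2 ≤ n) {T : PosRootD n × ℕ → BTree}
    (hT : ∀ p, IsRootTreeD p.1 p.2 (T p)) :
    SpansCurrent n (aD n) T := fun _ _ _ _ _ hx h0 => hx.lieSpan_le_spanD hn h0 T hT

lemma SpansCurrent.comp_ofLex {α : Type} {A : ℕ → ℕ → ℤ} {T : α × ℕ → BTree}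
    (hT : SpansCurrent n A T) : SpansCurrent n A fun p : Lex (α × ℕ) => T (ofLex p) := by
  intro L _ _ _ x hx h0
  refine (hT L x hx h0).trans (Submodule.span_mono ?_)
  rintro _ ⟨p, rfl⟩
  exact ⟨toLex p, rfl⟩

variable {A : ℕ → ℕ → ℤ} {Dd : ℕ → ℕ}

theorem adjoin_eq_of_spansCurrent (hA : ∀ i, A i i = 2)
    (hA' : ∀ i j, i ≠ j → A i j = 0 ∨ A i j = -1 ∨ A i j = -2) {ι : Type} {T T' : ι → BTree}
    (hT : SpansCurrent n A T) (hT' : SpansCurrent n A T') :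
    Algebra.adjoin RH (Set.range fun p => hbar • (T p).eval (gy1 n A Dd)) =
      Algebra.adjoin RH (Set.range fun p => hbar • (T' p).eval (gy1 n A Dd)) := by
  obtain ⟨δ, hδ⟩ := exists_isGrading (n := n) (Dd := Dd) hA'
  rw [adjoin_eq_adjoin_hSub yangRel_gy1 hA (fun c r hc => gy1_eq_zero hc r) hδ hT,
    adjoin_eq_adjoin_hSub yangRel_gy1 hA (fun c r hc => gy1_eq_zero hc r) hδ hT']

theorem span_ordMon_of_spansCurrent (hA : ∀ i, A i i = 2)
    (hA' : ∀ i j, i ≠ j → A i j = 0 ∨ A i j = -1 ∨ A i j = -2) {α : Type} [LinearOrder α]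
    {T : α × ℕ → BTree} (hT : SpansCurrent n A T) :
    Submodule.span RH (Set.range fun m : Lex (α × ℕ) →₀ ℕ =>
        ordMon (fun p => hbar • (T (ofLex p)).eval (gy1 n A Dd)) m) =
      Subalgebra.toSubmodule
        (Algebra.adjoin RH (Set.range fun p => hbar • (T p).eval (gy1 n A Dd))) := by
  obtain ⟨δ, hδ⟩ := exists_isGrading (n := n) (Dd := Dd) hA'
  rw [span_ordMon yangRel_gy1 hA (fun c r hc => gy1_eq_zero hc r) hδ hT.comp_ofLex]
  rfl

end RootTrees

section Scalars

lemma exists_common_factor {K : Type} [Field K] [CharZero K] {u c f g : K} (hc : c ≠ 0)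
    (h : (u + c) * f = (u - c) * g) : ∃ m, f = m * (u - c) ∧ g = m * (u + c) := by
  by_cases h1 : u + c = 0
  · have h2 : u - c ≠ 0 := by
      intro h2
      apply hc
      have : 2 * c = 0 := by linear_combination h1 - h2
      simpa using this
    refine ⟨f / (u - c), by field_simp, ?_⟩
    have : (u - c) * g = 0 := by rw [← h, h1, zero_mul]
    rw [(mul_eq_zero.1 this).resolve_left h2, h1, mul_zero]
  · refine ⟨g / (u + c), ?_, by field_simp⟩
    field_simp
    linear_combination h

/-- the coefficient of a product of operators `T_a`. -/
def wordCoef {Box O : Type} [CommRing O] (φ : Box → Box → O) : List Box → O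
  | [] => 1
  | a :: l => (l.map fun c => φ c a).prod * wordCoef φ l

variable {Box O : Type} [CommRing O] [IsDomain O] [CharZero O] {z : Box → O} {φ : Box → Box → O}

lemma serre_coef₁ {η : O} (hη : η ≠ 0) {a a' b : Box}
    (h1 : (z a - z a' + 2 * η) * φ a a' = (z a - z a' - 2 * η) * φ a' a)
    (h2 : (z a - z b - η) * φ a b = (z a - z b + η) * φ b a)
    (h3 : (z a' - z b - η) * φ a' b = (z a' - z b + η) * φ b a') :
    wordCoef φ [a, a', b] - wordCoef φ [a, b, a'] - wordCoef φ [a', b, a] + wordCoef φ [b, a', a]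
      + (wordCoef φ [a', a, b] - wordCoef φ [a', b, a] - wordCoef φ [a, b, a']
        + wordCoef φ [b, a, a']) = 0 := by
  have : CharZero (FractionRing O) := charZero_of_injective_algebraMap
    (IsFractionRing.injective O (FractionRing O))
  set ι := algebraMap O (FractionRing O) with hι
  have inj : Function.Injective ι := IsFractionRing.injective O (FractionRing O)
  have hη' : ι η ≠ 0 := fun h => hη (inj (by rw [h, map_zero]))
  apply_fun ι at h1 h2 h3
  simp only [map_mul, map_add, map_sub, map_ofNat] at h1 h2 h3
  obtain ⟨m1, e1, e1'⟩ := exists_common_factor (mul_ne_zero two_ne_zero hη') h1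
  obtain ⟨m2, e2, e2'⟩ := exists_common_factor (u := ι (z a) - ι (z b))
    (f := ι (φ a b)) (g := ι (φ b a)) (neg_ne_zero.2 hη') (by linear_combination h2)
  obtain ⟨m3, e3, e3'⟩ := exists_common_factor (u := ι (z a') - ι (z b))
    (f := ι (φ a' b)) (g := ι (φ b a')) (neg_ne_zero.2 hη') (by linear_combination h3)
  apply inj
  simp only [wordCoef, List.map_cons, List.map_nil, List.prod_cons, List.prod_nil, mul_one,
    map_add, map_sub, map_mul, map_zero, e1, e1', e2, e2', e3, e3']
  ring

/-- the coefficient of `[T_a, [T_{a'}, [T_{a''}, T_b]]]`. -/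
def lieCoef₃ (φ : Box → Box → O) (a b c d : Box) : O :=
  wordCoef φ [a, b, c, d] - wordCoef φ [a, b, d, c] - wordCoef φ [a, c, d, b]
    + wordCoef φ [a, d, c, b] - wordCoef φ [b, c, d, a] + wordCoef φ [b, d, c, a]
    + wordCoef φ [c, d, b, a] - wordCoef φ [d, c, b, a]

lemma serre_coef₂ {η : O} (hη : η ≠ 0) {a b c d : Box}
    (h1 : (z a - z b + 2 * η) * φ a b = (z a - z b - 2 * η) * φ b a)
    (h2 : (z a - z c + 2 * η) * φ a c = (z a - z c - 2 * η) * φ c a)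
    (h3 : (z b - z c + 2 * η) * φ b c = (z b - z c - 2 * η) * φ c b)
    (h4 : (z a - z d - 2 * η) * φ a d = (z a - z d + 2 * η) * φ d a)
    (h5 : (z b - z d - 2 * η) * φ b d = (z b - z d + 2 * η) * φ d b)
    (h6 : (z c - z d - 2 * η) * φ c d = (z c - z d + 2 * η) * φ d c) :
    lieCoef₃ φ a b c d + lieCoef₃ φ a c b d + lieCoef₃ φ b a c d + lieCoef₃ φ b c a d
      + lieCoef₃ φ c a b d + lieCoef₃ φ c b a d = 0 := by
  have : CharZero (FractionRing O) := charZero_of_injective_algebraMap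
    (IsFractionRing.injective O (FractionRing O))
  set ι := algebraMap O (FractionRing O) with hι
  have inj : Function.Injective ι := IsFractionRing.injective O (FractionRing O)
  have hη' : ι η ≠ 0 := fun h => hη (inj (by rw [h, map_zero]))
  have hη2 : 2 * ι η ≠ 0 := mul_ne_zero two_ne_zero hη'
  apply_fun ι at h1 h2 h3 h4 h5 h6
  simp only [map_mul, map_add, map_sub, map_ofNat] at h1 h2 h3 h4 h5 h6
  obtain ⟨m1, e1, e1'⟩ := exists_common_factor hη2 h1
  obtain ⟨m2, e2, e2'⟩ := exists_common_factor hη2 h2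
  obtain ⟨m3, e3, e3'⟩ := exists_common_factor hη2 h3
  obtain ⟨m4, e4, e4'⟩ := exists_common_factor (u := ι (z a) - ι (z d))
    (f := ι (φ a d)) (g := ι (φ d a)) (neg_ne_zero.2 hη2) (by linear_combination h4)
  obtain ⟨m5, e5, e5'⟩ := exists_common_factor (u := ι (z b) - ι (z d))
    (f := ι (φ b d)) (g := ι (φ d b)) (neg_ne_zero.2 hη2) (by linear_combination h5)
  obtain ⟨m6, e6, e6'⟩ := exists_common_factor (u := ι (z c) - ι (z d))
    (f := ι (φ c d)) (g := ι (φ d c)) (neg_ne_zero.2 hη2) (by linear_combination h6)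
  apply inj
  simp only [lieCoef₃, wordCoef, List.map_cons, List.map_nil, List.prod_cons, List.prod_nil,
    mul_one, map_add, map_sub, map_mul, map_zero, e1, e1', e2, e2', e3, e3', e4, e4', e5, e5',
    e6, e6']
  ring

end Scalars

section Operators
variable {Box O : Type} [DecidableEq Box] [CommRing O] (φ : Box → Box → O)

/-- the operator adding the box `a`. -/
def addBox (a : Box) : Module.End O (Finset Box → O) where
  toFun ψ s := if a ∈ s then 0 else (∏ b ∈ s, φ a b) * ψ (insert a s)
  map_add' ψ ψ' := by
    funext s
    simp only [Pi.add_apply]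
    split_ifs
    · simp
    · ring
  map_smul' c ψ := by
    funext s
    simp only [Pi.smul_apply, smul_eq_mul, RingHom.id_apply]
    split_ifs
    · simp
    · ring

lemma addBox_apply (a : Box) (ψ : Finset Box → O) (s : Finset Box) :
    addBox φ a ψ s = if a ∈ s then 0 else (∏ b ∈ s, φ a b) * ψ (insert a s) := rfl

/-- the operator adding the boxes of `S` simultaneously. -/
def addBoxes (S : Finset Box) : Module.End O (Finset Box → O) where
  toFun ψ s := if Disjoint S s then (∏ a ∈ S, ∏ b ∈ s, φ a b) * ψ (S ∪ s) else 0
  map_add' ψ ψ' := by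
    funext s
    simp only [Pi.add_apply]
    split_ifs
    · ring
    · simp
  map_smul' c ψ := by
    funext s
    simp only [Pi.smul_apply, smul_eq_mul, RingHom.id_apply]
    split_ifs
    · ring
    · simp

lemma addBoxes_apply (S : Finset Box) (ψ : Finset Box → O) (s : Finset Box) :
    addBoxes φ S ψ s = if Disjoint S s then (∏ a ∈ S, ∏ b ∈ s, φ a b) * ψ (S ∪ s) else 0 := rfl

variable {φ}

lemma addBox_mul_addBoxes (h0 : ∀ a, φ a a = 0) (a : Box) (S : Finset Box) :
    addBox φ a * addBoxes φ S = (∏ c ∈ S, φ c a) • addBoxes φ (insert a S) := by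
  refine LinearMap.ext fun ψ => funext fun s => ?_
  rw [Module.End.mul_apply, addBox_apply, addBoxes_apply, LinearMap.smul_apply, Pi.smul_apply,
    addBoxes_apply, smul_eq_mul]
  simp only [Finset.disjoint_insert_right, Finset.disjoint_insert_left]
  by_cases h1 : a ∈ s
  · simp [h1]
  by_cases h2 : a ∈ S
  · rw [Finset.prod_eq_zero (f := fun c => φ c a) h2 (h0 a)]
    simp [h2]
  by_cases h3 : Disjoint S s
  · rw [if_neg h1, if_pos ⟨h2, h3⟩, if_pos ⟨h1, h3⟩, Finset.prod_insert h2,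
      Finset.union_insert, Finset.insert_union]
    simp only [Finset.prod_insert h1, Finset.prod_mul_distrib]
    ring
  · simp [h3]

lemma prod_map_addBox (h0 : ∀ a, φ a a = 0) (l : List Box) :
    (l.map (addBox φ)).prod = wordCoef φ l • addBoxes φ l.toFinset := by
  have hz : ∀ l : List Box, ¬ l.Nodup → wordCoef φ l = 0 := by
    intro l hl
    induction l with
    | nil => exact absurd List.nodup_nil hl
    | cons a l ih =>
      rw [wordCoef]
      by_cases ha : a ∈ l
      · rw [List.prod_eq_zero (show (0 : O) ∈ l.map fun c => φ c a from
          List.mem_map.2 ⟨a, ha, h0 a⟩), zero_mul]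
      · rw [ih fun h => hl (List.nodup_cons.2 ⟨ha, h⟩), mul_zero]
  induction l with
  | nil =>
    refine LinearMap.ext fun ψ => funext fun s => ?_
    simp [wordCoef, addBoxes_apply]
  | cons a l ih =>
    rw [List.map_cons, List.prod_cons, ih, mul_smul_comm, addBox_mul_addBoxes h0,
      List.toFinset_cons, smul_smul, wordCoef]
    by_cases hl : l.Nodup
    · rw [List.prod_toFinset _ hl, mul_comm]
    · rw [hz l hl, zero_mul, mul_zero]

lemma prod_map_addBox_perm (h0 : ∀ a, φ a a = 0) {l l' : List Box}
    (h : l.toFinset = l'.toFinset) :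
    (l.map (addBox φ)).prod = wordCoef φ l • addBoxes φ l'.toFinset := by
  rw [prod_map_addBox h0, h]

/-- the operator `∑ f_a T_a` over the boxes of a given color. -/
def colorOp (φ : Box → Box → O) (bx : Finset Box) (col : Box → ℕ) (c : ℕ) (f : Box → O) :
    Module.End O (Finset Box → O) :=
  ∑ a ∈ bx.filter fun a => col a = c, f a • addBox φ a

end Operators

section TripleSums
variable {α M : Type*} [AddCommMonoid M] (s : Finset α) (K : α → α → α → M)

lemma sum₂_swap (K : α → α → M) : ∑ a ∈ s, ∑ b ∈ s, K a b = ∑ a ∈ s, ∑ b ∈ s, K b a :=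
  Finset.sum_comm

lemma sum₃_swap₁ : ∑ a ∈ s, ∑ b ∈ s, ∑ c ∈ s, K a b c = ∑ a ∈ s, ∑ b ∈ s, ∑ c ∈ s, K b a c :=
  Finset.sum_comm

lemma sum₃_swap₂ : ∑ a ∈ s, ∑ b ∈ s, ∑ c ∈ s, K a b c = ∑ a ∈ s, ∑ b ∈ s, ∑ c ∈ s, K a c b :=
  Finset.sum_congr rfl fun _ _ => Finset.sum_comm

lemma sum₃_perm {K₁ K₂ K₃ K₄ K₅ K₆ : α → α → α → M} (h : ∀ a ∈ s, ∀ b ∈ s, ∀ c ∈ s,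
      K₁ a b c + K₂ a c b + K₃ b a c + K₄ b c a + K₅ c a b + K₆ c b a = 0) :
    ∑ a ∈ s, ∑ b ∈ s, ∑ c ∈ s, K₁ a b c + ∑ a ∈ s, ∑ b ∈ s, ∑ c ∈ s, K₂ a b c
      + ∑ a ∈ s, ∑ b ∈ s, ∑ c ∈ s, K₃ a b c + ∑ a ∈ s, ∑ b ∈ s, ∑ c ∈ s, K₄ a b c
      + ∑ a ∈ s, ∑ b ∈ s, ∑ c ∈ s, K₅ a b c + ∑ a ∈ s, ∑ b ∈ s, ∑ c ∈ s, K₆ a b c = 0 := by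
  rw [sum₃_swap₂ s K₂, sum₃_swap₁ s K₃, sum₃_swap₂ s K₄, sum₃_swap₁ s fun a b c => K₄ a c b,
    sum₃_swap₁ s K₅, sum₃_swap₂ s fun a b c => K₅ b a c, sum₃_swap₁ s K₆,
    sum₃_swap₂ s fun a b c => K₆ b a c, sum₃_swap₁ s fun a b c => K₆ c a b]
  simp only [← Finset.sum_add_distrib]
  exact Finset.sum_eq_zero fun a ha => Finset.sum_eq_zero fun b hb =>
    Finset.sum_eq_zero fun c hc => h a ha b hb c hc

end TripleSums

section BoxRep
variable {Box O : Type} [DecidableEq Box] [CommRing O] [IsDomain O] [CharZero O] [Algebra RH O]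

/-- the structure constant `d_i a_{ij} ħ / 2`. -/
def halfForm (O : Type) [CommRing O] [Algebra RH O] (A : ℕ → ℕ → ℤ) (Dd : ℕ → ℕ) (i j : ℕ) : O :=
  algebraMap RH O (Polynomial.C (((Dd i : ℚ) * (A i j : ℚ)) / 2) * hbar)

/-- compatibility of the weights `φ` and parameters `z` of colored boxes. -/
structure IsBoxData (A : ℕ → ℕ → ℤ) (Dd : ℕ → ℕ) (bx : Finset Box) (col : Box → ℕ) (z : Box → O)
    (φ : Box → Box → O) : Prop where
  self : ∀ a, φ a a = 0
  cross : ∀ a ∈ bx, ∀ b ∈ bx, (z a - z b + halfForm O A Dd (col a) (col b)) * φ a b =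
    (z a - z b - halfForm O A Dd (col a) (col b)) * φ b a
  comm : ∀ a ∈ bx, ∀ b ∈ bx, col a ≠ col b → A (col a) (col b) = 0 → φ a b = φ b a

variable {A : ℕ → ℕ → ℤ} {Dd : ℕ → ℕ} {bx : Finset Box} {col : Box → ℕ} {z : Box → O}
  {φ : Box → Box → O}

omit [IsDomain O] [CharZero O] [Algebra RH O] in
lemma colorOp_lie (c : ℕ) (f : Box → O) (Y : Module.End O (Finset Box → O)) :
    ⁅colorOp φ bx col c f, Y⁆ = ∑ a ∈ bx.filter (fun a => col a = c), f a • ⁅addBox φ a, Y⁆ := by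
  simp only [Ring.lie_def, colorOp, Finset.sum_mul, Finset.mul_sum, smul_mul_assoc,
    mul_smul_comm, smul_sub, Finset.sum_sub_distrib]

omit [IsDomain O] [CharZero O] [Algebra RH O] [DecidableEq Box] in
lemma end_sub_smul (k m : O) (F : Module.End O (Finset Box → O)) :
    k • F - m • F = (k - m) • F := by
  refine LinearMap.ext fun ψ => funext fun s => ?_
  simp [sub_mul]

omit [IsDomain O] [CharZero O] [Algebra RH O] [DecidableEq Box] in
lemma end_add_smul (k m : O) (F : Module.End O (Finset Box → O)) :
    k • F + m • F = (k + m) • F := by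
  refine LinearMap.ext fun ψ => funext fun s => ?_
  simp [add_mul]

omit [IsDomain O] [CharZero O] [Algebra RH O] [DecidableEq Box] in
lemma end_lie_smul (k : O) (F G : Module.End O (Finset Box → O)) : ⁅F, k • G⁆ = k • ⁅F, G⁆ := by
  simp only [Ring.lie_def, mul_smul_comm, smul_mul_assoc, smul_sub]

omit [IsDomain O] [CharZero O] [Algebra RH O] [DecidableEq Box] in
lemma end_lie_sum {ι : Type} (s : Finset ι) (F : Module.End O (Finset Box → O))
    (G : ι → Module.End O (Finset Box → O)) : ⁅F, ∑ i ∈ s, G i⁆ = ∑ i ∈ s, ⁅F, G i⁆ := by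
  simp only [Ring.lie_def, Finset.sum_mul, Finset.mul_sum, Finset.sum_sub_distrib]

omit [IsDomain O] [CharZero O] [Algebra RH O] in
lemma lie_addBox₂ (h0 : ∀ a, φ a a = 0) (a b c : Box) :
    ⁅addBox φ a, ⁅addBox φ b, addBox φ c⁆⁆ =
      (wordCoef φ [a, b, c] - wordCoef φ [a, c, b] - wordCoef φ [b, c, a] + wordCoef φ [c, b, a]) •
        addBoxes φ {a, b, c} := by
  have e1 := prod_map_addBox_perm h0 (l := [a, b, c]) (l' := [a, b, c]) rfl
  have e2 := prod_map_addBox_perm h0 (l := [a, c, b]) (l' := [a, b, c])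
    (by ext; simp; tauto)
  have e3 := prod_map_addBox_perm h0 (l := [b, c, a]) (l' := [a, b, c])
    (by ext; simp; tauto)
  have e4 := prod_map_addBox_perm h0 (l := [c, b, a]) (l' := [a, b, c])
    (by ext; simp; tauto)
  have e5 : [a, b, c].toFinset = {a, b, c} := by simp
  simp only [List.map_cons, List.map_nil, List.prod_cons, List.prod_nil, mul_one, e5]
    at e1 e2 e3 e4
  simp only [Ring.lie_def, mul_sub, sub_mul, mul_assoc, e1, e2, e3, e4, end_sub_smul]
  congr 1
  ring

omit [IsDomain O] [CharZero O] [Algebra RH O] in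
lemma lie_addBox₃ (h0 : ∀ a, φ a a = 0) (a b c d : Box) {S : Finset Box}
    (hS : [a, b, c, d].toFinset = S) :
    ⁅addBox φ a, ⁅addBox φ b, ⁅addBox φ c, addBox φ d⁆⁆⁆ =
      lieCoef₃ φ a b c d • addBoxes φ S := by
  have key : ∀ l : List Box, l.Perm [a, b, c, d] → (l.map (addBox φ)).prod =
      wordCoef φ l • addBoxes φ S := by
    intro l hl
    rw [prod_map_addBox h0, ← hS, List.toFinset_eq_of_perm _ _ hl]
  have e1 := key [a, b, c, d] (List.Perm.refl _)
  have e2 := key [a, b, d, c] (((List.Perm.swap _ _ _).cons _).cons _)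
  have e3 := key [a, c, d, b] (List.Perm.cons _ (List.perm_append_comm (l₁ := [c, d]) (l₂ := [b])))
  have e4 := key [a, d, c, b] ((List.reverse_perm [b, c, d]).cons a)
  have e5 := key [b, c, d, a] (List.perm_append_comm (l₁ := [b, c, d]) (l₂ := [a]))
  have e6 := key [b, d, c, a] ((List.perm_append_comm (l₁ := [b, d, c]) (l₂ := [a])).trans
    (((List.Perm.swap _ _ _).cons _).cons _))
  have e7 := key [c, d, b, a] ((List.perm_append_comm (l₁ := [c, d, b]) (l₂ := [a])).trans
    (List.Perm.cons _ (List.perm_append_comm (l₁ := [c, d]) (l₂ := [b]))))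
  have e8 := key [d, c, b, a] (List.reverse_perm [a, b, c, d])
  simp only [List.map_cons, List.map_nil, List.prod_cons, List.prod_nil, mul_one]
    at e1 e2 e3 e4 e5 e6 e7 e8
  simp only [Ring.lie_def, mul_sub, sub_mul, mul_assoc, e1, e2, e3, e4, e5, e6, e7, e8,
    end_sub_smul, lieCoef₃]
  congr 1
  ring

omit [IsDomain O] [CharZero O] in
lemma IsBoxData.loop (h : IsBoxData A Dd bx col z φ) {a b : Box} (ha : a ∈ bx) (hb : b ∈ bx) :
    (z a - z b) • ⁅addBox φ a, addBox φ b⁆ = halfForm O A Dd (col a) (col b) •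
      (addBox φ a * addBox φ b + addBox φ b * addBox φ a) := by
  have e1 := prod_map_addBox_perm h.self (l := [a, b]) (l' := [a, b]) rfl
  have e2 := prod_map_addBox_perm h.self (l := [b, a]) (l' := [a, b]) (by ext; simp; tauto)
  simp only [List.map_cons, List.map_nil, List.prod_cons, List.prod_nil, mul_one, wordCoef]
    at e1 e2
  rw [Ring.lie_def, e1, e2, end_sub_smul, end_add_smul, smul_smul, smul_smul]
  congr 1
  linear_combination -h.cross a ha b hb

omit [DecidableEq Box] [IsDomain O] [CharZero O] in
lemma IsBoxData.cross_self (h : IsBoxData A Dd bx col z φ) (hA : ∀ i, A i i = 2) {a b : Box}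
    {i : ℕ} (ha : a ∈ bx) (hb : b ∈ bx) (hai : col a = i) (hbi : col b = i) {q : ℚ} {η : O}
    (hq : q * 2 = (Dd i : ℚ)) (hη : η = algebraMap RH O (Polynomial.C q * hbar)) :
    (z a - z b + 2 * η) * φ a b = (z a - z b - 2 * η) * φ b a := by
  have := h.cross a ha b hb
  have e : halfForm O A Dd (col a) (col b) = 2 * η := by
    rw [hη, halfForm, hai, hbi, hA, ← map_ofNat (algebraMap RH O) 2, ← map_mul, ← mul_assoc,
      ← map_ofNat (Polynomial.C : ℚ →+* RH) 2, ← map_mul]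
    congr 3
    push_cast
    linarith
  rwa [e] at this

omit [DecidableEq Box] [IsDomain O] [CharZero O] in
lemma IsBoxData.cross_ne (h : IsBoxData A Dd bx col z φ) {a b : Box} {i j : ℕ}
    (ha : a ∈ bx) (hb : b ∈ bx) (hai : col a = i) (hbj : col b = j) {q : ℚ} {η : O} {m : ℤ}
    (hq : q * 2 = (Dd i : ℚ)) (hA : A i j = -m)
    (hη : η = algebraMap RH O (Polynomial.C q * hbar)) :
    (z a - z b - m * η) * φ a b = (z a - z b + m * η) * φ b a := by
  have := h.cross a ha b hb
  have e : halfForm O A Dd (col a) (col b) = -(m * η) := by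
    rw [hη, halfForm, hai, hbj, hA, ← map_intCast (algebraMap RH O) m, ← map_mul, ← mul_assoc,
      ← map_intCast (Polynomial.C : ℚ →+* RH) m, ← map_mul, ← map_neg, ← neg_mul, ← map_neg]
    congr 3
    push_cast
    rw [← hq]
    ring
  rw [e] at this
  linear_combination this

lemma IsBoxData.yangRel (h : IsBoxData A Dd bx col z φ) (hA : ∀ i, A i i = 2)
    (hD : ∀ a ∈ bx, Dd (col a) ≠ 0)
    (hh : ∀ q : ℚ, q ≠ 0 → algebraMap RH O (Polynomial.C q * hbar) ≠ 0) :
    YangRel A Dd fun c r => colorOp φ bx col c fun a => z a ^ r := by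
  refine ⟨fun i j r s => ?_, fun i j r s hij hA0 => ?_, fun i j r s t hij hA1 => ?_,
    fun i j r s u t hij hA2 => ?_⟩
  · rw [colorOp_lie, colorOp_lie, ← algebraMap_smul O, ← Finset.sum_sub_distrib]
    simp only [colorOp, end_lie_sum, end_lie_smul]
    simp only [Finset.sum_mul, Finset.mul_sum, Finset.smul_sum]
    rw [Finset.sum_comm (s := bx.filter fun a => col a = j), ← Finset.sum_add_distrib,
      Finset.smul_sum]
    refine Finset.sum_congr rfl fun a ha => ?_
    rw [← Finset.sum_sub_distrib, ← Finset.sum_add_distrib, Finset.smul_sum]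
    refine Finset.sum_congr rfl fun b hb => ?_
    rw [Finset.mem_filter] at ha hb
    have := h.loop ha.1 hb.1
    rw [ha.2, hb.2] at this
    simp only [smul_mul_assoc, mul_smul_comm, smul_smul]
    have e : z a ^ (r + 1) * z b ^ s - z a ^ r * z b ^ (s + 1) =
      (z a ^ r * z b ^ s) * (z a - z b) := by ring
    rw [end_sub_smul, e, mul_smul, this, mul_comm (z b ^ s), ← smul_add, smul_smul, smul_smul,
      mul_comm]
    rfl
  · rw [colorOp_lie]
    refine Finset.sum_eq_zero fun a ha => ?_
    simp only [colorOp, end_lie_sum, end_lie_smul]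
    rw [Finset.sum_eq_zero, smul_zero]
    intro b hb
    rw [Finset.mem_filter] at ha hb
    have e1 := prod_map_addBox_perm h.self (l := [a, b]) (l' := [a, b]) rfl
    have e2 := prod_map_addBox_perm h.self (l := [b, a]) (l' := [a, b]) (by ext; simp; tauto)
    simp only [List.map_cons, List.map_nil, List.prod_cons, List.prod_nil, mul_one, wordCoef]
      at e1 e2
    rw [Ring.lie_def, e1, e2, h.comm a ha.1 b hb.1 (by rw [ha.2, hb.2]; exact hij)
      (by rw [ha.2, hb.2]; exact hA0), sub_self, smul_zero]
  · simp only [colorOp_lie]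
    simp only [colorOp, end_lie_sum, end_lie_smul, Finset.smul_sum, smul_smul]
    rw [sum₂_swap (bx.filter fun a => col a = i) (fun a a' => ∑ b ∈ bx.filter (fun a => col a = j),
      (z a ^ s * (z a' ^ r * z b ^ t)) • ⁅addBox φ a, ⁅addBox φ a', addBox φ b⁆⁆),
      ← Finset.sum_add_distrib]
    refine Finset.sum_eq_zero fun a ha => ?_
    rw [← Finset.sum_add_distrib]
    refine Finset.sum_eq_zero fun a' ha' => ?_
    rw [← Finset.sum_add_distrib]
    refine Finset.sum_eq_zero fun b hb => ?_
    rw [Finset.mem_filter] at ha ha' hb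
    set q : ℚ := (Dd i : ℚ) / 2 with hq
    have hq2 : q * 2 = (Dd i : ℚ) := by rw [hq]; ring
    have hq0 : q ≠ 0 := by
      have := hD a ha.1
      rw [ha.2] at this
      rw [hq]
      positivity
    have key := serre_coef₁ (hh q hq0) (h.cross_self hA ha.1 ha'.1 ha.2 ha'.2 hq2 rfl)
      (by simpa using h.cross_ne (m := 1) ha.1 hb.1 ha.2 hb.2 hq2 hA1 rfl)
      (by simpa using h.cross_ne (m := 1) ha'.1 hb.1 ha'.2 hb.2 hq2 hA1 rfl)
    rw [lie_addBox₂ h.self, lie_addBox₂ h.self, Finset.insert_comm a' a, smul_smul, smul_smul,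
      end_add_smul]
    refine (congrArg (· • _) ?_).trans (zero_smul O _)
    linear_combination (z a ^ r * z a' ^ s * z b ^ t) * key
  · simp only [colorOp_lie]
    simp only [colorOp, end_lie_sum, end_lie_smul, Finset.smul_sum, smul_smul]
    refine sum₃_perm _ fun a ha b hb c hc => ?_
    simp only [← Finset.sum_add_distrib]
    refine Finset.sum_eq_zero fun d hd => ?_
    rw [Finset.mem_filter] at ha hb hc hd
    set q : ℚ := (Dd i : ℚ) / 2 with hq
    have hq2 : q * 2 = (Dd i : ℚ) := by rw [hq]; ring
    have hq0 : q ≠ 0 := by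
      have := hD a ha.1
      rw [ha.2] at this
      rw [hq]
      positivity
    have key := serre_coef₂ (hh q hq0) (h.cross_self hA ha.1 hb.1 ha.2 hb.2 hq2 rfl)
      (h.cross_self hA ha.1 hc.1 ha.2 hc.2 hq2 rfl) (h.cross_self hA hb.1 hc.1 hb.2 hc.2 hq2 rfl)
      (by simpa using h.cross_ne (m := 2) ha.1 hd.1 ha.2 hd.2 hq2 hA2 rfl)
      (by simpa using h.cross_ne (m := 2) hb.1 hd.1 hb.2 hd.2 hq2 hA2 rfl)
      (by simpa using h.cross_ne (m := 2) hc.1 hd.1 hc.2 hd.2 hq2 hA2 rfl)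
    have e : ∀ l : List Box, l.Perm [a, b, c] → (l ++ [d]).toFinset = [a, b, c, d].toFinset :=
      fun l hl => List.toFinset_eq_of_perm _ _ (hl.append_right [d])
    rw [lie_addBox₃ h.self a b c d rfl,
      lie_addBox₃ h.self a c b d (e [a, c, b] ((List.Perm.swap _ _ _).cons _)),
      lie_addBox₃ h.self b a c d (e [b, a, c] (List.Perm.swap _ _ _)),
      lie_addBox₃ h.self b c a d (e [b, c, a] (List.perm_append_comm (l₁ := [b, c]) (l₂ := [a]))),
      lie_addBox₃ h.self c a b d (e [c, a, b] (List.perm_append_comm (l₁ := [c]) (l₂ := [a, b]))),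
      lie_addBox₃ h.self c b a d (e [c, b, a] (List.reverse_perm [a, b, c]))]
    simp only [smul_smul, end_add_smul]
    refine (congrArg (· • _) ?_).trans (zero_smul O _)
    linear_combination (z a ^ r * z b ^ s * z c ^ u * z d ^ t) * key

end BoxRep

section Functionals

/-- linear independence is detected by the constant terms of linear functionals. -/
lemma linearIndependent_of_functionals {ι M : Type} [AddCommGroup M] [Module RH M] (v : ι → M)
    (h : ∀ q : ι →₀ ℚ, (∀ ℓ : M →ₗ[RH] RH, ∑ i ∈ q.support, q i * (ℓ (v i)).coeff 0 = 0) → q = 0) :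
    LinearIndependent RH v := by
  rw [linearIndependent_iff']
  intro s g hg i hi
  by_contra hgi
  have hex : ∃ k, ∃ i ∈ s, (g i).coeff k ≠ 0 := by
    by_contra hne
    push Not at hne
    exact hgi (Polynomial.ext fun k => by rw [hne k i hi, Polynomial.coeff_zero])
  classical
  obtain ⟨j, hj, hjk⟩ := Nat.find_spec hex
  have hlt : ∀ m < Nat.find hex, ∀ i ∈ s, (g i).coeff m = 0 := by
    intro m hm i hi
    by_contra hne
    exact Nat.find_min hex hm ⟨i, hi, hne⟩
  set k := Nat.find hex
  let q : ι →₀ ℚ := Finsupp.onFinset s (fun i => if i ∈ s then (g i).coeff k else 0)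
    fun i hi => by
      by_contra hne
      exact hi (if_neg hne)
  have hq : ∀ i ∈ s, q i = (g i).coeff k := fun i hi => by
    rw [Finsupp.onFinset_apply, if_pos hi]
  have hq0 := h q fun ℓ => by
    rw [Finset.sum_subset (Finsupp.support_onFinset_subset : q.support ⊆ s) fun i _ hi => by
      rw [Finsupp.notMem_support_iff.1 hi, zero_mul]]
    have e := congrArg (fun y => (ℓ y).coeff k) hg
    simp only [map_sum, map_smul, map_zero, Polynomial.coeff_zero, Polynomial.finsetSum_coeff,
      smul_eq_mul, Polynomial.coeff_mul] at e
    rw [← e]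
    refine Finset.sum_congr rfl fun i hi => ?_
    rw [Finset.sum_eq_single (k, 0), hq i hi]
    · rintro ⟨m, m'⟩ hm hne
      rw [Finset.HasAntidiagonal.mem_antidiagonal] at hm
      simp only at hm
      by_cases hmk : m = k
      · exact absurd (Prod.ext hmk (by simp only; omega)) hne
      · rw [hlt m (by omega) i hi, zero_mul]
    · intro hne
      exact absurd (Finset.HasAntidiagonal.mem_antidiagonal.2 (by simp)) hne
  rw [hq0] at hq
  exact hjk (hq j hj).symm

lemma hbar_ne_zero : hbar ≠ 0 := Polynomial.X_ne_zero

lemma linearIndependent_hbar_pow_smul {ι M : Type} [AddCommGroup M] [Module RH M] {v : ι → M}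
    (hv : LinearIndependent RH v) (m : ι → ℕ) :
    LinearIndependent RH fun i => hbar ^ m i • v i := by
  rw [linearIndependent_iff'] at hv ⊢
  intro s g hg i hi
  have := hv s (fun i => g i * hbar ^ m i) (by simpa only [mul_smul] using hg) i hi
  exact (mul_eq_zero.1 this).resolve_right (pow_ne_zero _ hbar_ne_zero)

lemma ordMon_smul {B κ : Type} [Ring B] [Algebra RH B] [LinearOrder κ] (E : κ → B) (h : κ →₀ ℕ) :
    ordMon (fun p => hbar • E p) h = hbar ^ (h.sum fun _ m => m) • ordMon E h := by
  unfold ordMon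
  have : ∀ l : List κ, (l.map fun p => (hbar • E p) ^ h p).prod =
      hbar ^ (l.map h).sum • (l.map fun p => E p ^ h p).prod := by
    intro l
    induction l with
    | nil => simp
    | cons p l ih =>
      rw [List.map_cons, List.prod_cons, ih, smul_pow, smul_mul_smul_comm, ← pow_add,
        List.map_cons, List.sum_cons, List.map_cons, List.prod_cons]
  rw [this, ← List.sum_toFinset _ (Finset.sort_nodup _ _), Finset.sort_toFinset]
  rfl

end Functionals

section Tensor
variable {N : ℕ}

abbrev SlotBox (N : ℕ) := (_ : Fin N) × ℕ

/-- the boxes of `s` in the slot `k`. -/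
def slice (s : Finset (SlotBox N)) (k : Fin N) : Finset ℕ :=
  (s.filter fun b => b.1 = k).image fun b => b.2

lemma mem_slice {s : Finset (SlotBox N)} {k : Fin N} {p : ℕ} :
    p ∈ slice s k ↔ (⟨k, p⟩ : SlotBox N) ∈ s := by
  simp only [slice, Finset.mem_image, Finset.mem_filter]
  constructor
  · rintro ⟨⟨k', p'⟩, ⟨h1, rfl⟩, rfl⟩
    exact h1
  · exact fun h => ⟨_, ⟨h, rfl⟩, rfl⟩

lemma slice_empty (k : Fin N) : slice (∅ : Finset (SlotBox N)) k = ∅ := rfl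

lemma slice_insert_self (s : Finset (SlotBox N)) (k : Fin N) (p : ℕ) :
    slice (insert ⟨k, p⟩ s) k = insert p (slice s k) := by
  ext q
  simp only [mem_slice, Finset.mem_insert, Sigma.mk.injEq, heq_eq_eq, true_and]

lemma slice_insert_ne (s : Finset (SlotBox N)) {k l : Fin N} (h : l ≠ k) (p : ℕ) :
    slice (insert ⟨k, p⟩ s) l = slice s l := by
  ext q
  simp only [mem_slice, Finset.mem_insert, Sigma.mk.injEq, h, false_and, false_or]

/-- the external product of functions of one slot. -/
def extProd (f : Fin N → Finset ℕ → ℚ) (s : Finset (SlotBox N)) : ℚ := ∏ k, f k (slice s k)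

lemma extProd_update (f : Fin N → Finset ℕ → ℚ) (k : Fin N) (g : Finset ℕ → ℚ)
    (s : Finset (SlotBox N)) : extProd (Function.update f k g) s =
      g (slice s k) * ∏ l ∈ Finset.univ.erase k, f l (slice s l) := by
  rw [extProd, ← Finset.mul_prod_erase _ _ (Finset.mem_univ k), Function.update_self]
  congr 1
  refine Finset.prod_congr rfl fun l hl => ?_
  rw [Function.update_of_ne (Finset.ne_of_mem_erase hl)]

/-- `F` acts on external products as `∑_k a_k^d u_k`. -/
def IsDer (a : Fin N → ℚ) (d : ℕ) (u : Fin N → Module.End ℚ (Finset ℕ → ℚ))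
    (F : Module.End ℚ (Finset (SlotBox N) → ℚ)) : Prop :=
  ∀ f, F (extProd f) = ∑ k, a k ^ d • extProd (Function.update f k (u k (f k)))

lemma IsDer.lie {a : Fin N → ℚ} {d d' : ℕ} {u u' : Fin N → Module.End ℚ (Finset ℕ → ℚ)}
    {F F' : Module.End ℚ (Finset (SlotBox N) → ℚ)} (h : IsDer a d u F) (h' : IsDer a d' u' F') :
    IsDer a (d + d') (fun k => ⁅u k, u' k⁆) ⁅F, F'⁆ := by
  intro f
  have e1 : F (F' (extProd f)) = ∑ k, ∑ l, (a k ^ d * a l ^ d') •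
      extProd (Function.update (Function.update f l (u' l (f l))) k
        (u k (Function.update f l (u' l (f l)) k))) := by
    rw [h' f, map_sum, Finset.sum_comm]
    refine Finset.sum_congr rfl fun l _ => ?_
    rw [map_smul, h, Finset.smul_sum]
    refine Finset.sum_congr rfl fun k _ => ?_
    rw [smul_smul, mul_comm]
  have e2 : F' (F (extProd f)) = ∑ k, ∑ l, (a k ^ d * a l ^ d') •
      extProd (Function.update (Function.update f k (u k (f k))) l
        (u' l (Function.update f k (u k (f k)) l))) := by
    rw [h f, map_sum]
    refine Finset.sum_congr rfl fun l _ => ?_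
    rw [map_smul, h', Finset.smul_sum]
    refine Finset.sum_congr rfl fun k _ => ?_
    rw [smul_smul]
  rw [Ring.lie_def, LinearMap.sub_apply, Module.End.mul_apply, Module.End.mul_apply, e1, e2,
    ← Finset.sum_sub_distrib]
  refine Finset.sum_congr rfl fun k _ => ?_
  rw [← Finset.sum_sub_distrib, Finset.sum_eq_single k]
  · rw [← smul_sub, pow_add]
    congr 1
    funext s
    simp only [Pi.sub_apply, Function.update_idem, extProd_update, Function.update_self,
      Ring.lie_def, LinearMap.sub_apply, Module.End.mul_apply]
    ring
  · intro l _ hl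
    rw [Function.update_of_ne hl, Function.update_of_ne hl.symm, Function.update_comm hl, sub_self]
  · exact fun h => absurd (Finset.mem_univ k) h

end Tensor

section Reduction
variable {Box : Type} [DecidableEq Box] {φ : Box → Box → RH} {φ₀ : Box → Box → ℚ}

/-- the operator `F₀` is the reduction of `F` at `ħ = 0`. -/
def IsReduction (F : Module.End RH (Finset Box → RH)) (F₀ : Module.End ℚ (Finset Box → ℚ)) : Prop :=
  ∀ ψ s, (F ψ s).coeff 0 = F₀ (fun t => (ψ t).coeff 0) s

omit [DecidableEq Box] in
lemma IsReduction.mul {F G : Module.End RH (Finset Box → RH)}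
    {F₀ G₀ : Module.End ℚ (Finset Box → ℚ)} (h : IsReduction F F₀) (h' : IsReduction G G₀) :
    IsReduction (F * G) (F₀ * G₀) := by
  intro ψ s
  rw [Module.End.mul_apply, Module.End.mul_apply, h, funext (h' ψ)]

omit [DecidableEq Box] in
lemma IsReduction.lie {F G : Module.End RH (Finset Box → RH)}
    {F₀ G₀ : Module.End ℚ (Finset Box → ℚ)} (h : IsReduction F F₀) (h' : IsReduction G G₀) :
    IsReduction ⁅F, G⁆ ⁅F₀, G₀⁆ := by
  intro ψ s
  have e1 := h.mul h' ψ s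
  have e2 := h'.mul h ψ s
  rw [Ring.lie_def, Ring.lie_def, LinearMap.sub_apply, LinearMap.sub_apply, Pi.sub_apply,
    Pi.sub_apply, Polynomial.coeff_sub, e1, e2]

omit [DecidableEq Box] in
lemma IsReduction.list_prod {κ : Type} (l : List κ) {F : κ → Module.End RH (Finset Box → RH)}
    {F₀ : κ → Module.End ℚ (Finset Box → ℚ)} (h : ∀ p, IsReduction (F p) (F₀ p)) :
    IsReduction (l.map F).prod (l.map F₀).prod := by
  induction l with
  | nil => exact fun ψ s => rfl
  | cons p l ih => exact (h p).mul ih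

lemma colorOp_apply {O : Type} [CommRing O] (φ : Box → Box → O) (bx : Finset Box) (col : Box → ℕ)
    (c : ℕ) (f : Box → O) (ψ : Finset Box → O) (s : Finset Box) : colorOp φ bx col c f ψ s =
      ∑ a ∈ bx, if col a = c then f a * (if a ∈ s then 0 else (∏ b ∈ s, φ a b) * ψ (insert a s))
        else 0 := by
  rw [colorOp, LinearMap.sum_apply, Finset.sum_apply, Finset.sum_filter]
  rfl

lemma isReduction_colorOp (hφ : ∀ a b, (φ a b).coeff 0 = φ₀ a b) (bx : Finset Box)
    (col : Box → ℕ) (c : ℕ) {f : Box → RH} {f₀ : Box → ℚ} (hf : ∀ a, (f a).coeff 0 = f₀ a) :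
    IsReduction (colorOp φ bx col c f) (colorOp φ₀ bx col c f₀) := by
  intro ψ s
  rw [colorOp_apply, colorOp_apply, Polynomial.finsetSum_coeff]
  refine Finset.sum_congr rfl fun a _ => ?_
  split_ifs
  · simp
  · simp only [← Polynomial.constantCoeff_apply] at hf hφ ⊢
    simp only [map_mul, map_prod, hφ, hf]
  · simp

end Reduction

section SlotRep
attribute [local instance] LieRing.ofAssociativeRing

/-- numerical data of an evaluation-type module: boxes `0, …, len - 1` with colors, positions and
weights. -/
structure Slot where
  len : ℕ
  col : ℕ → ℕ
  pos : ℕ → ℚ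
  wt : ℕ → ℕ → ℚ

namespace Slot

/-- the operator of color `c`. -/
def op (S : Slot) (c : ℕ) : Module.End ℚ (Finset ℕ → ℚ) :=
  colorOp S.wt (Finset.range S.len) S.col c fun _ => 1

lemma op_apply (S : Slot) (c : ℕ) (ψ : Finset ℕ → ℚ) (s : Finset ℕ) : S.op c ψ s =
    ∑ p ∈ Finset.range S.len, if S.col p = c then
      1 * (if p ∈ s then 0 else (∏ q ∈ s, S.wt p q) * ψ (insert p s)) else 0 :=
  colorOp_apply _ _ _ _ _ _ _

/-- the action of a bracketing. -/
def act (S : Slot) (T : BTree) : Module.End ℚ (Finset ℕ → ℚ) := T.eval fun c _ => S.op c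

/-- the indicator function of the set of all boxes. -/
def full (S : Slot) : Finset ℕ → ℚ := fun s => if s = Finset.range S.len then 1 else 0

/-- compatibility of the data with a symmetrizable Cartan matrix. -/
structure Good (n : ℕ) (A : ℕ → ℕ → ℤ) (Dd : ℕ → ℕ) (S : Slot) : Prop where
  col_pos : ∀ p < S.len, 1 ≤ S.col p
  col_le : ∀ p < S.len, S.col p ≤ n
  self : ∀ p, S.wt p p = 0
  cross : ∀ p < S.len, ∀ q < S.len,
    (S.pos p - S.pos q + (Dd (S.col p) : ℚ) * A (S.col p) (S.col q) / 2) * S.wt p q =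
      (S.pos p - S.pos q - (Dd (S.col p) : ℚ) * A (S.col p) (S.col q) / 2) * S.wt q p
  comm : ∀ p < S.len, ∀ q < S.len, S.col p ≠ S.col q → A (S.col p) (S.col q) = 0 →
    S.wt p q = S.wt q p

end Slot

/-- the sum of the second indices. -/
def BTree.deg : BTree → ℕ
  | .leaf _ r => r
  | .br a b => a.deg + b.deg

variable {N n : ℕ} {A : ℕ → ℕ → ℤ} {Dd : ℕ → ℕ} (S : Fin N → Slot) (a : Fin N → ℚ)

/-- all boxes of a family of slots. -/
def slotBoxes : Finset (SlotBox N) := Finset.univ.sigma fun k => Finset.range (S k).len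

/-- the color of a box. -/
def slotCol (b : SlotBox N) : ℕ := (S b.1).col b.2

/-- the parameter of a box. -/
def slotPar (b : SlotBox N) : RH :=
  Polynomial.C (a b.1) + Polynomial.C ((S b.1).pos b.2) * Polynomial.X

/-- the weights of a family of slots. -/
def slotWt (A : ℕ → ℕ → ℤ) (Dd : ℕ → ℕ) (b b' : SlotBox N) : RH :=
  if b.1 = b'.1 then Polynomial.C ((S b.1).wt b.2 b'.2)
  else Polynomial.C (a b.1 - a b'.1)⁻¹ *
    (slotPar S a b - slotPar S a b' - halfForm RH A Dd (slotCol S b) (slotCol S b'))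

variable {S a}

lemma halfForm_eq (A : ℕ → ℕ → ℤ) (Dd : ℕ → ℕ) (i j : ℕ) :
    halfForm RH A Dd i j = Polynomial.C (((Dd i : ℚ) * (A i j : ℚ)) / 2) * Polynomial.X := rfl

lemma mem_slotBoxes {b : SlotBox N} : b ∈ slotBoxes S ↔ b.2 < (S b.1).len := by
  simp [slotBoxes]

lemma isBoxData_slots (hS : ∀ k, (S k).Good n A Dd)
    (hs : ∀ i j, 1 ≤ i → i ≤ n → 1 ≤ j → j ≤ n → (Dd i : ℤ) * A i j = (Dd j : ℤ) * A j i) :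
    IsBoxData A Dd (slotBoxes S) (slotCol S) (slotPar S a) (slotWt S a A Dd) := by
  have hsym : ∀ b ∈ slotBoxes S, ∀ b' ∈ slotBoxes S,
      halfForm RH A Dd (slotCol S b) (slotCol S b') =
        halfForm RH A Dd (slotCol S b') (slotCol S b) := by
    intro b hb b' hb'
    rw [mem_slotBoxes] at hb hb'
    have := hs (slotCol S b) (slotCol S b') ((hS _).col_pos _ hb) ((hS _).col_le _ hb)
      ((hS _).col_pos _ hb') ((hS _).col_le _ hb')
    have h2 : (Dd (slotCol S b) : ℚ) * A (slotCol S b) (slotCol S b') =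
      (Dd (slotCol S b') : ℚ) * A (slotCol S b') (slotCol S b) := by exact_mod_cast this
    rw [halfForm, halfForm, h2]
  have hinv : ∀ k l : Fin N,
      Polynomial.C (a l - a k)⁻¹ = -Polynomial.C (a k - a l)⁻¹ := by
    intro k l
    rw [← Polynomial.C_neg, ← inv_neg, neg_sub]
  refine ⟨fun b => ?_, fun b hb b' hb' => ?_, fun b hb b' hb' hne h0 => ?_⟩
  · rw [slotWt, if_pos rfl, (hS _).self, Polynomial.C_0]
  · have hsy := hsym b hb b' hb'
    rw [mem_slotBoxes] at hb hb'
    by_cases hk : b.1 = b'.1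
    · obtain ⟨k, p⟩ := b
      obtain ⟨l, q⟩ := b'
      obtain rfl : k = l := hk
      have h := congrArg (fun t : ℚ => Polynomial.C t * (Polynomial.X : RH))
        ((hS k).cross p hb q hb')
      simp only [slotWt, if_true, slotPar, halfForm_eq, slotCol]
      simp only [Polynomial.C_mul, Polynomial.C_sub, Polynomial.C_add] at h
      linear_combination h
    · rw [slotWt, slotWt, if_neg hk, if_neg (Ne.symm hk), ← hsy, hinv b.1 b'.1]
      ring
  · have hsy := hsym b hb b' hb'
    rw [mem_slotBoxes] at hb hb'
    by_cases hk : b.1 = b'.1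
    · obtain ⟨k, p⟩ := b
      obtain ⟨l, q⟩ := b'
      obtain rfl : k = l := hk
      simp only [slotWt, if_true]
      rw [(hS k).comm p hb q hb' hne h0]
    · have h00 : halfForm RH A Dd (slotCol S b) (slotCol S b') = 0 := by
        rw [halfForm, h0]; simp
      rw [slotWt, slotWt, if_neg hk, if_neg (Ne.symm hk), ← hsy, hinv b.1 b'.1, h00]
      ring

/-- the representation operators. -/
def slotOp (S : Fin N → Slot) (a : Fin N → ℚ) (A : ℕ → ℕ → ℤ) (Dd : ℕ → ℕ) (c r : ℕ) :
    Module.End RH (Finset (SlotBox N) → RH) :=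
  colorOp (slotWt S a A Dd) (slotBoxes S) (slotCol S) c fun b => slotPar S a b ^ r

lemma exists_slotRep (hA : ∀ i, A i i = 2)
    (hA' : ∀ i j, i ≠ j → A i j = 0 ∨ A i j = -1 ∨ A i j = -2)
    (hs : ∀ i j, 1 ≤ i → i ≤ n → 1 ≤ j → j ≤ n → (Dd i : ℤ) * A i j = (Dd j : ℤ) * A j i)
    (hD : ∀ i, Dd i ≠ 0) (hS : ∀ k, (S k).Good n A Dd) :
    ∃ ρ : YA n A Dd →ₐ[RH] Module.End RH (Finset (SlotBox N) → RH),
      ∀ c r, ρ (gy1 n A Dd c r) = slotOp S a A Dd c r := by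
  refine YangRel.exists_algHom hA' ((isBoxData_slots hS hs).yangRel hA (fun b _ => hD _) ?_) ?_
  · intro q hq
    exact mul_ne_zero (Polynomial.C_ne_zero.2 hq) hbar_ne_zero
  · intro c r hc
    refine (Finset.sum_congr (Finset.filter_eq_empty_iff.2 ?_) fun _ _ => rfl).trans
      Finset.sum_empty
    intro b hb hbc
    rw [mem_slotBoxes] at hb
    have h1 : 1 ≤ slotCol S b := (hS b.1).col_pos _ hb
    have h2 : slotCol S b ≤ n := (hS b.1).col_le _ hb
    omega

/-- the reduction of the weights. -/
def slotWt₀ (S : Fin N → Slot) (b b' : SlotBox N) : ℚ :=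
  if b.1 = b'.1 then (S b.1).wt b.2 b'.2 else 1

/-- the reduced representation operators. -/
def slotOp₀ (S : Fin N → Slot) (a : Fin N → ℚ) (c r : ℕ) :
    Module.End ℚ (Finset (SlotBox N) → ℚ) :=
  colorOp (slotWt₀ S) (slotBoxes S) (slotCol S) c fun b => a b.1 ^ r

lemma isReduction_slotOp (ha : Function.Injective a) (c r : ℕ) :
    IsReduction (slotOp S a A Dd c r) (slotOp₀ S a c r) := by
  refine isReduction_colorOp (fun b b' => ?_) _ _ _ fun b => ?_
  · rw [slotWt, slotWt₀]
    split_ifs with hk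
    · simp
    · have : a b.1 - a b'.1 ≠ 0 := sub_ne_zero.2 fun h => hk (ha h)
      simp [halfForm_eq, slotPar, this]
  · simp [slotPar, Polynomial.coeff_zero_eq_eval_zero]

lemma isDer_slotOp₀ (c r : ℕ) : IsDer a r (fun k => (S k).op c) (slotOp₀ S a c r) := by
  intro f
  funext s
  rw [slotOp₀, colorOp_apply, slotBoxes, Finset.sum_sigma, Finset.sum_apply]
  refine Finset.sum_congr rfl fun k _ => ?_
  rw [Pi.smul_apply, extProd_update, Slot.op_apply, Finset.sum_mul, smul_eq_mul,
    Finset.mul_sum]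
  refine Finset.sum_congr rfl fun p _ => ?_
  simp only [mem_slice]
  by_cases h1 : (S k).col p = c
  swap
  · have h1' : slotCol S ⟨k, p⟩ ≠ c := h1
    rw [if_neg h1', if_neg h1, zero_mul, mul_zero]
  have h1' : slotCol S ⟨k, p⟩ = c := h1
  rw [if_pos h1', if_pos h1]
  by_cases h2 : (⟨k, p⟩ : SlotBox N) ∈ s
  · simp [h2]
  · have e1 : ∏ b ∈ s, slotWt₀ S ⟨k, p⟩ b = ∏ q ∈ slice s k, (S k).wt p q := by
      rw [slice, Finset.prod_image]
      · rw [Finset.prod_filter]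
        refine Finset.prod_congr rfl fun b _ => ?_
        simp only [slotWt₀, eq_comm (a := k)]
      · rintro ⟨k₁, p₁⟩ h₁ ⟨k₂, p₂⟩ h₂ h
        simp only [Finset.coe_filter, Set.mem_ofPred_eq] at h₁ h₂ h
        obtain ⟨_, rfl⟩ := h₁
        obtain ⟨_, rfl⟩ := h₂
        rw [h]
    have e2 : extProd f (insert (⟨k, p⟩ : SlotBox N) s) = f k (insert p (slice s k)) *
        ∏ l ∈ Finset.univ.erase k, f l (slice s l) := by
      rw [extProd, ← Finset.mul_prod_erase _ _ (Finset.mem_univ k), slice_insert_self]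
      congr 1
      refine Finset.prod_congr rfl fun l hl => ?_
      rw [slice_insert_ne s (Finset.ne_of_mem_erase hl)]
    rw [if_neg h2, if_neg h2, e1, e2]
    ring

lemma isReduction_eval (ha : Function.Injective a) (T : BTree) :
    IsReduction (T.eval (slotOp S a A Dd)) (T.eval (slotOp₀ S a)) := by
  induction T with
  | leaf c r => exact isReduction_slotOp ha c r
  | br T T' ih ih' => exact ih.lie ih'

lemma isDer_eval (T : BTree) : IsDer a T.deg (fun k => (S k).act T) (T.eval (slotOp₀ S a)) := by
  induction T with
  | leaf c r => exact isDer_slotOp₀ c r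
  | br T T' ih ih' => exact ih.lie ih'

end SlotRep

section Placements
variable {N : ℕ} {κ : Type}

/-- the generating polynomial of the placements of the letters of a list into slots. -/
def placement (E : Fin N → κ → ℚ) (d : κ → ℕ) :
    List κ → Finset (Fin N) → MvPolynomial (Fin N) ℚ
  | [], _ => 1
  | j :: l, K => ∑ k ∈ K, MvPolynomial.monomial (Finsupp.single k (d j)) (E k j) *
      placement E d l (K.erase k)

/-- the number of bijective placements respecting labels. -/
def placementCount [DecidableEq κ] (lab : Fin N → κ) : List κ → Finset (Fin N) → ℕ
  | [], _ => 1
  | j :: l, K => ∑ k ∈ K, if j = lab k then placementCount lab l (K.erase k) else 0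

lemma coeff_placement_eq_zero (E : Fin N → κ → ℚ) (d : κ → ℕ) (l : List κ) :
    ∀ (K : Finset (Fin N)) (m : Fin N →₀ ℕ) (k : Fin N), k ∉ K → m k ≠ 0 →
      (placement E d l K).coeff m = 0 := by
  induction l with
  | nil =>
    intro K m k _ hm
    rw [placement, MvPolynomial.coeff_one, if_neg]
    rintro rfl
    exact hm rfl
  | cons j l ih =>
    intro K m k hk hm
    rw [placement, MvPolynomial.coeff_sum]
    refine Finset.sum_eq_zero fun k' hk' => ?_
    rw [MvPolynomial.coeff_monomial_mul']
    split_ifs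
    · rw [ih (K.erase k') _ k (fun h => hk (Finset.mem_of_mem_erase h)), mul_zero]
      have : k' ≠ k := by
        rintro rfl
        exact hk hk'
      rw [Finsupp.tsub_apply, Finsupp.single_eq_of_ne this.symm, Nat.sub_zero]
      exact hm
    · rfl

lemma coeff_placement {α : Type} [DecidableEq α] {lab : Fin N → α × ℕ} {E : Fin N → α × ℕ → ℚ}
    {e : Fin N → ℚ} (hE : ∀ k j, E k j = if j.1 = (lab k).1 then e k else 0) (l : List (α × ℕ)) :
    ∀ K : Finset (Fin N), l.length = K.card →
      (placement E Prod.snd l K).coeff (∑ k ∈ K, Finsupp.single k (lab k).2) =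
        (∏ k ∈ K, e k) * placementCount lab l K := by
  induction l with
  | nil =>
    intro K hK
    obtain rfl : K = ∅ := Finset.card_eq_zero.1 hK.symm
    simp [placement, placementCount]
  | cons j l ih =>
    intro K hK
    rw [placement, placementCount, MvPolynomial.coeff_sum, Nat.cast_sum, Finset.mul_sum]
    refine Finset.sum_congr rfl fun k hk => ?_
    rw [MvPolynomial.coeff_monomial_mul', ← Finset.add_sum_erase _ _ hk, hE]
    have hval : ((Finsupp.single k (lab k).2 + ∑ x ∈ K.erase k, Finsupp.single x (lab x).2 :
        Fin N →₀ ℕ)) k = (lab k).2 := by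
      rw [Finsupp.add_apply, Finsupp.single_eq_same, Finsupp.finsetSum_apply,
        Finset.sum_eq_zero, Nat.add_zero]
      intro x hx
      exact Finsupp.single_eq_of_ne (Finset.ne_of_mem_erase hx).symm
    by_cases hj : j = lab k
    · rw [if_pos, hj, if_pos rfl, if_pos rfl, add_tsub_cancel_left,
        ih _ (by rw [Finset.card_erase_of_mem hk, ← hK]; rfl), ← Finset.mul_prod_erase _ _ hk]
      · ring
      · rw [hj]
        exact le_self_add
    · rw [if_neg hj, Nat.cast_zero, mul_zero]
      by_cases h1 : j.1 = (lab k).1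
      · have h2 : j.2 ≠ (lab k).2 := fun h2 => hj (Prod.ext h1 h2)
        split_ifs with h3
        · have h4 : j.2 ≤ (lab k).2 := by
            have := h3 k
            rwa [hval, Finsupp.single_eq_same] at this
          rw [coeff_placement_eq_zero _ _ _ _ _ k (Finset.notMem_erase k K), mul_zero]
          rw [Finsupp.tsub_apply, hval, Finsupp.single_eq_same]
          omega
        · rfl
      · simp [h1]

lemma placementCount_ne_zero_iff [DecidableEq κ] {lab : Fin N → κ} (l : List κ) :
    ∀ K : Finset (Fin N), l.length = K.card →
      (placementCount lab l K ≠ 0 ↔ (l : Multiset κ) = K.val.map lab) := by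
  induction l with
  | nil =>
    intro K hK
    obtain rfl : K = ∅ := Finset.card_eq_zero.1 hK.symm
    simp [placementCount]
  | cons j l ih =>
    intro K hK
    have hcard : ∀ k ∈ K, l.length = (K.erase k).card := fun k hk => by
      rw [Finset.card_erase_of_mem hk, ← hK]; rfl
    have hmap : ∀ k ∈ K, K.val.map lab = lab k ::ₘ (K.erase k).val.map lab := fun k hk => by
      rw [Finset.erase_val, ← Multiset.map_cons, Multiset.cons_erase hk]
    rw [placementCount, Ne, Finset.sum_eq_zero_iff]
    push Not
    rw [← Multiset.cons_coe]
    constructor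
    · rintro ⟨k, hk, h⟩
      rw [ite_ne_right_iff] at h
      rw [hmap k hk, ← (ih _ (hcard k hk)).1 h.2, h.1]
    · intro h
      have : j ∈ K.val.map lab := by rw [← h]; exact Multiset.mem_cons_self j _
      obtain ⟨k, hk, rfl⟩ := Multiset.mem_map.1 this
      rw [hmap k hk, Multiset.cons_inj_right] at h
      exact ⟨k, hk, by rw [if_pos rfl]; exact (ih _ (hcard k hk)).2 h⟩

lemma MvPolynomial.eq_zero_of_eval_injective {P : MvPolynomial (Fin N) ℚ}
    (h : ∀ a : Fin N → ℚ, Function.Injective a → MvPolynomial.eval a P = 0) : P = 0 := by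
  let V : MvPolynomial (Fin N) ℚ := ∏ p ∈ Finset.univ.filter fun p : Fin N × Fin N => p.1 ≠ p.2,
    (MvPolynomial.X p.1 - MvPolynomial.X p.2)
  have hV : V ≠ 0 := by
    refine Finset.prod_ne_zero_iff.2 fun p hp => sub_ne_zero.2 fun h => ?_
    exact (Finset.mem_filter.1 hp).2 (MvPolynomial.X_injective h)
  have hPV : P * V = 0 := by
    refine MvPolynomial.funext fun a => ?_
    rw [map_mul, map_zero]
    by_cases ha : Function.Injective a
    · rw [h a ha, zero_mul]
    · simp only [Function.Injective] at ha
      push Not at ha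
      obtain ⟨k, l, h1, h2⟩ := ha
      rw [map_prod, Finset.prod_eq_zero (i := (k, l)), mul_zero]
      · simpa using h2
      · simp [h1]
  exact (mul_eq_zero.1 hPV).resolve_right hV

end Placements

section ListValues
variable {N : ℕ} {κ : Type} {a : Fin N → ℚ} {d : κ → ℕ}
  {u : κ → Fin N → Module.End ℚ (Finset ℕ → ℚ)} {D : κ → Module.End ℚ (Finset (SlotBox N) → ℚ)}

lemma list_prod_extProd_eq_zero (hD : ∀ j, IsDer a (d j) (u j) (D j)) (l : List κ) :
    ∀ (f : Fin N → Finset ℕ → ℚ) (K : Finset (Fin N)), l.length < K.card →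
      (∀ k ∈ K, f k ∅ = 0) → (l.reverse.map D).prod (extProd f) ∅ = 0 := by
  induction l with
  | nil =>
    intro f K hK hf
    obtain ⟨k, hk⟩ := Finset.card_pos.1 hK
    exact Finset.prod_eq_zero (Finset.mem_univ k) (hf k hk)
  | cons j l ih =>
    intro f K hK hf
    rw [List.reverse_cons, List.map_append, List.prod_append, List.map_singleton,
      List.prod_singleton, Module.End.mul_apply, hD, map_sum, Finset.sum_apply]
    refine Finset.sum_eq_zero fun k _ => ?_
    rw [map_smul, Pi.smul_apply, ih _ (K.erase k), smul_zero]
    · have := Finset.pred_card_le_card_erase (a := k) (s := K)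
      rw [List.length_cons] at hK
      omega
    · intro m hm
      rw [Function.update_of_ne (Finset.ne_of_mem_erase hm)]
      exact hf m (Finset.mem_of_mem_erase hm)

lemma list_prod_extProd (hD : ∀ j, IsDer a (d j) (u j) (D j)) {F : Fin N → Finset ℕ → ℚ}
    (hF : ∀ k, F k ∅ = 0) (l : List κ) : ∀ (f : Fin N → Finset ℕ → ℚ) (K : Finset (Fin N)),
      l.length = K.card → (∀ k ∈ K, f k = F k) →
      (l.reverse.map D).prod (extProd f) ∅ = (∏ k ∈ Kᶜ, f k ∅) *
        MvPolynomial.eval a (placement (fun k j => u j k (F k) ∅) d l K) := by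
  induction l with
  | nil =>
    intro f K hK hf
    obtain rfl : K = ∅ := Finset.card_eq_zero.1 hK.symm
    simp [placement, extProd, slice_empty]
  | cons j l ih =>
    intro f K hK hf
    rw [List.reverse_cons, List.map_append, List.prod_append, List.map_singleton,
      List.prod_singleton, Module.End.mul_apply, hD, map_sum, Finset.sum_apply, placement,
      map_sum, Finset.mul_sum, ← Finset.sum_subset (Finset.subset_univ K)]
    · refine Finset.sum_congr rfl fun k hk => ?_
      rw [map_smul, Pi.smul_apply, ih _ (K.erase k)
        (by rw [Finset.card_erase_of_mem hk, ← hK]; rfl), Finset.compl_erase,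
        Finset.prod_insert (by simpa using hk), Function.update_self, hf k hk, map_mul,
        MvPolynomial.eval_monomial, smul_eq_mul]
      · have : ∏ x ∈ Kᶜ, Function.update f k (u j k (F k)) x ∅ = ∏ x ∈ Kᶜ, f x ∅ := by
          refine Finset.prod_congr rfl fun x hx => ?_
          rw [Function.update_of_ne]
          rintro rfl
          exact Finset.mem_compl.1 hx hk
        rw [this]
        simp
        ring
      · intro m hm
        rw [Function.update_of_ne (Finset.ne_of_mem_erase hm)]
        exact hf m (Finset.mem_of_mem_erase hm)
    · intro k _ hk
      rw [map_smul, Pi.smul_apply, list_prod_extProd_eq_zero hD l _ K, smul_zero]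
      · rw [← hK]
        exact Nat.lt_succ_self _
      · intro m hm
        rw [Function.update_of_ne (by rintro rfl; exact hk hm), hf m hm, hF]

end ListValues

section Independence
attribute [local instance] LieRing.ofAssociativeRing
variable {n : ℕ} {A : ℕ → ℕ → ℤ} {Dd : ℕ → ℕ}

theorem linearIndependent_ordMon (hA : ∀ i, A i i = 2)
    (hA' : ∀ i j, i ≠ j → A i j = 0 ∨ A i j = -1 ∨ A i j = -2)
    (hs : ∀ i j, 1 ≤ i → i ≤ n → 1 ≤ j → j ≤ n → (Dd i : ℤ) * A i j = (Dd j : ℤ) * A j i)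
    (hD : ∀ i, Dd i ≠ 0) {α : Type} [LinearOrder α] {T : α × ℕ → BTree}
    (hdeg : ∀ p, (T p).deg = p.2) (S : α → Slot) (hS : ∀ b, (S b).Good n A Dd)
    (hlen : ∀ b, (S b).len ≠ 0) {e : α → ℚ} (he : ∀ b, e b ≠ 0)
    (hE : ∀ b p, (S b).act (T p) (S b).full ∅ = if p.1 = b then e b else 0) :
    LinearIndependent RH fun h : Lex (α × ℕ) →₀ ℕ =>
      ordMon (fun p => hbar • (T (ofLex p)).eval (gy1 n A Dd)) h := by
  simp only [ordMon_smul]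
  refine linearIndependent_hbar_pow_smul (v := fun h : Lex (α × ℕ) →₀ ℕ =>
    ordMon (fun p => (T (ofLex p)).eval (gy1 n A Dd)) h)
    (linearIndependent_of_functionals _ fun q hq => ?_) fun h => h.sum fun _ m => m
  by_contra hq0
  choose L hLc hLp using fun h : Lex (α × ℕ) →₀ ℕ =>
    exists_list_ordMon (fun p : Lex (α × ℕ) => (T (ofLex p)).eval (gy1 n A Dd)) h
  obtain ⟨h₀, hh₀, hmax⟩ := Finset.exists_max_image q.support (fun h => (L h).length)
    (Finsupp.support_nonempty_iff.2 hq0)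
  set N := (L h₀).length
  let lab : Fin N → α × ℕ := fun k => ofLex ((L h₀).get k)
  let E : Fin N → α × ℕ → ℚ := fun k j => (S (lab k).1).act (T j) (S (lab k).1).full ∅
  let w : (Lex (α × ℕ) →₀ ℕ) → List (α × ℕ) := fun h => ((L h).map ofLex).reverse
  have hw : ∀ h, (w h).length = (L h).length := fun h => by simp [w]
  let P : (Lex (α × ℕ) →₀ ℕ) → MvPolynomial (Fin N) ℚ := fun h =>
    if (L h).length = N then placement E Prod.snd (w h) Finset.univ else 0
  have hfull : ∀ b, (S b).full ∅ = 0 := fun b => by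
    rw [Slot.full, if_neg]
    intro h
    have := congrArg Finset.card h
    rw [Finset.card_range] at this
    exact hlen b this.symm
  have hP : ∀ a : Fin N → ℚ, Function.Injective a →
      MvPolynomial.eval a (∑ h ∈ q.support, MvPolynomial.C (q h) * P h) = 0 := by
    intro a ha
    let S' : Fin N → Slot := fun k => S (lab k).1
    obtain ⟨ρ, hρ⟩ := exists_slotRep (S := S') (a := a) hA hA' hs hD fun k => hS _
    let f : Fin N → Finset ℕ → ℚ := fun k => (S' k).full
    let ℓ : YA n A Dd →ₗ[RH] RH :=
      { toFun := fun y => ρ y (fun s => Polynomial.C (extProd f s)) ∅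
        map_add' := fun y y' => by rw [map_add]; rfl
        map_smul' := fun c y => by rw [map_smul]; rfl }
    rw [map_sum, ← hq ℓ]
    refine Finset.sum_congr rfl fun h hh => ?_
    rw [map_mul, MvPolynomial.eval_C]
    congr 1
    have hder : ∀ j : α × ℕ, IsDer a j.2 (fun k => (S' k).act (T j))
        ((T j).eval (slotOp₀ S' a)) := fun j => by
      have := isDer_eval (S := S') (a := a) (T j)
      rwa [hdeg] at this
    have hval : (ℓ (ordMon (fun p : Lex (α × ℕ) => (T (ofLex p)).eval (gy1 n A Dd)) h)).coeff 0 =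
        ((w h).reverse.map fun j => (T j).eval (slotOp₀ S' a)).prod (extProd f) ∅ := by
      have hmap : ρ (ordMon (fun p : Lex (α × ℕ) => (T (ofLex p)).eval (gy1 n A Dd)) h) =
          ((w h).reverse.map fun j => (T j).eval (slotOp S' a A Dd)).prod := by
        rw [hLp, map_list_prod]
        congr 1
        simp only [w, List.reverse_reverse, List.map_map]
        refine List.map_congr_left fun p _ => ?_
        simp only [Function.comp]
        rw [BTree.map_eval ρ fun x y => by simp only [Ring.lie_def, map_sub, map_mul]]
        simp only [hρ]
      change (ρ _ _ ∅).coeff 0 = _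
      rw [hmap, IsReduction.list_prod (w h).reverse fun j => isReduction_eval ha (T j)]
      simp only [Polynomial.coeff_C_zero]
    rw [hval]
    by_cases hN : (L h).length = N
    · simp only [P]
      rw [if_pos hN, list_prod_extProd hder (F := f) (fun k => hfull _) (w h) f Finset.univ
        (by rw [hw, hN, Finset.card_univ, Fintype.card_fin]) fun k _ => rfl, Finset.compl_univ,
        Finset.prod_empty, one_mul]
    · simp only [P]
      rw [if_neg hN, map_zero, list_prod_extProd_eq_zero hder (w h) f Finset.univ
        (by
          rw [hw, Finset.card_univ, Fintype.card_fin]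
          exact lt_of_le_of_ne (hmax h hh) hN) fun k _ => hfull _]
  have hcard : ∀ h, (L h).length = N → (w h).length = (Finset.univ : Finset (Fin N)).card :=
    fun h hN => by rw [hw, hN, Finset.card_univ, Fintype.card_fin]
  have hlab : ∀ h, ((w h : List (α × ℕ)) : Multiset (α × ℕ)) =
      (Finset.univ : Finset (Fin N)).val.map lab ↔ h = h₀ := by
    intro h
    have e1 : (Finset.univ : Finset (Fin N)).val.map lab = ((L h₀).map ofLex : List (α × ℕ)) := by
      rw [Fin.univ_val_map]
      congr 1
      refine List.ext_get (by simp [N]) fun k h1 h2 => ?_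
      simp [lab]
    rw [e1, Multiset.coe_eq_coe]
    simp only [w]
    rw [(List.reverse_perm _).congr_left, List.map_perm_map_iff ofLex.injective]
    constructor
    · intro hp
      ext p
      rw [← hLc, ← hLc]
      exact @List.Perm.count_eq _ instBEqOfDecidableEq _ _ hp p
    · rintro rfl
      rfl
  have hQ := congrArg (MvPolynomial.coeff (∑ k, Finsupp.single k (lab k).2))
    (MvPolynomial.eq_zero_of_eval_injective hP)
  rw [MvPolynomial.coeff_sum, Finset.sum_eq_single_of_mem h₀ hh₀, MvPolynomial.coeff_C_mul,
    MvPolynomial.coeff_zero] at hQ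
  · simp only [P] at hQ
    rw [if_pos rfl, coeff_placement (fun k j => hE _ _) _ _ (hcard h₀ rfl)] at hQ
    have h1 := (mul_eq_zero.1 hQ).resolve_left (Finsupp.mem_support_iff.1 hh₀)
    have h2 := (mul_eq_zero.1 h1).resolve_left (Finset.prod_ne_zero_iff.2 fun k _ => he _)
    refine (placementCount_ne_zero_iff (lab := lab) _ _ (hcard h₀ rfl)).2 ?_ (by exact_mod_cast h2)
    exact (hlab h₀).2 rfl
  · intro h hh hne
    simp only [P]
    rw [MvPolynomial.coeff_C_mul]
    by_cases hN : (L h).length = N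
    · rw [if_pos hN, coeff_placement (fun k j => hE _ _) _ _ (hcard h hN),
        not_not.1 fun h0 => hne ((hlab h).1
          ((placementCount_ne_zero_iff (lab := lab) _ _ (hcard h hN)).1 h0)), Nat.cast_zero,
        mul_zero, mul_zero]
    · rw [if_neg hN, MvPolynomial.coeff_zero, mul_zero]

end Independence

namespace BTree

/-- the list of colors of a bracketing. -/
def letters : BTree → List ℕ
  | leaf c _ => [c]
  | br a b => a.letters ++ b.letters

lemma chain_cons (i s : ℕ) (w ss : List ℕ) :
    chain (i :: w) (s :: ss) = (w.zip ss).foldl (fun acc p => br acc (leaf p.1 p.2)) (leaf i s) :=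
  rfl

lemma deg_foldl (l : List (ℕ × ℕ)) (T : BTree) :
    (l.foldl (fun acc p => br acc (leaf p.1 p.2)) T).deg = T.deg + (l.map Prod.snd).sum := by
  induction l generalizing T with
  | nil => rfl
  | cons p l ih => simp only [List.foldl_cons, ih, deg, List.map_cons, List.sum_cons, add_assoc]

lemma letters_foldl (l : List (ℕ × ℕ)) (T : BTree) :
    (l.foldl (fun acc p => br acc (leaf p.1 p.2)) T).letters = T.letters ++ l.map Prod.fst := by
  induction l generalizing T with
  | nil => simp
  | cons p l ih => simp [ih, letters]

variable {L : Type*} [LieRing L]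

/-- the left-normed bracket of the elements `y (w 0), …, y (w k)`. -/
def chainFam (y : ℕ → L) (w : ℕ → ℕ) : ℕ → L
  | 0 => y (w 0)
  | k + 1 => ⁅chainFam y w k, y (w (k + 1))⁆

lemma foldl_chainFam (y : ℕ → L) (w : ℕ → ℕ) (k : ℕ) : ∀ j : ℕ,
    ((List.range k).map fun q => w (j + 1 + q)).foldl (fun acc c => ⁅acc, y c⁆)
      (chainFam y w j) = chainFam y w (j + k) := by
  induction k with
  | zero => intro j; rfl
  | succ k ih =>
    intro j
    rw [List.range_succ_eq_map, List.map_cons, List.foldl_cons, List.map_map]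
    have := ih (j + 1)
    rw [chainFam] at this
    rw [show j + (k + 1) = j + 1 + k by omega, ← this]
    congr 1
    refine List.map_congr_left fun q _ => ?_
    simp only [Function.comp_apply]
    congr 1
    omega

lemma IsChain.deg {w : List ℕ} {s : ℕ} {T : BTree} (h : T.IsChain w s) : T.deg = s := by
  obtain ⟨ss, h1, rfl, rfl⟩ := h
  rcases w with _ | ⟨i, w⟩
  · rw [List.length_nil, List.length_eq_zero_iff] at h1
    subst h1
    rfl
  · rcases ss with _ | ⟨s, ss⟩
    · simp at h1
    · simp only [List.length_cons, Nat.add_right_cancel_iff] at h1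
      rw [chain_cons, deg_foldl, List.map_snd_zip h1.le, List.sum_cons]
      rfl

lemma IsChain.letters {w : List ℕ} {s : ℕ} {T : BTree} (h : T.IsChain w s) (hw : w ≠ []) :
    T.letters = w := by
  obtain ⟨ss, h1, rfl, rfl⟩ := h
  rcases w with _ | ⟨i, w⟩
  · exact absurd rfl hw
  · rcases ss with _ | ⟨s, ss⟩
    · simp at h1
    · simp only [List.length_cons, Nat.add_right_cancel_iff] at h1
      rw [chain_cons, letters_foldl, List.map_fst_zip h1.ge]
      rfl

lemma IsChain.eval {w : ℕ → ℕ} {k s : ℕ} {T : BTree}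
    (h : T.IsChain ((List.range (k + 1)).map w) s) (y : ℕ → L) :
    T.eval (fun c _ => y c) = chainFam y w k := by
  obtain ⟨ss, h1, -, rfl⟩ := h
  rcases ss with _ | ⟨s, ss⟩
  · simp at h1
  rw [List.range_succ_eq_map, List.map_cons, List.map_map] at h1 ⊢
  simp only [List.length_cons, Nat.add_right_cancel_iff] at h1
  have hf : ∀ (l : List (ℕ × ℕ)) (T : BTree),
      (l.foldl (fun acc p => br acc (leaf p.1 p.2)) T).eval (fun c _ => y c) =
        (l.map Prod.fst).foldl (fun acc c => ⁅acc, y c⁆) (T.eval fun c _ => y c) := by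
    intro l
    induction l with
    | nil => intro T; rfl
    | cons p l ih => intro T; simp only [List.foldl_cons, List.map_cons, ih, BTree.eval]
  rw [chain_cons, hf, List.map_fst_zip h1.ge]
  have := foldl_chainFam y w k 0
  rw [Nat.zero_add k] at this
  rw [← this]
  congr 1
  refine List.map_congr_left fun q _ => ?_
  simp only [Function.comp_apply]
  congr 1
  omega

end BTree

section Flag
attribute [local instance] LieRing.ofAssociativeRing
open BTree

variable {V : Type*} [AddCommGroup V] [Module ℚ V] {y : ℕ → Module.End ℚ V} {δ : ℕ → V}
  {col : ℕ → ℕ} {ω : ℕ → ℚ} {N : ℕ}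

/-- the operators `y c` lower the family `δ 0, …, δ N`. -/
structure IsFlag (y : ℕ → Module.End ℚ V) (δ : ℕ → V) (col : ℕ → ℕ) (ω : ℕ → ℚ) (N : ℕ) :
    Prop where
  step : ∀ q < N, y (col q) (δ (q + 1)) = ω q • δ q
  kill : ∀ q < N, ∀ c, col q ≠ c → y c (δ (q + 1)) = 0
  ne_zero : ∀ q < N, ω q ≠ 0

lemma IsFlag.apply (h : IsFlag y δ col ω N) (c q : ℕ) (hq : q < N) :
    ∃ r : ℚ, y c (δ (q + 1)) = r • δ q := by
  by_cases hc : col q = c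
  · exact ⟨ω q, hc ▸ h.step q hq⟩
  · exact ⟨0, by rw [h.kill q hq c hc, zero_smul]⟩

lemma IsFlag.chainFam_apply (h : IsFlag y δ col ω N) (w : ℕ → ℕ) (k : ℕ) :
    ∀ a, a + k < N → ∃ r : ℚ, chainFam y w k (δ (a + k + 1)) = r • δ a := by
  induction k with
  | zero => intro a ha; exact h.apply _ _ ha
  | succ k ih =>
    intro a ha
    obtain ⟨r₁, h₁⟩ := h.apply (w (k + 1)) (a + k + 1) (by omega)
    obtain ⟨r₂, h₂⟩ := ih a (by omega)
    obtain ⟨r₃, h₃⟩ := ih (a + 1) (by omega)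
    obtain ⟨r₄, h₄⟩ := h.apply (w (k + 1)) a (by omega)
    refine ⟨r₁ * r₂ - r₃ * r₄, ?_⟩
    rw [chainFam, Ring.lie_def, LinearMap.sub_apply, Module.End.mul_apply, Module.End.mul_apply,
      show a + (k + 1) + 1 = a + k + 1 + 1 by omega, h₁, map_smul, h₂,
      show a + k + 1 + 1 = a + 1 + k + 1 by omega, h₃, map_smul, h₄, smul_smul, smul_smul,
      ← sub_smul]

lemma IsFlag.chainFam_eq_zero {v : V} (w : ℕ → ℕ) {k : ℕ} (hv : ∀ j ≤ k, y (w j) v = 0) :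
    chainFam y w k v = 0 := by
  induction k with
  | zero => exact hv 0 le_rfl
  | succ k ih =>
    rw [chainFam, Ring.lie_def, LinearMap.sub_apply, Module.End.mul_apply, Module.End.mul_apply,
      hv _ le_rfl, ih fun j hj => hv j (by omega), map_zero, map_zero, sub_zero]

/-- a chain removes the boxes `0, …, k`, the first box having a unique color. -/
lemma IsFlag.chainFam_bottom (h : IsFlag y δ col ω N) {k : ℕ} (hk : k < N)
    (hcol : ∀ j, 1 ≤ j → j ≤ k → col 0 ≠ col j) :
    ∃ r : ℚ, r ≠ 0 ∧ chainFam y col k (δ (k + 1)) = r • δ 0 := by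
  induction k with
  | zero => exact ⟨_, h.ne_zero 0 hk, h.step 0 hk⟩
  | succ k ih =>
    obtain ⟨r, hr, e⟩ := ih (by omega) fun j h1 h2 => hcol j h1 (by omega)
    obtain ⟨r', e'⟩ := h.chainFam_apply col k 1 (by omega)
    refine ⟨ω (k + 1) * r, mul_ne_zero (h.ne_zero _ hk) hr, ?_⟩
    rw [chainFam, Ring.lie_def, LinearMap.sub_apply, Module.End.mul_apply, Module.End.mul_apply,
      h.step _ hk, map_smul, e, show k + 1 + 1 = 1 + k + 1 by omega, e', map_smul,
      h.kill 0 (by omega) _ (hcol (k + 1) (by omega) le_rfl), smul_zero, sub_zero, smul_smul]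

/-- a chain removes the top boxes in the same order. -/
lemma IsFlag.chainFam_top (h : IsFlag y δ col ω N) {a k : ℕ} (hk : a + k < N) (w : ℕ → ℕ)
    (hw : ∀ j ≤ k, col (a + k - j) = w j) (hcol : ∀ j, 1 ≤ j → j ≤ k → col (a + k) ≠ w j) :
    ∀ j ≤ k, ∃ r : ℚ, r ≠ 0 ∧ chainFam y w j (δ (a + k + 1)) = r • δ (a + k - j) := by
  intro j
  induction j with
  | zero =>
    intro _
    refine ⟨_, h.ne_zero _ hk, ?_⟩
    rw [chainFam, ← hw 0 (by omega)]
    exact h.step _ hk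
  | succ j ih =>
    intro hj
    obtain ⟨r, hr, e⟩ := ih (by omega)
    refine ⟨-(r * ω (a + k - (j + 1))), neg_ne_zero.2 (mul_ne_zero hr (h.ne_zero _ (by omega))), ?_⟩
    rw [chainFam, Ring.lie_def, LinearMap.sub_apply, Module.End.mul_apply, Module.End.mul_apply,
      h.kill _ hk _ (hcol (j + 1) (by omega) hj), e, map_smul, map_zero, zero_sub,
      show a + k - j = a + k - (j + 1) + 1 by omega, ← hw (j + 1) hj, h.step _ (by omega),
      smul_smul, neg_smul]

/-- the bracket `[A, [A, x]]` of chains removes all boxes of a symmetric flag. -/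
lemma IsFlag.lie_lie_chainFam {k : ℕ} (h : IsFlag y δ col ω (2 * k + 3))
    (hsymm : ∀ j ≤ k, col (2 * k + 2 - j) = col j)
    (hinj : ∀ j, 1 ≤ j → j ≤ k + 1 → col 0 ≠ col j) (hmid : ∀ j ≤ k, col j ≠ col (k + 1)) :
    ∃ r : ℚ, r ≠ 0 ∧ ⁅chainFam y col k, chainFam y col (k + 1)⁆ (δ (2 * k + 3)) = r • δ 0 := by
  obtain ⟨r₁, hr₁, e₁⟩ := h.chainFam_top (a := k + 2) (k := k) (by omega) col
    (fun j hj => by rw [show k + 2 + k - j = 2 * k + 2 - j by omega, hsymm j hj])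
    (fun j h1 h2 => by
      rw [show k + 2 + k = 2 * k + 2 - 0 by omega, hsymm 0 (by omega)]
      exact hinj j h1 (by omega)) k le_rfl
  obtain ⟨r₂, hr₂, e₂⟩ := h.chainFam_bottom (k := k) (by omega)
    fun j h1 h2 => hinj j h1 (by omega)
  have h3 : chainFam y col k (δ (k + 2)) = 0 := by
    apply IsFlag.chainFam_eq_zero
    intro j hj
    exact h.kill (k + 1) (by omega) _ (hmid j hj).symm
  have h4 : y (col (k + 1)) (δ (2 * k + 3)) = 0 := by
    refine h.kill (2 * k + 2) (by omega) _ ?_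
    rw [show 2 * k + 2 = 2 * k + 2 - 0 by omega, hsymm 0 (by omega)]
    exact hinj (k + 1) (by omega) le_rfl
  rw [show k + 2 + k + 1 = 2 * k + 3 by omega, show k + 2 + k - k = k + 2 by omega] at e₁
  refine ⟨-2 * (r₁ * ω (k + 1) * r₂), ?_, ?_⟩
  · exact mul_ne_zero (by norm_num) (mul_ne_zero (mul_ne_zero hr₁ (h.ne_zero _ (by omega))) hr₂)
  · rw [chainFam]
    simp only [Ring.lie_def, LinearMap.sub_apply, Module.End.mul_apply, h4, e₁, map_smul,
      map_zero, map_neg, h3, h.step (k + 1) (by omega), e₂, zero_sub, sub_zero]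
    module

end Flag

section SlotFlag
attribute [local instance] LieRing.ofAssociativeRing

namespace Slot
variable {S : Slot}

/-- the indicator function of a set of boxes. -/
def ind (R : Finset ℕ) : Finset ℕ → ℚ := fun s => if s = R then 1 else 0

lemma full_eq_ind : S.full = ind (Finset.range S.len) := rfl

/-- the removal of the box `p` with weight `ω`. -/
def rm (p : ℕ) (ω : ℕ → ℚ) : Module.End ℚ (Finset ℕ → ℚ) where
  toFun ψ s := if p ∈ s then 0 else (∏ q ∈ s, ω q) * ψ (insert p s)
  map_add' ψ ψ' := by
    funext s
    simp only [Pi.add_apply]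
    split_ifs <;> ring
  map_smul' a ψ := by
    funext s
    simp only [Pi.smul_apply, smul_eq_mul, RingHom.id_apply]
    split_ifs <;> ring

lemma rm_apply (p : ℕ) (ω : ℕ → ℚ) (ψ : Finset ℕ → ℚ) (s : Finset ℕ) :
    rm p ω ψ s = if p ∈ s then 0 else (∏ q ∈ s, ω q) * ψ (insert p s) := rfl

lemma rm_ind (p : ℕ) (ω : ℕ → ℚ) (R : Finset ℕ) :
    rm p ω (ind R) = if p ∈ R then (∏ q ∈ R.erase p, ω q) • ind (R.erase p) else 0 := by
  funext s
  rw [rm_apply]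
  by_cases hR : p ∈ R
  · rw [if_pos hR, Pi.smul_apply, smul_eq_mul, ind, ind]
    by_cases hs : p ∈ s
    · rw [if_pos hs, if_neg, mul_zero]
      rintro rfl
      simp at hs
    · rw [if_neg hs]
      by_cases h : s = R.erase p
      · subst h
        rw [if_pos rfl, if_pos (Finset.insert_erase hR)]
      · rw [if_neg h, if_neg, mul_zero, mul_zero]
        rintro rfl
        exact h (Finset.erase_insert hs).symm
  · rw [if_neg hR, Pi.zero_apply, ind]
    split_ifs with h1 h2
    · rfl
    · exact absurd (h2 ▸ Finset.mem_insert_self p s) hR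
    · rw [mul_zero]

lemma op_eq_sum (S : Slot) (c : ℕ) :
    S.op c = ∑ p ∈ (Finset.range S.len).filter (S.col · = c), rm p (S.wt p) := by
  refine LinearMap.ext fun ψ => funext fun s => ?_
  rw [op_apply, LinearMap.sum_apply, Finset.sum_apply, Finset.sum_filter]
  refine Finset.sum_congr rfl fun p _ => ?_
  rw [one_mul, rm_apply]

lemma rm_comm (φ : ℕ → ℕ → ℚ) (p q : ℕ) :
    Commute (rm p (φ p)) (rm q fun b => φ b q) := by
  refine LinearMap.ext fun ψ => funext fun s => ?_
  rw [Module.End.mul_apply, Module.End.mul_apply, rm_apply, rm_apply, rm_apply, rm_apply]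
  by_cases hp : p ∈ s
  · simp [hp]
  by_cases hq : q ∈ s
  · simp [hq]
  by_cases hpq : p = q
  · subst hpq
    simp
  rw [if_neg hp, if_neg hq, if_neg (by simp [hq, Ne.symm hpq]), if_neg (by simp [hp, hpq]),
    Finset.prod_insert hp, Finset.prod_insert hq, Finset.insert_comm]
  ring

lemma commute_op (S : Slot) (c q : ℕ) : Commute (S.op c) (rm q fun b => S.wt b q) := by
  rw [op_eq_sum]
  exact Commute.sum_left _ _ _ fun p _ => rm_comm S.wt p q

lemma commute_chainFam (S : Slot) (w : ℕ → ℕ) (k q : ℕ) :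
    Commute (BTree.chainFam S.op w k) (rm q fun b => S.wt b q) := by
  induction k with
  | zero => exact S.commute_op _ _
  | succ k ih =>
    rw [BTree.chainFam, Ring.lie_def]
    exact (ih.mul_left (S.commute_op _ _)).sub_left ((S.commute_op _ _).mul_left ih)

lemma chainFam_succ_apply (S : Slot) (w : ℕ → ℕ) (k : ℕ) (R : Finset ℕ) :
    BTree.chainFam S.op w (k + 1) (ind R) ∅ =
      ∑ p ∈ (Finset.range S.len).filter (S.col · = w (k + 1)), if p ∈ R then
        ((∏ b ∈ R.erase p, S.wt p b) - ∏ b ∈ R.erase p, S.wt b p) *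
          BTree.chainFam S.op w k (ind (R.erase p)) ∅ else 0 := by
  rw [BTree.chainFam, Ring.lie_def, LinearMap.sub_apply, Module.End.mul_apply,
    Module.End.mul_apply, Pi.sub_apply, op_eq_sum, LinearMap.sum_apply, LinearMap.sum_apply,
    map_sum, Finset.sum_apply, Finset.sum_apply, ← Finset.sum_sub_distrib]
  refine Finset.sum_congr rfl fun p _ => ?_
  have h1 : rm p (S.wt p) (BTree.chainFam S.op w k (ind R)) ∅ =
      rm p (fun b => S.wt b p) (BTree.chainFam S.op w k (ind R)) ∅ := by
    rw [rm_apply, rm_apply, Finset.prod_empty, Finset.prod_empty]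
  have h2 := LinearMap.congr_fun (S.commute_chainFam w k p).eq (ind R)
  rw [Module.End.mul_apply, Module.End.mul_apply] at h2
  rw [h1, ← h2, rm_ind, rm_ind]
  split_ifs
  · rw [map_smul, map_smul, Pi.smul_apply, Pi.smul_apply, smul_eq_mul, smul_eq_mul, sub_mul]
  · rw [map_zero, Pi.zero_apply, sub_zero]

lemma range_succ_erase (k : ℕ) : (Finset.range (k + 1)).erase k = Finset.range k := by
  rw [Finset.range_add_one, Finset.erase_insert (by simp)]

theorem chainFam_ne_zero (S : Slot)
    (h1 : ∀ k, 1 ≤ k → k < S.len →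
      ∏ b ∈ Finset.range k, S.wt k b ≠ ∏ b ∈ Finset.range k, S.wt b k)
    (h2 : ∀ k < S.len, ∀ p < k, S.col p = S.col k →
      (∃ b ≤ k, b ≠ p ∧ S.wt p b = 0) ∧ ∃ b ≤ k, b ≠ p ∧ S.wt b p = 0) (k : ℕ) :
    k < S.len → BTree.chainFam S.op S.col k (ind (Finset.range (k + 1))) ∅ ≠ 0 := by
  induction k with
  | zero =>
    intro h
    rw [BTree.chainFam, op_eq_sum, LinearMap.sum_apply, Finset.sum_apply,
      Finset.sum_eq_single_of_mem 0 (by simp [h])]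
    · rw [rm_ind, if_pos (by simp)]
      simp [ind]
    · intro p _ hp
      rw [rm_ind, if_neg (by simp [hp])]
      rfl
  | succ k ih =>
    intro h
    rw [chainFam_succ_apply, Finset.sum_eq_single_of_mem (k + 1) (by simp [h])]
    · rw [if_pos (by simp), range_succ_erase]
      exact mul_ne_zero (sub_ne_zero.2 (h1 _ (by omega) h)) (ih (by omega))
    · intro p hp hpk
      rw [Finset.mem_filter] at hp
      by_cases hpR : p ∈ Finset.range (k + 1 + 1)
      · obtain ⟨⟨b, hb, hbp, hb0⟩, b', hb', hbp', hb0'⟩ :=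
          h2 (k + 1) h p (by rw [Finset.mem_range] at hpR; omega) hp.2
        rw [if_pos hpR, Finset.prod_eq_zero (i := b) (by simp; omega) hb0,
          Finset.prod_eq_zero (i := b') (by simp; omega) hb0', sub_zero, zero_mul]
      · rw [if_neg hpR]

lemma isFlag (S : Slot) (h0 : ∀ p, p + 1 < S.len → S.wt p (p + 1) = 0)
    (h1 : ∀ q < S.len, ∀ b < q, S.wt q b ≠ 0) :
    IsFlag S.op (fun q => ind (Finset.range q)) S.col
      (fun q => ∏ b ∈ Finset.range q, S.wt q b) S.len := by
  have key : ∀ q < S.len, ∀ p ∈ Finset.range S.len, p ≠ q →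
      rm p (S.wt p) (ind (Finset.range (q + 1))) = 0 := by
    intro q hq p _ hpq
    rw [rm_ind]
    split_ifs with h
    · rw [Finset.mem_range] at h
      rw [Finset.prod_eq_zero (i := p + 1) (by simp; omega) (h0 p (by omega)), zero_smul]
    · rfl
  refine ⟨fun q hq => ?_, fun q hq c hc => ?_, fun q hq => ?_⟩
  · rw [op_eq_sum, LinearMap.sum_apply, Finset.sum_eq_single_of_mem q (by simp [hq]), rm_ind,
      if_pos (by simp), range_succ_erase]
    exact fun p hp hpq => key q hq p (Finset.mem_filter.1 hp).1 hpq
  · rw [op_eq_sum, LinearMap.sum_apply]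
    refine Finset.sum_eq_zero fun p hp => ?_
    rw [Finset.mem_filter] at hp
    refine key q hq p hp.1 ?_
    rintro rfl
    exact hc hp.2
  · exact Finset.prod_ne_zero_iff.2 fun b hb => h1 q hq b (Finset.mem_range.1 hb)

lemma exists_of_act_ne_zero (T : BTree) : ∀ (ψ : Finset ℕ → ℚ) (t : Finset ℕ),
    S.act T ψ t ≠ 0 → ∃ t', ψ t' ≠ 0 ∧ t'.val.map S.col = ↑T.letters + t.val.map S.col := by
  induction T with
  | leaf c r =>
    intro ψ t h
    rw [act, BTree.eval, op_apply] at h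
    obtain ⟨p, -, hp⟩ := Finset.exists_ne_zero_of_sum_ne_zero h
    split_ifs at hp with h1 h2
    · simp at hp
    · rw [one_mul] at hp
      refine ⟨insert p t, right_ne_zero_of_mul hp, ?_⟩
      rw [Finset.insert_val_of_notMem h2, Multiset.map_cons, h1, BTree.letters,
        Multiset.coe_singleton, Multiset.singleton_add]
    · exact absurd rfl hp
  | br a b iha ihb =>
    intro ψ t h
    rw [act, BTree.eval, Ring.lie_def, LinearMap.sub_apply, Pi.sub_apply] at h
    rw [BTree.letters, ← Multiset.coe_add]
    by_cases h1 : S.act a (S.act b ψ) t = 0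
    · have h2 : S.act b (S.act a ψ) t ≠ 0 := by
        intro h2
        refine h ?_
        change S.act a (S.act b ψ) t - S.act b (S.act a ψ) t = 0
        rw [h1, h2, sub_zero]
      obtain ⟨t₁, h3, h4⟩ := ihb _ _ h2
      obtain ⟨t₂, h5, h6⟩ := iha _ _ h3
      exact ⟨t₂, h5, by rw [h6, h4, add_assoc]⟩
    · obtain ⟨t₁, h3, h4⟩ := iha _ _ h1
      obtain ⟨t₂, h5, h6⟩ := ihb _ _ h3
      exact ⟨t₂, h5, by rw [h6, h4, add_left_comm, add_assoc]⟩

lemma act_full_eq_zero (T : BTree) (h : ¬ ((List.range S.len).map S.col).Perm T.letters) :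
    S.act T S.full ∅ = 0 := by
  by_contra h0
  obtain ⟨t, h1, h2⟩ := exists_of_act_ne_zero T _ _ h0
  rw [full] at h1
  split_ifs at h1 with h3
  · subst h3
    rw [Finset.empty_val, Multiset.map_zero, add_zero] at h2
    exact h (Multiset.coe_eq_coe.1 h2)
  · exact h1 rfl

/-- the slot with the standard weights. -/
def std (A : ℕ → ℕ → ℤ) (Dd : ℕ → ℕ) (len : ℕ) (col : ℕ → ℕ) (pos : ℕ → ℚ) : Slot where
  len := len
  col := col
  pos := pos
  wt p q := if p = q then 0 else if A (col p) (col q) = 0 then 1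
    else if q < p then pos p - pos q - (Dd (col p) : ℚ) * A (col p) (col q) / 2
    else -(pos p - pos q - (Dd (col p) : ℚ) * A (col p) (col q) / 2)

lemma good_std {n : ℕ} {A : ℕ → ℕ → ℤ} {Dd : ℕ → ℕ}
    (hs : ∀ i j, 1 ≤ i → i ≤ n → 1 ≤ j → j ≤ n → (Dd i : ℤ) * A i j = (Dd j : ℤ) * A j i)
    (hD : ∀ i, Dd i ≠ 0) {len : ℕ} {col : ℕ → ℕ} {pos : ℕ → ℚ}
    (h1 : ∀ p < len, 1 ≤ col p) (h2 : ∀ p < len, col p ≤ n) :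
    (std A Dd len col pos).Good n A Dd := by
  have hz : ∀ p < len, ∀ q < len, A (col p) (col q) = 0 → A (col q) (col p) = 0 := by
    intro p hp q hq h
    have := hs _ _ (h1 p hp) (h2 p hp) (h1 q hq) (h2 q hq)
    rw [h, mul_zero] at this
    exact (mul_eq_zero.1 this.symm).resolve_left (by exact_mod_cast hD _)
  refine ⟨h1, h2, fun p => if_pos rfl, ?_, ?_⟩
  · intro p hp q hq
    simp only [std] at hp hq ⊢
    by_cases hpq : p = q
    · rw [if_pos hpq, if_pos hpq.symm, mul_zero, mul_zero]
    have hs' : (Dd (col p) : ℚ) * A (col p) (col q) = (Dd (col q) : ℚ) * A (col q) (col p) := by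
      exact_mod_cast hs _ _ (h1 p hp) (h2 p hp) (h1 q hq) (h2 q hq)
    rw [if_neg hpq, if_neg (Ne.symm hpq)]
    by_cases ha : A (col p) (col q) = 0
    · rw [if_pos ha, if_pos (hz p hp q hq ha), ha]
      simp
    · rw [if_neg ha, if_neg (fun h => ha (hz q hq p hp h)), ← hs']
      obtain h | h := Nat.lt_or_gt_of_ne hpq
      · rw [if_neg (by omega), if_pos h]
        ring
      · rw [if_pos h, if_neg (by omega)]
        ring
  · intro p hp q hq hc ha
    simp only [std] at hp hq hc ha ⊢
    rw [if_neg (fun h : p = q => hc (congrArg col h)),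
      if_neg (fun h : q = p => hc (congrArg col h.symm)), if_pos ha, if_pos (hz p hp q hq ha)]

variable {A : ℕ → ℕ → ℤ} {Dd : ℕ → ℕ} {len : ℕ} {col : ℕ → ℕ} {pos : ℕ → ℚ}

lemma std_wt_lt {p q : ℕ} (h : q < p) : (std A Dd len col pos).wt p q =
    if A (col p) (col q) = 0 then 1
    else pos p - pos q - (Dd (col p) : ℚ) * A (col p) (col q) / 2 := by
  simp only [std]
  rw [if_neg (by omega), if_pos h]

lemma std_wt_gt {p q : ℕ} (h : p < q) : (std A Dd len col pos).wt p q =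
    if A (col p) (col q) = 0 then 1
    else -(pos p - pos q - (Dd (col p) : ℚ) * A (col p) (col q) / 2) := by
  simp only [std]
  rw [if_neg (by omega), if_neg (by omega : ¬ q < p)]

end Slot

end SlotFlag

section SlotC
attribute [local instance] LieRing.ofAssociativeRing
open BTree

/-- positions of the boxes in type `C`. -/
def posC (m p : ℕ) : ℚ := if p < m then p / 2 else if p = m then (p + 1) / 2 else (p + 2) / 2

lemma posC_cases (m p : ℕ) : (p < m ∧ posC m p = p / 2) ∨ (p = m ∧ posC m p = (p + 1) / 2) ∨
    (m < p ∧ posC m p = (p + 2) / 2) := by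
  unfold posC
  split_ifs with h1 h2
  · exact Or.inl ⟨h1, rfl⟩
  · exact Or.inr (Or.inl ⟨h2, rfl⟩)
  · exact Or.inr (Or.inr ⟨by omega, rfl⟩)

lemma posC_lt {m p q : ℕ} (h : q < p) : posC m q < posC m p := by
  have h' : (q : ℚ) < p := by exact_mod_cast h
  rcases posC_cases m p with ⟨h1, e1⟩ | ⟨h1, e1⟩ | ⟨h1, e1⟩ <;>
  rcases posC_cases m q with ⟨h2, e2⟩ | ⟨h2, e2⟩ | ⟨h2, e2⟩ <;>
  first | omega | (rw [e1, e2]; linarith)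

lemma aC_symm (n i j : ℕ) (hi : i ≤ n) (hj : j ≤ n) :
    (dC n i : ℤ) * aC n i j = (dC n j : ℤ) * aC n j i := by
  have h1 := aC_cases n i j
  have h2 := aC_cases n j i
  unfold dC
  split_ifs <;> push_cast <;> omega

/-- the slot of `k` boxes with colors `i, …, n-1, n, n-1, …, i`. -/
def slotC (n i k : ℕ) : Slot := Slot.std (aC n) (dC n) k (colC n i) (posC (n - i))

lemma dC_ne_zero (n i : ℕ) : dC n i ≠ 0 := by
  unfold dC
  split_ifs <;> omega

lemma slotC_good {n i k : ℕ} (h1 : 1 ≤ i) (hi : i ≤ n) (hk : k ≤ 2 * (n - i) + 1) :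
    (slotC n i k).Good n (aC n) (dC n) := by
  refine Slot.good_std (fun i j _ h1 _ h2 => aC_symm n i j h1 h2) (dC_ne_zero n) ?_ ?_ <;>
  · intro p hp
    unfold colC
    split_ifs <;> omega

lemma slotC_wt_succ {n i k p : ℕ} (hk : k ≤ 2 * (n - i) + 1) (hp : p + 1 < k) :
    (slotC n i k).wt p (p + 1) = 0 := by
  obtain ⟨m, rfl⟩ : ∃ m, n = i + m := ⟨n - i, by omega⟩
  rw [slotC, Slot.std_wt_gt (by omega), show i + m - i = m by omega]
  rcases Nat.lt_trichotomy (p + 1) m with h | h | h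
  · have e1 : aC (i + m) (colC (i + m) i p) (colC (i + m) i (p + 1)) = -1 := by
      have := aC_cases (i + m) (colC (i + m) i p) (colC (i + m) i (p + 1))
      unfold colC at *
      split_ifs at * <;> omega
    have e2 : dC (i + m) (colC (i + m) i p) = 1 := by
      unfold dC colC
      split_ifs <;> omega
    rw [e1, e2, if_neg (by norm_num), posC, posC, if_pos (by omega), if_pos h]
    push_cast
    norm_num
    ring
  · have e1 : aC (i + m) (colC (i + m) i p) (colC (i + m) i (p + 1)) = -2 := by
      have := aC_cases (i + m) (colC (i + m) i p) (colC (i + m) i (p + 1))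
      unfold colC at *
      split_ifs at * <;> omega
    have e2 : dC (i + m) (colC (i + m) i p) = 1 := by
      unfold dC colC
      split_ifs <;> omega
    rw [e1, e2, if_neg (by norm_num), posC, posC, if_pos (by omega), if_neg (by omega), if_pos h]
    push_cast
    norm_num
    ring
  · have e1 : aC (i + m) (colC (i + m) i p) (colC (i + m) i (p + 1)) = -1 := by
      have := aC_cases (i + m) (colC (i + m) i p) (colC (i + m) i (p + 1))
      unfold colC at *
      split_ifs at * <;> omega
    rcases Nat.lt_or_ge m p with h2 | h2
    · have e2 : dC (i + m) (colC (i + m) i p) = 1 := by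
        unfold dC colC
        split_ifs <;> omega
      rw [e1, e2, if_neg (by norm_num), posC, posC, if_neg (by omega), if_neg (by omega),
        if_neg (by omega),
        if_neg (by omega)]
      push_cast
      norm_num
      ring
    · have e2 : dC (i + m) (colC (i + m) i p) = 2 := by
        unfold dC colC
        split_ifs <;> omega
      rw [e1, e2, if_neg (by norm_num), posC, posC, if_neg (by omega), if_pos (by omega),
        if_neg (by omega),
        if_neg (by omega)]
      push_cast
      norm_num
      ring

lemma slotC_wt_lt {n i k p q : ℕ} (hk : k ≤ 2 * (n - i) + 1) (hp : p < k) (hq : q < p) :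
    (slotC n i k).wt p q ≠ 0 := by
  obtain ⟨m, rfl⟩ : ∃ m, n = i + m := ⟨n - i, by omega⟩
  have hlt := posC_lt (m := m) hq
  rw [slotC, Slot.std_wt_lt hq, show i + m - i = m by omega]
  split_ifs with h0
  · exact one_ne_zero
  rcases lt_or_gt_of_ne h0 with h | h
  · have h' : (aC (i + m) (colC (i + m) i p) (colC (i + m) i q) : ℚ) < 0 := by exact_mod_cast h
    have hd : (0 : ℚ) ≤ dC (i + m) (colC (i + m) i p) := by positivity
    have := mul_nonneg_of_nonpos_of_nonpos (neg_nonpos.2 hd) h'.le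
    intro h2
    linarith
  · have h3 : p + q = 2 * m ∧ q < m ∧ m < p := by
      have := aC_cases (i + m) (colC (i + m) i p) (colC (i + m) i q)
      have : colC (i + m) i p = colC (i + m) i q := by omega
      unfold colC at this
      split_ifs at * <;> omega
    have e1 : aC (i + m) (colC (i + m) i p) (colC (i + m) i q) = 2 := by
      have := aC_cases (i + m) (colC (i + m) i p) (colC (i + m) i q)
      omega
    have e2 : dC (i + m) (colC (i + m) i p) = 1 := by
      unfold dC colC
      split_ifs <;> omega
    rw [e1, e2, posC, posC, if_neg (by omega), if_neg (by omega), if_pos (by omega)]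
    have : (q : ℚ) < p := by exact_mod_cast hq
    push_cast
    intro h4
    linarith

lemma slotC_isFlag {n i k : ℕ} (hk : k ≤ 2 * (n - i) + 1) :
    ∃ ω, IsFlag (slotC n i k).op (fun q => Slot.ind (Finset.range q)) (colC n i) ω k :=
  ⟨_, Slot.isFlag (slotC n i k) (fun _ hp => slotC_wt_succ hk hp)
    fun _ hq _ hb => slotC_wt_lt hk hq hb⟩

end SlotC

section RootSlotC
attribute [local instance] LieRing.ofAssociativeRing
open BTree

variable {n : ℕ}

lemma PosRootC.ext_ri_rt {β γ : PosRootC n} (h1 : ri β = ri γ) (h2 : rt β = rt γ) : β = γ := by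
  refine Subtype.ext (ofLex.injective (Prod.ext (Fin.ext h1) (Fin.ext h2)))

/-- the number of letters of a root. -/
def lenC (β : PosRootC n) : ℕ :=
  if ri β + rt β < n ∨ ri β = n then rt β + 1
  else if ri β + rt β = n then 2 * (n - ri β) + 1 else rt β

lemma PosRootC.bounds (β : PosRootC n) :
    1 ≤ ri β ∧ ri β ≤ n ∧ (ri β = n → rt β = 0) ∧ rt β + 2 * ri β ≤ 2 * n :=
  ⟨β.2.1, Nat.lt_succ_iff.1 (ofLex β.1).1.2, β.2.2.1, β.2.2.2⟩

lemma lenC_bounds (β : PosRootC n) : 1 ≤ lenC β ∧ lenC β ≤ 2 * (n - ri β) + 1 := by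
  have := β.bounds
  unfold lenC
  split_ifs <;> omega

/-- the slot of a root. -/
def rootSlotC (β : PosRootC n) : Slot := slotC n (ri β) (lenC β)

lemma wordC_eq {β : PosRootC n} (h : ¬ isINI β) :
    ∃ p, lenC β = p + 1 ∧ wordC β = (List.range (p + 1)).map (colC n (ri β)) ∧
      p + 1 ≤ 2 * (n - ri β) + 1 ∧
      ∀ j, 1 ≤ j → j ≤ p → colC n (ri β) 0 ≠ colC n (ri β) j := by
  have hb := β.bounds
  unfold isINI at h
  unfold lenC
  obtain hi | hi := hb.2.1.eq_or_lt
  · refine ⟨0, by rw [if_pos (Or.inr hi), hb.2.2.1 hi], ?_, by omega, fun j h1 h2 => by omega⟩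
    rw [wordC_last β hi, hi]
    simp [colC]
  · have hc : ∀ p, p + 1 ≤ 2 * (n - ri β) → ∀ j, 1 ≤ j → j ≤ p →
        colC n (ri β) 0 ≠ colC n (ri β) j := by
      intro p hp j h1 h2
      have e0 := colC_cases n (ri β) 0
      have e1 := colC_cases n (ri β) j
      omega
    obtain ht | ht := Nat.lt_or_ge (ri β + rt β) n
    · exact ⟨rt β, by rw [if_pos (Or.inl ht)],
        wordC_eq_map hi (by omega) β rfl (Or.inl ⟨ht, rfl⟩), by omega, hc _ (by omega)⟩
    · refine ⟨rt β - 1, ?_, wordC_eq_map hi (by omega) β rfl (Or.inr ⟨by omega, by omega⟩),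
        by omega, hc _ (by omega)⟩
      rw [if_neg (by omega), if_neg (by omega)]
      omega

lemma range_map_colC_perm {i m : ℕ} (h : i + m = n) :
    ((List.range (2 * m + 1)).map (colC n i)).Perm
      ((List.range m).map (colC n i) ++ (List.range (m + 1)).map (colC n i)) := by
  have h1 : (List.range m).map (fun j => colC n i (m + 1 + j)) =
      ((List.range m).map (colC n i)).reverse := by
    apply List.ext_getElem
    · simp
    · intro j hj _
      simp only [List.length_map, List.length_range] at hj
      simp only [List.getElem_map, List.getElem_range, List.getElem_reverse, List.length_map,
        List.length_range]
      have e0 := colC_cases n i (m + 1 + j)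
      have e1 := colC_cases n i (m - 1 - j)
      omega
  rw [show 2 * m + 1 = m + 1 + m by omega, List.range_add, List.map_append, List.map_map]
  refine List.perm_append_comm.trans (List.Perm.append_right _ ?_)
  change ((List.range m).map (fun j => colC n i (m + 1 + j))).Perm _
  rw [h1]
  exact List.reverse_perm _

lemma isINI.exists_chains {β : PosRootC n} (h : isINI β) {s : ℕ} {T : BTree}
    (hT : IsRootTreeC β s T) :
    ∃ (k s₁ s₂ : ℕ) (T₁ T₂ : BTree), ri β + (k + 1) = n ∧ lenC β = 2 * k + 3 ∧
      T₁.IsChain ((List.range (k + 1)).map (colC n (ri β))) s₁ ∧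
      T₂.IsChain ((List.range (k + 1 + 1)).map (colC n (ri β))) s₂ ∧ s = s₁ + s₂ ∧
      T = br T₁ T₂ := by
  rw [IsRootTreeC, if_pos h] at hT
  obtain ⟨β₁, β₂, s₁, s₂, T₁, T₂, ⟨h1, h2⟩, ⟨h3, h4⟩, h5, h6, h7, h8⟩ := hT
  obtain ⟨h9, h10⟩ := h
  have hb := β₁.bounds
  refine ⟨rt β₁, s₁, s₂, T₁, T₂, by omega, ?_, ?_, ?_, h7, h8⟩
  · rw [lenC, if_neg (by omega), if_pos h9]
    omega
  · rwa [wordC_eq_map h10 (by omega) β₁ h1 (Or.inl ⟨by omega, rfl⟩)] at h5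
  · rwa [wordC_eq_map (p := rt β₁ + 1) h10 (by omega) β₂ h3 (Or.inr ⟨by omega, by omega⟩)] at h6

lemma IsRootTreeC.deg {β : PosRootC n} {s : ℕ} {T : BTree} (hT : IsRootTreeC β s T) :
    T.deg = s := by
  by_cases h : isINI β
  · obtain ⟨k, s₁, s₂, T₁, T₂, -, -, h1, h2, rfl, rfl⟩ := h.exists_chains hT
    rw [BTree.deg, h1.deg, h2.deg]
  · rw [IsRootTreeC, if_neg h] at hT
    exact IsChain.deg hT

lemma IsRootTreeC.letters {β : PosRootC n} {s : ℕ} {T : BTree} (hT : IsRootTreeC β s T) :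
    ((List.range (lenC β)).map (colC n (ri β))).Perm T.letters := by
  by_cases h : isINI β
  · obtain ⟨k, s₁, s₂, T₁, T₂, h0, h3, h1, h2, rfl, rfl⟩ := h.exists_chains hT
    rw [BTree.letters, h1.letters (by simp), h2.letters (by simp), h3]
    exact range_map_colC_perm h0
  · rw [IsRootTreeC, if_neg h] at hT
    obtain ⟨p, h1, h2, -, -⟩ := wordC_eq h
    rw [h2] at hT
    rw [IsChain.letters hT (by simp), h1]

lemma eq_of_perm_colC {β γ : PosRootC n}
    (h : ((List.range (lenC β)).map (colC n (ri β))).Perm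
      ((List.range (lenC γ)).map (colC n (ri γ)))) : β = γ := by
  have key : ∀ {β γ : PosRootC n}, ((List.range (lenC β)).map (colC n (ri β))).Perm
      ((List.range (lenC γ)).map (colC n (ri γ))) → ri γ ≤ ri β := by
    intro β γ h
    have hβ := β.bounds
    have hγ := γ.bounds
    have h1 := lenC_bounds β
    have h2 := lenC_bounds γ
    have hm : colC n (ri β) 0 ∈ (List.range (lenC γ)).map (colC n (ri γ)) :=
      h.mem_iff.1 (List.mem_map.2 ⟨0, List.mem_range.2 (by omega), rfl⟩)
    obtain ⟨q, hq, e⟩ := List.mem_map.1 hm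
    rw [List.mem_range] at hq
    have e0 := colC_cases n (ri β) 0
    have e1 := colC_cases n (ri γ) q
    omega
  have hi := le_antisymm (key h.symm) (key h)
  have hl := h.length_eq
  have hβ := β.bounds
  have hγ := γ.bounds
  simp only [List.length_map, List.length_range] at hl
  unfold lenC at hl
  refine PosRootC.ext_ri_rt hi ?_
  split_ifs at hl <;> omega

lemma rootSlotC_act_ne {β γ : PosRootC n} {s : ℕ} {T : BTree} (hT : IsRootTreeC γ s T)
    (h : γ ≠ β) : (rootSlotC β).act T (rootSlotC β).full ∅ = 0 := by
  refine Slot.act_full_eq_zero T fun hp => h ?_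
  exact (eq_of_perm_colC (hp.trans hT.letters.symm)).symm

lemma rootSlotC_act (β : PosRootC n) :
    ∃ e : ℚ, e ≠ 0 ∧ ∀ s T, IsRootTreeC β s T →
      (rootSlotC β).act T (rootSlotC β).full ∅ = e := by
  obtain ⟨ω, hω⟩ := slotC_isFlag (lenC_bounds β).2
  have hone : Slot.ind (Finset.range 0) ∅ = 1 := if_pos rfl
  by_cases h : isINI β
  · obtain ⟨k, hk⟩ : ∃ k, ri β + (k + 1) = n := by
      have := β.bounds
      unfold isINI at h
      exact ⟨n - ri β - 1, by omega⟩
    have hlen : lenC β = 2 * k + 3 := by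
      rw [lenC, if_neg (by unfold isINI at h; omega), if_pos h.1]
      omega
    rw [hlen] at hω
    obtain ⟨r, hr, e⟩ := hω.lie_lie_chainFam (k := k)
      (fun j hj => by
        have e0 := colC_cases n (ri β) (2 * k + 2 - j)
        have e1 := colC_cases n (ri β) j
        omega)
      (fun j h1 h2 => by
        have e0 := colC_cases n (ri β) 0
        have e1 := colC_cases n (ri β) j
        omega)
      (fun j hj => by
        have e0 := colC_cases n (ri β) j
        have e1 := colC_cases n (ri β) (k + 1)
        omega)
    refine ⟨r, hr, fun s T hT => ?_⟩
    obtain ⟨k', s₁, s₂, T₁, T₂, h0, -, h1, h2, -, rfl⟩ := h.exists_chains hT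
    obtain rfl : k' = k := by omega
    rw [Slot.act, BTree.eval, h1.eval, h2.eval, Slot.full_eq_ind, rootSlotC, hlen]
    refine (congrFun e ∅).trans ?_
    rw [Pi.smul_apply, hone, smul_eq_mul, mul_one]
  · obtain ⟨p, h1, h2, h3, h4⟩ := wordC_eq h
    rw [h1] at hω
    obtain ⟨r, hr, e⟩ := hω.chainFam_bottom (k := p) (by omega) h4
    refine ⟨r, hr, fun s T hT => ?_⟩
    rw [IsRootTreeC, if_neg h, h2] at hT
    rw [Slot.act, IsChain.eval hT, Slot.full_eq_ind, rootSlotC, h1]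
    refine (congrFun e ∅).trans ?_
    rw [Pi.smul_apply, hone, smul_eq_mul, mul_one]

theorem linearIndependent_ordMonC {T : PosRootC n × ℕ → BTree}
    (hT : ∀ p, IsRootTreeC p.1 p.2 (T p)) :
    LinearIndependent RH fun h : Lex (PosRootC n × ℕ) →₀ ℕ =>
      ordMon (fun p => hbar • (T (ofLex p)).eval (genYC n)) h := by
  choose e he hE using rootSlotC_act (n := n)
  refine linearIndependent_ordMon (fun i => by simp [aC]) (fun i j h => aC_offdiag n i j h)
    (fun i j _ h1 _ h2 => aC_symm n i j h1 h2) (dC_ne_zero n) (fun p => (hT p).deg)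
    rootSlotC (fun b => slotC_good b.bounds.1 b.bounds.2.1 (lenC_bounds b).2)
    (fun b => Nat.one_le_iff_ne_zero.1 (lenC_bounds b).1) he fun b p => ?_
  split_ifs with h
  · subst h
    exact hE _ _ _ (hT p)
  · exact rootSlotC_act_ne (hT p) h

end RootSlotC

section SlotD
attribute [local instance] LieRing.ofAssociativeRing
open BTree

lemma aD_symm (n i j : ℕ) : aD n i j = aD n j i := by
  have h1 := aD_cases (n := n) i j
  have h2 := aD_cases (n := n) j i
  omega

lemma aD_symm' (n i j : ℕ) (_ : 1 ≤ i) (_ : i ≤ n) (_ : 1 ≤ j) (_ : j ≤ n) :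
    (dD n i : ℤ) * aD n i j = (dD n j : ℤ) * aD n j i := by
  rw [aD_symm n i j]
  rfl

lemma dD_ne_zero (n i : ℕ) : dD n i ≠ 0 := one_ne_zero

variable {n k : ℕ} {col : ℕ → ℕ} {pos : ℕ → ℚ}

lemma stdD_wt_lt {p q : ℕ} (h : q < p) {a : ℤ} (ha : aD n (col p) (col q) = a) :
    (Slot.std (aD n) (dD n) k col pos).wt p q = if a = 0 then 1 else pos p - pos q - a / 2 := by
  rw [Slot.std_wt_lt h, ha, dD, Nat.cast_one, one_mul]

lemma stdD_wt_gt {p q : ℕ} (h : p < q) {a : ℤ} (ha : aD n (col p) (col q) = a) :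
    (Slot.std (aD n) (dD n) k col pos).wt p q = if a = 0 then 1 else pos q - pos p + a / 2 := by
  rw [Slot.std_wt_gt h, ha, dD, Nat.cast_one, one_mul]
  split_ifs
  · rfl
  · ring

lemma stdD_wt_eq_zero {p q : ℕ} (h : p < q) (ha : aD n (col p) (col q) = -1)
    (hpos : pos q = pos p + 1 / 2) : (Slot.std (aD n) (dD n) k col pos).wt p q = 0 := by
  rw [stdD_wt_gt h ha, if_neg (by norm_num), hpos]
  push_cast
  ring

lemma stdD_wt_ne_zero {p q : ℕ} (h : q < p) (hpos : pos q ≤ pos p)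
    (h2 : col p = col q → pos q + 2 ≤ pos p) :
    (Slot.std (aD n) (dD n) k col pos).wt p q ≠ 0 := by
  rw [stdD_wt_lt h rfl]
  split_ifs with h0
  · exact one_ne_zero
  rcases aD_cases (n := n) (col p) (col q) with ⟨h3, e⟩ | ⟨-, e⟩ | h3
  · have := h2 h3
    rw [e]
    push_cast
    intro h4
    linarith
  · rw [e]
    push_cast
    intro h4
    linarith
  · exact absurd h3.2.2.2.2.2 h0

/-- positions of the boxes in type `D`. -/
def posD (m p : ℕ) : ℚ := if p ≤ m then p / 2 else if p = m + 1 then m / 2 else (p + 1) / 2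

lemma posD_cases (m p : ℕ) : (p ≤ m ∧ posD m p = p / 2) ∨ (p = m + 1 ∧ posD m p = m / 2) ∨
    (m + 1 < p ∧ posD m p = (p + 1) / 2) := by
  unfold posD
  split_ifs with h1 h2
  · exact Or.inl ⟨h1, rfl⟩
  · exact Or.inr (Or.inl ⟨h2, rfl⟩)
  · exact Or.inr (Or.inr ⟨by omega, rfl⟩)

lemma posD_le {m p q : ℕ} (h : q < p) : posD m q ≤ posD m p := by
  have h' : (q : ℚ) < p := by exact_mod_cast h
  rcases posD_cases m p with ⟨h1, e1⟩ | ⟨h1, e1⟩ | ⟨h1, e1⟩ <;>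
  rcases posD_cases m q with ⟨h2, e2⟩ | ⟨h2, e2⟩ | ⟨h2, e2⟩ <;>
  rw [e1, e2] <;>
  first
  | omega
  | linarith
  | (have : (q : ℚ) ≤ m := by exact_mod_cast h2
     linarith)
  | (have : (m : ℚ) + 1 < p := by exact_mod_cast h1
     linarith)

/-- the slot of `k` boxes with colors `i, …, n-2, n, n-1, n-2, …, i+1`. -/
def slotD (n i k : ℕ) : Slot := Slot.std (aD n) (dD n) k (colD n i) (posD (n - 1 - i))

/-- the slot of `k` boxes with colors `i, i+1, …`. -/
def sideSlotD (n i k : ℕ) : Slot := Slot.std (aD n) (dD n) k (fun p => i + p) (fun p => p / 2)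

lemma slotD_good {n i k : ℕ} (h1 : 1 ≤ i) (hi : i + 2 ≤ n) (hk : k ≤ 2 * (n - 1 - i) + 1) :
    (slotD n i k).Good n (aD n) (dD n) := by
  refine Slot.good_std (aD_symm' n) (dD_ne_zero n) ?_ ?_ <;>
  · intro p hp
    have := colD_cases n i p
    omega

lemma sideSlotD_good {n i k : ℕ} (h1 : 1 ≤ i) (hk : i + k ≤ n + 1) :
    (sideSlotD n i k).Good n (aD n) (dD n) := by
  refine Slot.good_std (aD_symm' n) (dD_ne_zero n) ?_ ?_ <;>
  · intro p hp
    omega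

lemma sideSlotD_chainFam_ne {n i k : ℕ} (hk : i + k ≤ n ∨ k = 1) :
    ∀ p < k, chainFam (sideSlotD n i k).op (fun p => i + p) p
      (Slot.ind (Finset.range (p + 1))) ∅ ≠ 0 := by
  refine Slot.chainFam_ne_zero (sideSlotD n i k) ?_ ?_
  · intro q h1 h2
    change q < k at h2
    rw [Finset.prod_eq_zero (f := fun b => (sideSlotD n i k).wt b q) (i := q - 1)
      (Finset.mem_range.2 (by omega)) ?_]
    · refine Finset.prod_ne_zero_iff.2 fun b hb => ?_
      rw [Finset.mem_range] at hb
      refine stdD_wt_ne_zero hb ?_ fun h => absurd h (by omega)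
      have : (b : ℚ) < q := by exact_mod_cast hb
      linarith
    · refine stdD_wt_eq_zero (by omega) ?_ ?_
      · have := aD_cases (n := n) (i + (q - 1)) (i + q)
        omega
      · obtain ⟨r, rfl⟩ : ∃ r, q = r + 1 := ⟨q - 1, by omega⟩
        rw [Nat.add_sub_cancel]
        push_cast
        ring
  · intro q _ p hp h
    change i + p = i + q at h
    omega

section Main
variable {i m : ℕ}

lemma slotD_wt_pred (hn : i + m + 1 = n) (hm : 1 ≤ m) {p q : ℕ} (hk : k ≤ 2 * m + 1) (hq : q < k)
    (h : p + 1 = q ∧ q ≤ m ∨ q = m + 1 ∧ p + 1 = m ∨ m + 3 ≤ q ∧ p + 1 = q) :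
    (slotD n i k).wt p q = 0 := by
  refine stdD_wt_eq_zero (by omega) ?_ ?_
  · have e0 := colD_cases n i p
    have e1 := colD_cases n i q
    have := aD_cases (n := n) (colD n i p) (colD n i q)
    omega
  · rw [show n - 1 - i = m by omega]
    rcases h with ⟨rfl, h⟩ | ⟨rfl, rfl⟩ | ⟨h, rfl⟩
    · rw [posD, posD, if_pos h, if_pos (by omega)]
      push_cast
      ring
    · rw [posD, posD, if_neg (by omega), if_pos rfl, if_pos (by omega)]
      push_cast
      ring
    · rw [posD, posD, if_neg (by omega), if_neg (by omega), if_neg (by omega), if_neg (by omega)]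
      push_cast
      ring

lemma colD_eq_imp (hn : i + m + 1 = n) {p q : ℕ} (hp : p < q) (hq : q ≤ 2 * m)
    (h : colD n i q = colD n i p) : p + q = 2 * m + 1 ∧ m + 2 ≤ q ∧ 1 ≤ p := by
  have e0 := colD_cases n i p
  have e1 := colD_cases n i q
  omega

lemma slotD_wt_lt (hn : i + m + 1 = n) {p q : ℕ} (hk : k ≤ 2 * m + 1) (hp : p < k) (hq : q < p) :
    (slotD n i k).wt p q ≠ 0 := by
  refine stdD_wt_ne_zero hq (posD_le hq) fun h => ?_
  obtain ⟨h1, h2, -⟩ := colD_eq_imp hn hq (by omega) h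
  rw [show n - 1 - i = m by omega, posD, posD, if_pos (by omega), if_neg (by omega),
    if_neg (by omega)]
  have h3 : (q : ℚ) + p = 2 * m + 1 := by exact_mod_cast (by omega : q + p = 2 * m + 1)
  have h4 : (m : ℚ) + 2 ≤ p := by exact_mod_cast h2
  linarith

lemma slotD_prod_branch (hn : i + (m + 2) + 1 = n) :
    ∏ b ∈ Finset.range (m + 4), (slotD n i k).wt (m + 4) b ≠
      ∏ b ∈ Finset.range (m + 4), (slotD n i k).wt b (m + 4) := by
  have hpos : n - 1 - i = m + 2 := by omega
  have c4 : colD n i (m + 4) = n - 2 := by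
    have := colD_cases n i (m + 4)
    omega
  have c3 : colD n i (m + 3) = n - 1 := by
    have := colD_cases n i (m + 3)
    omega
  have c2 : colD n i (m + 2) = n := by
    have := colD_cases n i (m + 2)
    omega
  have c1 : colD n i (m + 1) = n - 2 := by
    have := colD_cases n i (m + 1)
    omega
  have c0 : colD n i m = n - 3 := by
    have := colD_cases n i m
    omega
  have a3 : aD n (n - 2) (n - 1) = -1 := by
    have := aD_cases (n := n) (n - 2) (n - 1)
    omega
  have a2 : aD n (n - 2) n = -1 := by
    have := aD_cases (n := n) (n - 2) n
    omega
  have a1 : aD n (n - 2) (n - 2) = 2 := by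
    have := aD_cases (n := n) (n - 2) (n - 2)
    omega
  have a0 : aD n (n - 2) (n - 3) = -1 := by
    have := aD_cases (n := n) (n - 2) (n - 3)
    omega
  have hb : ∀ b < m, aD n (n - 2) (colD n i b) = 0 := by
    intro b hb
    have e0 := colD_cases n i b
    have := aD_cases (n := n) (n - 2) (colD n i b)
    omega
  have q4 : posD (m + 2) (m + 4) = (m + 5) / 2 := by
    rw [posD, if_neg (by omega), if_neg (by omega)]
    push_cast
    ring
  have q3 : posD (m + 2) (m + 3) = (m + 2) / 2 := by
    rw [posD, if_neg (by omega), if_pos rfl]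
    push_cast
    ring
  have q2 : posD (m + 2) (m + 2) = (m + 2) / 2 := by
    rw [posD, if_pos le_rfl]
    push_cast
    ring
  have q1 : posD (m + 2) (m + 1) = (m + 1) / 2 := by
    rw [posD, if_pos (by omega)]
    push_cast
    ring
  have q0 : posD (m + 2) m = m / 2 := by
    rw [posD, if_pos (by omega)]
  have hl : ∀ b < m, (slotD n i k).wt (m + 4) b = 1 := by
    intro b h
    rw [slotD, stdD_wt_lt (p := m + 4) (q := b) (a := 0) (by omega) (by rw [c4]; exact hb b h),
      if_pos rfl]
  have hr : ∀ b < m, (slotD n i k).wt b (m + 4) = 1 := by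
    intro b h
    rw [slotD, stdD_wt_gt (p := b) (q := m + 4) (a := 0) (by omega)
      (by rw [c4, aD_symm]; exact hb b h), if_pos rfl]
  rw [Finset.prod_range_succ, Finset.prod_range_succ, Finset.prod_range_succ,
    Finset.prod_range_succ, Finset.prod_eq_one fun b h => hl b (Finset.mem_range.1 h),
    Finset.prod_range_succ, Finset.prod_range_succ, Finset.prod_range_succ,
    Finset.prod_range_succ, Finset.prod_eq_one fun b h => hr b (Finset.mem_range.1 h), slotD,
    stdD_wt_lt (p := m + 4) (q := m) (a := -1) (by omega) (by rw [c4, c0, a0]),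
    stdD_wt_lt (p := m + 4) (q := m + 1) (a := 2) (by omega) (by rw [c4, c1, a1]),
    stdD_wt_lt (p := m + 4) (q := m + 2) (a := -1) (by omega) (by rw [c4, c2, a2]),
    stdD_wt_lt (p := m + 4) (q := m + 3) (a := -1) (by omega) (by rw [c4, c3, a3]),
    stdD_wt_gt (q := m + 4) (p := m) (a := -1) (by omega) (by rw [c4, c0, aD_symm, a0]),
    stdD_wt_gt (q := m + 4) (p := m + 1) (a := 2) (by omega) (by rw [c4, c1, aD_symm, a1]),
    stdD_wt_gt (q := m + 4) (p := m + 2) (a := -1) (by omega) (by rw [c4, c2, aD_symm, a2]),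
    stdD_wt_gt (q := m + 4) (p := m + 3) (a := -1) (by omega) (by rw [c4, c3, aD_symm, a3]),
    hpos, q4, q3, q2, q1, q0]
  norm_num
  ring_nf
  norm_num

lemma slotD_chainFam_ne (hn : i + m + 1 = n) (hm : 1 ≤ m) (hk : k ≤ 2 * m + 1) :
    ∀ p < k, chainFam (slotD n i k).op (colD n i) p (Slot.ind (Finset.range (p + 1))) ∅ ≠ 0 := by
  refine Slot.chainFam_ne_zero (slotD n i k) ?_ ?_
  · intro q h1 h2
    change q < k at h2
    by_cases hq : q = m + 2
    · obtain ⟨r, rfl⟩ : ∃ r, m = r + 2 := ⟨m - 2, by omega⟩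
      rw [hq]
      exact slotD_prod_branch hn
    · obtain ⟨p, hp, h⟩ : ∃ p < q,
          p + 1 = q ∧ q ≤ m ∨ q = m + 1 ∧ p + 1 = m ∨ m + 3 ≤ q ∧ p + 1 = q := by
        by_cases hq1 : q = m + 1
        · exact ⟨m - 1, by omega, by omega⟩
        · exact ⟨q - 1, by omega, by omega⟩
      rw [Finset.prod_eq_zero (f := fun b => (slotD n i k).wt b q) (Finset.mem_range.2 hp)
        (slotD_wt_pred hn hm hk h2 h)]
      exact Finset.prod_ne_zero_iff.2 fun b hb => slotD_wt_lt hn hk h2 (Finset.mem_range.1 hb)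
  · intro q hq p hp h
    change q < k at hq
    obtain ⟨h3, h4, h5⟩ := colD_eq_imp hn hp (by omega) h.symm
    exact ⟨⟨p + 1, by omega, by omega, slotD_wt_pred hn hm hk (by omega) (by omega)⟩,
      p - 1, by omega, by omega, slotD_wt_pred hn hm hk (by omega) (by omega)⟩

end Main

end SlotD

section RootSlotD
attribute [local instance] LieRing.ofAssociativeRing
open BTree

variable {n : ℕ}

lemma PosRootD.ext_riD_rtD {β γ : PosRootD n} (h1 : riD β = riD γ) (h2 : rtD β = rtD γ) :
    β = γ :=
  Subtype.ext (ofLex.injective (Prod.ext (Fin.ext h1) (Fin.ext h2)))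

lemma PosRootD.bounds (β : PosRootD n) :
    1 ≤ riD β ∧ riD β ≤ n ∧ (n - 1 ≤ riD β → rtD β = 0) ∧
      (rtD β = 0 ∨ rtD β + 2 * riD β + 1 ≤ 2 * n) :=
  ⟨β.2.1, Nat.lt_succ_iff.1 (ofLex β.1).1.2, β.2.2.1, β.2.2.2⟩

/-- the roots `[i,n-1]` and `[n]`. -/
def isSideD (β : PosRootD n) : Prop := riD β + rtD β + 1 = n ∨ riD β = n

instance (β : PosRootD n) : Decidable (isSideD β) := by unfold isSideD; infer_instance

/-- the number of letters of a root. -/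
def lenD (β : PosRootD n) : ℕ := if riD β + rtD β < n ∨ riD β = n then rtD β + 1 else rtD β

/-- the letters of a root. -/
def rootColD (β : PosRootD n) : ℕ → ℕ :=
  if isSideD β then fun p => riD β + p else colD n (riD β)

/-- the slot of a root. -/
def rootSlotD (β : PosRootD n) : Slot :=
  if isSideD β then sideSlotD n (riD β) (lenD β) else slotD n (riD β) (lenD β)

lemma isSideD.lenD_eq {β : PosRootD n} (h : isSideD β) :
    lenD β = rtD β + 1 ∧ (riD β + lenD β ≤ n ∨ riD β = n ∧ lenD β = 1) := by
  have hb := β.bounds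
  unfold isSideD at h
  rw [lenD, if_pos (by omega)]
  omega

lemma lenD_of_not_isSideD {β : PosRootD n} (h : ¬ isSideD β) :
    riD β + 2 ≤ n ∧ 1 ≤ lenD β ∧ lenD β ≤ 2 * (n - 1 - riD β) + 1 ∧
      (riD β + rtD β + 2 ≤ n ∧ rtD β + 1 = lenD β ∨ n ≤ riD β + rtD β ∧ rtD β = lenD β) := by
  have hb := β.bounds
  unfold isSideD at h
  have h1 : riD β + 2 ≤ n := by
    by_contra h2
    have := hb.2.2.1 (by omega)
    omega
  unfold lenD
  split_ifs <;> omega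

lemma lenD_pos (β : PosRootD n) : 1 ≤ lenD β := by
  by_cases h : isSideD β
  · have := h.lenD_eq
    omega
  · exact (lenD_of_not_isSideD h).2.1

lemma wordD_eq (β : PosRootD n) : wordD β = (List.range (lenD β)).map (rootColD β) := by
  have hb := β.bounds
  by_cases h : isSideD β
  · rw [rootColD, if_pos h, h.lenD_eq.1]
    by_cases hs : riD β + rtD β + 1 = n
    · exact wordD_side β rfl hs
    · have hi : riD β = n := h.resolve_left hs
      rw [wordD_last β (by omega) rfl, hb.2.2.1 (by omega)]
      rfl
  · obtain ⟨h1, h2, h3, h4⟩ := lenD_of_not_isSideD h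
    obtain ⟨p, hp⟩ : ∃ p, lenD β = p + 1 := ⟨lenD β - 1, by omega⟩
    rw [rootColD, if_neg h, hp]
    exact wordD_eq_map h1 (by omega) β rfl (by omega)

lemma IsRootTreeD.chain {β : PosRootD n} {s : ℕ} {T : BTree} (hT : IsRootTreeD β s T) :
    T.IsChain ((List.range (lenD β)).map (rootColD β)) s := by
  rw [← wordD_eq]
  exact hT

lemma IsRootTreeD.letters {β : PosRootD n} {s : ℕ} {T : BTree} (hT : IsRootTreeD β s T) :
    T.letters = (List.range (lenD β)).map (rootColD β) := by
  refine IsChain.letters hT.chain fun h => ?_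
  have := congrArg List.length h
  have := lenD_pos β
  simp at *
  omega

lemma rootColD_zero_le {β : PosRootD n} {p : ℕ} (hp : p < lenD β) : riD β ≤ rootColD β p := by
  by_cases h : isSideD β
  · rw [rootColD, if_pos h]
    exact Nat.le_add_right _ _
  · have hl := lenD_of_not_isSideD h
    have := colD_cases n (riD β) p
    rw [rootColD, if_neg h]
    omega

lemma rootColD_zero (β : PosRootD n) : rootColD β 0 = riD β := by
  by_cases h : isSideD β
  · rw [rootColD, if_pos h, Nat.add_zero]
  · have hl := lenD_of_not_isSideD h
    have := colD_cases n (riD β) 0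
    rw [rootColD, if_neg h]
    omega

lemma eq_of_perm_rootColD {β γ : PosRootD n}
    (h : ((List.range (lenD β)).map (rootColD β)).Perm
      ((List.range (lenD γ)).map (rootColD γ))) : β = γ := by
  have key : ∀ {β γ : PosRootD n}, ((List.range (lenD β)).map (rootColD β)).Perm
      ((List.range (lenD γ)).map (rootColD γ)) → riD γ ≤ riD β := by
    intro β γ h
    have hm : rootColD β 0 ∈ (List.range (lenD γ)).map (rootColD γ) :=
      h.mem_iff.1 (List.mem_map.2 ⟨0, List.mem_range.2 (lenD_pos β), rfl⟩)
    obtain ⟨q, hq, e⟩ := List.mem_map.1 hm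
    rw [← rootColD_zero β, ← e]
    exact rootColD_zero_le (List.mem_range.1 hq)
  have side : ∀ {β γ : PosRootD n}, ((List.range (lenD β)).map (rootColD β)).Perm
      ((List.range (lenD γ)).map (rootColD γ)) → riD β = riD γ → lenD β = lenD γ →
      isSideD β → rtD β = rtD γ := by
    intro β γ h hi hl hβ
    have h1 := hβ.lenD_eq
    by_cases hγ : isSideD γ
    · have h2 := hγ.lenD_eq
      omega
    · exfalso
      have h2 := lenD_of_not_isSideD hγ
      have h3 : riD γ + (lenD γ - 1) + 1 = n := by
        unfold isSideD at hβ
        omega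
      have hm : rootColD γ (lenD γ - 1) ∈ (List.range (lenD β)).map (rootColD β) :=
        h.mem_iff.2 (List.mem_map.2 ⟨lenD γ - 1, List.mem_range.2 (by omega), rfl⟩)
      obtain ⟨q, hq, e⟩ := List.mem_map.1 hm
      rw [List.mem_range] at hq
      have := colD_cases n (riD γ) (lenD γ - 1)
      rw [rootColD, rootColD, if_pos hβ, if_neg hγ] at e
      omega
  have hi := le_antisymm (key h.symm) (key h)
  have hl : lenD β = lenD γ := by simpa using h.length_eq
  refine PosRootD.ext_riD_rtD hi ?_
  by_cases hβ : isSideD β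
  · exact side h hi hl hβ
  by_cases hγ : isSideD γ
  · exact (side h.symm hi.symm hl.symm hγ).symm
  have h1 := lenD_of_not_isSideD hβ
  have h2 := lenD_of_not_isSideD hγ
  omega

lemma rootSlotD_len_col (β : PosRootD n) :
    (rootSlotD β).len = lenD β ∧ (rootSlotD β).col = rootColD β := by
  unfold rootSlotD rootColD
  split_ifs <;> exact ⟨rfl, rfl⟩

lemma rootSlotD_good (β : PosRootD n) : (rootSlotD β).Good n (aD n) (dD n) := by
  have hb := β.bounds
  unfold rootSlotD
  split_ifs with h
  · have := h.lenD_eq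
    exact sideSlotD_good hb.1 (by omega)
  · have := lenD_of_not_isSideD h
    exact slotD_good hb.1 this.1 this.2.2.1

lemma rootSlotD_act_ne {β γ : PosRootD n} {s : ℕ} {T : BTree} (hT : IsRootTreeD γ s T)
    (h : γ ≠ β) : (rootSlotD β).act T (rootSlotD β).full ∅ = 0 := by
  refine Slot.act_full_eq_zero T fun hp => h ?_
  rw [(rootSlotD_len_col β).1, (rootSlotD_len_col β).2, hT.letters] at hp
  exact (eq_of_perm_rootColD hp).symm

lemma rootSlotD_act (β : PosRootD n) :
    ∃ e : ℚ, e ≠ 0 ∧ ∀ s T, IsRootTreeD β s T →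
      (rootSlotD β).act T (rootSlotD β).full ∅ = e := by
  obtain ⟨p, hp⟩ : ∃ p, lenD β = p + 1 := ⟨lenD β - 1, by have := lenD_pos β; omega⟩
  have hne : chainFam (rootSlotD β).op (rootColD β) p (Slot.ind (Finset.range (p + 1))) ∅ ≠ 0 := by
    unfold rootSlotD rootColD
    split_ifs with h
    · have := h.lenD_eq
      exact sideSlotD_chainFam_ne (by omega) p (by omega)
    · have := lenD_of_not_isSideD h
      exact slotD_chainFam_ne (m := n - 1 - riD β) (by omega) (by omega) (by omega) p (by omega)
  refine ⟨_, hne, fun s T hT => ?_⟩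
  have hc := hT.chain
  rw [hp] at hc
  rw [Slot.act, IsChain.eval hc, Slot.full_eq_ind, (rootSlotD_len_col β).1, hp]

theorem linearIndependent_ordMonD {T : PosRootD n × ℕ → BTree}
    (hT : ∀ p, IsRootTreeD p.1 p.2 (T p)) :
    LinearIndependent RH fun h : Lex (PosRootD n × ℕ) →₀ ℕ =>
      ordMon (fun p => hbar • (T (ofLex p)).eval (genYD n)) h := by
  choose e he hE using rootSlotD_act (n := n)
  refine linearIndependent_ordMon (fun i => by simp [aD]) (fun i j h => aD_offdiag n i j h)
    (aD_symm' n) (dD_ne_zero n) (fun p => IsChain.deg (hT p))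
    rootSlotD (fun b => rootSlotD_good b)
    (fun b => by
      rw [(rootSlotD_len_col b).1]
      exact Nat.one_le_iff_ne_zero.1 (lenD_pos b)) he fun b p => ?_
  split_ifs with h
  · subst h
    exact hE _ _ _ (hT p)
  · exact rootSlotD_act_ne (hT p) h

end RootSlotD

section Forms
attribute [local instance] LieRing.ofAssociativeRing

variable {n : ℕ}

theorem exists_rootTreesC {X : PosRootC n × ℕ → YC n} (hX : ∀ p, IsRVYC p.1 p.2 (X p)) :
    ∃ T : PosRootC n × ℕ → BTree, (∀ p, IsRootTreeC p.1 p.2 (T p)) ∧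
      X = fun p => (T p).eval (genYC n) := by
  choose T hT e using fun p => (hX p).exists_tree
  exact ⟨T, hT, funext e⟩

theorem exists_rootTreesD {X : PosRootD n × ℕ → YD n} (hX : ∀ p, IsRVYD p.1 p.2 (X p)) :
    ∃ T : PosRootD n × ℕ → BTree, (∀ p, IsRootTreeD p.1 p.2 (T p)) ∧
      X = fun p => (T p).eval (genYD n) := by
  choose T hT e using fun p => (hX p).exists_tree
  exact ⟨T, hT, funext e⟩

theorem dgFormC_eq {X X' : PosRootC n × ℕ → YC n} (hX : ∀ p, IsRVYC p.1 p.2 (X p))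
    (hX' : ∀ p, IsRVYC p.1 p.2 (X' p)) : dgFormC X = dgFormC X' := by
  obtain ⟨T, hT, rfl⟩ := exists_rootTreesC hX
  obtain ⟨T', hT', rfl⟩ := exists_rootTreesC hX'
  unfold dgFormC genYC
  exact adjoin_eq_of_spansCurrent (fun i => by simp [aC]) (aC_offdiag n)
    (spansCurrentC hT) (spansCurrentC hT')

theorem dgFormD_eq (hn : 2 ≤ n) {X X' : PosRootD n × ℕ → YD n}
    (hX : ∀ p, IsRVYD p.1 p.2 (X p)) (hX' : ∀ p, IsRVYD p.1 p.2 (X' p)) :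
    dgFormD X = dgFormD X' := by
  obtain ⟨T, hT, rfl⟩ := exists_rootTreesD hX
  obtain ⟨T', hT', rfl⟩ := exists_rootTreesD hX'
  unfold dgFormD genYD
  exact adjoin_eq_of_spansCurrent (fun i => by simp [aD]) (aD_offdiag n)
    (spansCurrentD hn hT) (spansCurrentD hn hT')

theorem dgFormC_basis {X : PosRootC n × ℕ → YC n} (hX : ∀ p, IsRVYC p.1 p.2 (X p)) :
    LinearIndependent RH (fun h : Lex (PosRootC n × ℕ) →₀ ℕ =>
        ordMon (fun p => hbar • X (ofLex p)) h) ∧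
      Submodule.span RH (Set.range (fun h : Lex (PosRootC n × ℕ) →₀ ℕ =>
        ordMon (fun p => hbar • X (ofLex p)) h)) = Subalgebra.toSubmodule (dgFormC X) := by
  obtain ⟨T, hT, rfl⟩ := exists_rootTreesC hX
  refine ⟨linearIndependent_ordMonC hT, ?_⟩
  unfold dgFormC genYC
  exact span_ordMon_of_spansCurrent (fun i => by simp [aC]) (aC_offdiag n) (spansCurrentC hT)

theorem dgFormD_basis (hn : 2 ≤ n) {X : PosRootD n × ℕ → YD n}
    (hX : ∀ p, IsRVYD p.1 p.2 (X p)) :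
    LinearIndependent RH (fun h : Lex (PosRootD n × ℕ) →₀ ℕ =>
        ordMon (fun p => hbar • X (ofLex p)) h) ∧
      Submodule.span RH (Set.range (fun h : Lex (PosRootD n × ℕ) →₀ ℕ =>
        ordMon (fun p => hbar • X (ofLex p)) h)) = Subalgebra.toSubmodule (dgFormD X) := by
  obtain ⟨T, hT, rfl⟩ := exists_rootTreesD hX
  refine ⟨linearIndependent_ordMonD hT, ?_⟩
  unfold dgFormD genYD
  exact span_ordMon_of_spansCurrent (fun i => by simp [aD]) (aD_offdiag n) (spansCurrentD hn hT)

end Forms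

/-- **The Drinfeld–Gavarini dual `Ẏ_ħ^>(g)`** (`g` of type `C_n` with `n ≥ 2`, or of type
`D_n` with `n ≥ 4`): (a) the subalgebra `Ẏ_ħ^>(g)` generated by the `X̄_{β,s} = ħ·X_{β,s}`
does not depend on the choices of decompositions used in defining the root vectors
`X_{β,s}`; (b) for any fixed such choices, the ordered monomials `X̄_h` form a basis of
`Ẏ_ħ^>(g)` as a `ℚ[ħ]`-module. -/
theorem drinfeld_gavarini_dual (n : ℕ) :
    (2 ≤ n → ∀ X X' : PosRootC n × ℕ → YC n,
      (∀ p, IsRVYC p.1 p.2 (X p)) → (∀ p, IsRVYC p.1 p.2 (X' p)) →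
      dgFormC X = dgFormC X') ∧
    (2 ≤ n → ∀ X : PosRootC n × ℕ → YC n, (∀ p, IsRVYC p.1 p.2 (X p)) →
      LinearIndependent RH (fun h : Lex (PosRootC n × ℕ) →₀ ℕ =>
        ordMon (fun p => hbar • X (ofLex p)) h) ∧
      Submodule.span RH (Set.range (fun h : Lex (PosRootC n × ℕ) →₀ ℕ =>
        ordMon (fun p => hbar • X (ofLex p)) h)) = Subalgebra.toSubmodule (dgFormC X)) ∧
    (4 ≤ n → ∀ X X' : PosRootD n × ℕ → YD n,
      (∀ p, IsRVYD p.1 p.2 (X p)) → (∀ p, IsRVYD p.1 p.2 (X' p)) →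
      dgFormD X = dgFormD X') ∧
    (4 ≤ n → ∀ X : PosRootD n × ℕ → YD n, (∀ p, IsRVYD p.1 p.2 (X p)) →
      LinearIndependent RH (fun h : Lex (PosRootD n × ℕ) →₀ ℕ =>
        ordMon (fun p => hbar • X (ofLex p)) h) ∧
      Submodule.span RH (Set.range (fun h : Lex (PosRootD n × ℕ) →₀ ℕ =>
        ordMon (fun p => hbar • X (ofLex p)) h)) = Subalgebra.toSubmodule (dgFormD X)) := by
  exact ⟨fun _ _ _ hX hX' => dgFormC_eq hX hX', fun _ _ hX => dgFormC_basis hX,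
    fun hn _ _ hX hX' => dgFormD_eq (by omega) hX hX',
    fun hn _ hX => dgFormD_basis (by omega) hX⟩
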